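/- arXiv:1603.04180 — 3 statements merged into one kernel-verified Lean document; each statement's English description precedes it below -/
import Mathlib

section
/- Let η, ε > 0 and let k ≥ 4, 1 ≤ ℓ < k/2, and m ≥ 1 be integers. Then for every sufficiently large k-uniform hypergraph H = (V,E) on n vertices with δ_{k−2}(H) ≥ η·C(n,2) there is a set R ⊆ V with |R| ≤ εn such that for every j ≤ m and every collection X₁,Y₁,…,X_j,Y_j of 2j mutually disjoint ℓ-element vertex sets there exist ℓ-paths T₁,…,T_j in H of size at most 4 connecting (X_i,Y_i)_{i∈[j]} that contain vertices from (⋃_{i∈[j]} (X_i ∪ Y_i)) ∪ R only. -/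
open Finset

/-- Number of edges of the hypergraph `E` containing the vertex set `S`. -/
def degH {n : ℕ} (E : Finset (Finset (Fin n))) (S : Finset (Fin n)) : ℕ :=
  (E.filter fun e => S ⊆ e).card

/-- `vs` is (the vertex list of) an ℓ-path in the hypergraph `E`. -/
def IsPath {n : ℕ} (k l : ℕ) (E : Finset (Finset (Fin n))) (vs : List (Fin n)) : Prop :=
  vs.Nodup ∧ (∃ p : ℕ, 1 ≤ p ∧ vs.length = p * (k - l) + l) ∧
    ∀ i : ℕ, i * (k - l) + k ≤ vs.length →
      ((vs.drop (i * (k - l))).take k).toFinset ∈ E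

/-- The size (number of edges) of an ℓ-path given by the list `vs`. -/
def pathSize {n : ℕ} (k l : ℕ) (vs : List (Fin n)) : ℕ := (vs.length - l) / (k - l)

/-- The first end (first ℓ vertices) of an ℓ-path. -/
def firstEnd {n : ℕ} (l : ℕ) (vs : List (Fin n)) : Finset (Fin n) := (vs.take l).toFinset

/-- The last end (last ℓ vertices) of an ℓ-path. -/
def lastEnd {n : ℕ} (l : ℕ) (vs : List (Fin n)) : Finset (Fin n) :=
  (vs.drop (vs.length - l)).toFinset

/-- `X` and `Y` are joined by an ℓ-path of size at most four whose inner vertices lie in `V`. -/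
def Connected {n : ℕ} (k l : ℕ) (E : Finset (Finset (Fin n))) (X Y V : Finset (Fin n)) : Prop :=
  ∃ T : List (Fin n), IsPath k l E T ∧ pathSize k l T ≤ 4 ∧ firstEnd l T = X ∧
    lastEnd l T = Y ∧ T.toFinset ⊆ X ∪ Y ∪ V

/-- Being an edge, unless the cardinality is wrong. -/
def GoodSet {n : ℕ} (k : ℕ) (E : Finset (Finset (Fin n))) (S : Finset (Fin n)) : Prop :=
  S.card = k → S ∈ E

section Counting

open Classical in
/-- The number of elements satisfying a predicate. -/
noncomputable def countSat {A : Type*} [Fintype A] (P : A → Prop) : ℕ := (univ.filter P).card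

theorem countSat_le_of_injective {A B : Type*} [Fintype A] [Fintype B] {P : A → Prop}
    {Q : B → Prop} (f : A → B) (hf : Function.Injective f) (h : ∀ a, P a → Q (f a)) :
    countSat P ≤ countSat Q := by
  classical
  exact card_le_card_of_injOn f (fun a ha => by simpa using h a (by simpa using ha))
    hf.injOn

open Classical in
theorem le_card_filter_prod {A B : Type*} [Fintype A] [Fintype B] (P : A → Prop)
    (Q : A → B → Prop) {c d : ℝ} (hd : 0 ≤ d)
    (hP : c * Fintype.card A ≤ countSat P)
    (hQ : ∀ a, P a → d * Fintype.card B ≤ countSat (Q a)) :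
    c * d * (Fintype.card A * Fintype.card B) ≤
      countSat fun x : A × B => P x.1 ∧ Q x.1 x.2 := by
  simp only [countSat] at hP hQ
  have h1 : ((countSat fun x : A × B => P x.1 ∧ Q x.1 x.2) : ℝ)
      = ∑ a ∈ univ.filter P, ((univ.filter (Q a)).card : ℝ) := by
    simp only [countSat]
    rw [card_filter, Fintype.sum_prod_type, sum_filter]
    push_cast
    refine sum_congr rfl fun a _ => ?_
    by_cases h : P a <;> simp [h]
  rw [h1]
  calc c * d * (Fintype.card A * Fintype.card B)
      = (c * Fintype.card A) * (d * Fintype.card B) := by ring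
    _ ≤ (univ.filter P).card * (d * Fintype.card B) := by gcongr
    _ = ∑ a ∈ univ.filter P, d * Fintype.card B := by simp
    _ ≤ _ := sum_le_sum fun a ha => hQ a (by simpa using ha)

open Classical in
/-- A dense relation has densely many pairs of pairs with common second coordinate. -/
theorem le_card_filter_common {A B : Type*} [Fintype A] [Fintype B] (P : A → B → Prop)
    {c : ℝ} (hc : 0 ≤ c)
    (h : c * (Fintype.card A * Fintype.card B) ≤
      countSat fun x : A × B => P x.1 x.2) :
    c ^ 2 * (Fintype.card B * (Fintype.card A * Fintype.card A)) ≤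
      countSat fun x : B × A × A => P x.2.1 x.1 ∧ P x.2.2 x.1 := by
  simp only [countSat] at h
  set f : B → ℝ := fun b => ((univ.filter fun a => P a b).card : ℝ) with hf
  have h1 : ((univ.filter fun x : A × B => P x.1 x.2).card : ℝ) = ∑ b, f b := by
    rw [card_filter, Fintype.sum_prod_type_right]
    push_cast
    simp [hf]
  have h2 : ((countSat fun x : B × A × A => P x.2.1 x.1 ∧ P x.2.2 x.1) : ℝ)
      = ∑ b, f b ^ 2 := by
    simp only [countSat]
    rw [card_filter, Fintype.sum_prod_type]
    push_cast
    refine sum_congr rfl fun b _ => ?_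
    rw [hf, sq, ← Nat.cast_mul, ← card_product]
    simp only [Finset.sum_boole]
    congr 2
    ext x
    simp
  rw [h1] at h
  rw [h2]
  have h3 : (∑ b, f b) ^ 2 ≤ Fintype.card B * ∑ b, f b ^ 2 := by
    simpa using sq_sum_le_card_mul_sum_sq (s := (univ : Finset B)) (f := f)
  rcases Nat.eq_zero_or_pos (Fintype.card B) with h0 | h0
  · rw [h0, Nat.cast_zero, zero_mul, mul_zero]
    exact sum_nonneg fun _ _ => sq_nonneg _
  · have h0' : (0 : ℝ) < Fintype.card B := by exact_mod_cast h0
    have h4 : (c * (Fintype.card A * Fintype.card B)) ^ 2 ≤ (∑ b, f b) ^ 2 := by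
      gcongr
    refine le_of_mul_le_mul_left ?_ h0'
    calc _ = (c * (Fintype.card A * Fintype.card B)) ^ 2 := by ring
      _ ≤ _ := h4.trans h3

open Classical in
theorem card_mul_card_filter_le {ι α : Type*} [Fintype ι] [DecidableEq ι] [Fintype α] (i : ι)
    (P : (ι → α) → Prop)
    (hP : ∀ g g', P g → P g' → (∀ j, j ≠ i → g j = g' j) → g = g') :
    Fintype.card α * (univ.filter P).card ≤ Fintype.card α ^ Fintype.card ι := by
  rw [← Fintype.card_fun, ← card_univ (α := α), ← card_product, ← card_univ]
  refine card_le_card_of_injOn (fun x => Function.update x.2 i x.1) (fun _ _ => by simp) ?_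
  rintro ⟨v, g⟩ hg ⟨v', g'⟩ hg' h
  simp only [coe_product, Set.mem_prod, coe_filter, Set.mem_ofPred_eq, mem_univ, true_and] at hg hg'
  simp only at h
  have hv : v = v' := by simpa using congrFun h i
  have hgg : g = g' := hP g g' hg.2 hg'.2 fun j hj => by
    simpa [Function.update_of_ne hj] using congrFun h j
  rw [hv, hgg]

open Classical in
theorem card_mul_card_degenerate_le {ι α : Type*} [Fintype ι] [DecidableEq ι] [Fintype α]
    (W : Finset α) :
    Fintype.card α * (countSat fun g : ι → α => ¬ (Function.Injective g ∧ ∀ i, g i ∉ W)) ≤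
      (Fintype.card ι ^ 2 + Fintype.card ι * W.card) * Fintype.card α ^ Fintype.card ι := by
  set F : Finset (ι → α) :=
    ((univ : Finset (ι × ι)).filter fun x => x.1 ≠ x.2).biUnion
        (fun x => univ.filter fun g => g x.1 = g x.2) ∪
      ((univ : Finset ι) ×ˢ W).biUnion (fun x => univ.filter fun g => g x.1 = x.2) with hF
  have hsub : (countSat fun g : ι → α => ¬ (Function.Injective g ∧ ∀ i, g i ∉ W)) ≤ F.card := by
    refine card_le_card fun g hg => ?_
    simp only [mem_filter, mem_univ, true_and, not_and_or] at hg
    rw [hF, mem_union]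
    rcases hg with hg | hg
    · left
      simp only [Function.Injective, not_forall] at hg
      obtain ⟨a, b, hab, hne⟩ := hg
      simp only [mem_biUnion, mem_filter, mem_univ, true_and]
      exact ⟨(a, b), hne, hab⟩
    · right
      push Not at hg
      obtain ⟨i, hi⟩ := hg
      simp only [mem_biUnion, mem_filter, mem_univ, true_and, mem_product]
      exact ⟨(i, g i), hi, rfl⟩
  have h1 : ∀ x ∈ (univ : Finset (ι × ι)).filter (fun x => x.1 ≠ x.2),
      Fintype.card α * (univ.filter fun g : ι → α => g x.1 = g x.2).card ≤
        Fintype.card α ^ Fintype.card ι := by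
    intro x hx
    simp only [mem_filter, mem_univ, true_and] at hx
    refine card_mul_card_filter_le x.1 _ fun g g' hg hg' h => ?_
    funext j
    by_cases hj : j = x.1
    · rw [hj, hg, hg', h _ hx.symm]
    · exact h j hj
  have h2 : ∀ x ∈ (univ : Finset ι) ×ˢ W,
      Fintype.card α * (univ.filter fun g : ι → α => g x.1 = x.2).card ≤
        Fintype.card α ^ Fintype.card ι := by
    intro x _
    refine card_mul_card_filter_le x.1 _ fun g g' hg hg' h => ?_
    funext j
    by_cases hj : j = x.1
    · rw [hj, hg, hg']
    · exact h j hj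
  calc _ ≤ Fintype.card α * F.card := Nat.mul_le_mul_left _ hsub
    _ ≤ Fintype.card α * (∑ x ∈ (univ : Finset (ι × ι)).filter (fun x => x.1 ≠ x.2),
            (univ.filter fun g : ι → α => g x.1 = g x.2).card +
          ∑ x ∈ (univ : Finset ι) ×ˢ W, (univ.filter fun g : ι → α => g x.1 = x.2).card) :=
        Nat.mul_le_mul_left _ ((card_union_le _ _).trans
          (Nat.add_le_add card_biUnion_le card_biUnion_le))
    _ ≤ ((univ : Finset (ι × ι)).filter (fun x => x.1 ≠ x.2)).card *
            Fintype.card α ^ Fintype.card ι +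
          ((univ : Finset ι) ×ˢ W).card * Fintype.card α ^ Fintype.card ι := by
        rw [mul_add, mul_sum, mul_sum]
        refine Nat.add_le_add ?_ ?_
        · simpa using sum_le_card_nsmul _ _ _ h1
        · simpa using sum_le_card_nsmul _ _ _ h2
    _ ≤ _ := by
        rw [← add_mul]
        refine Nat.mul_le_mul_right _ (Nat.add_le_add ?_ (by simp))
        refine (card_filter_le _ _).trans ?_
        simp [sq]

/-- Greedy hitting sets for families of dense sets. -/
theorem exists_hitting_set {Ω I : Type*} [Fintype Ω] [Nonempty Ω] [DecidableEq Ω]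
    (F : Finset I) (G : I → Finset Ω) {c : ℝ} (hc : c ≤ 1)
    (hG : ∀ i ∈ F, c * Fintype.card Ω ≤ (G i).card) (N : ℕ) :
    ∃ L : Finset Ω, L.card ≤ N ∧
      ((F.filter fun i => Disjoint (G i) L).card : ℝ) ≤ (1 - c) ^ N * F.card := by
  induction N with
  | zero => exact ⟨∅, by simp⟩
  | succ N ih =>
    obtain ⟨L, hL, hF⟩ := ih
    set F' := F.filter fun i => Disjoint (G i) L with hF'
    have hsum : ∑ ω : Ω, c * (F'.card : ℝ) ≤
        ∑ ω : Ω, ((F'.filter fun i => ω ∈ G i).card : ℝ) := by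
      have h1 : ∑ ω : Ω, ((F'.filter fun i => ω ∈ G i).card : ℝ)
          = ∑ i ∈ F', ((G i).card : ℝ) := by
        have : ∀ ω : Ω, ((F'.filter fun i => ω ∈ G i).card : ℝ)
            = ∑ i ∈ F', if ω ∈ G i then (1 : ℝ) else 0 := by
          intro ω
          simp
        simp_rw [this]
        rw [sum_comm]
        simp
      rw [h1]
      calc ∑ ω : Ω, c * (F'.card : ℝ) = ∑ i ∈ F', c * (Fintype.card Ω : ℝ) := by
            simp only [sum_const, card_univ, nsmul_eq_mul]
            ring
        _ ≤ _ := sum_le_sum fun i hi => hG i (mem_filter.1 hi).1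
    obtain ⟨ω, -, hω⟩ := exists_le_of_sum_le univ_nonempty hsum
    refine ⟨insert ω L, (card_insert_le _ _).trans (by omega), ?_⟩
    have hsplit := card_filter_add_card_filter_not (s := F') (fun i => ω ∈ G i)
    have heq : (F.filter fun i => Disjoint (G i) (insert ω L))
        = F'.filter fun i => ¬ ω ∈ G i := by
      ext i
      simp only [hF', mem_filter, disjoint_insert_right]
      tauto
    rw [heq]
    have hs : ((F'.filter fun i => ω ∈ G i).card : ℝ) +
        (F'.filter fun i => ¬ ω ∈ G i).card = F'.card := by exact_mod_cast hsplit
    calc ((F'.filter fun i => ¬ ω ∈ G i).card : ℝ) ≤ (1 - c) * F'.card := by linarith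
      _ ≤ (1 - c) * ((1 - c) ^ N * F.card) :=
          mul_le_mul_of_nonneg_left hF (by linarith)
      _ = _ := by ring

end Counting

section Links

variable {n k : ℕ} {E : Finset (Finset (Fin n))} {η : ℝ}

open Classical in
theorem le_card_good_pairs (hη : 0 < η) (hn : 2 ≤ n) (hE : ∀ e ∈ E, e.card = k)
    (hdeg : ∀ S : Finset (Fin n), S.card = k - 2 → η * (Nat.choose n 2) ≤ (degH E S : ℝ))
    {S : Finset (Fin n)} (hS : S.card + 2 ≤ k) :
    min (η / 4) 1 * Fintype.card (Fin 2 → Fin n) ≤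
      countSat fun p : Fin 2 → Fin n => GoodSet k E (S ∪ univ.image p) := by
  simp only [countSat]
  have hn' : (2 : ℝ) ≤ n := by exact_mod_cast hn
  rcases hS.lt_or_eq with hlt | heq
  · have : (univ.filter fun p : Fin 2 → Fin n => GoodSet k E (S ∪ univ.image p)) = univ := by
      refine filter_true_of_mem fun p _ hp => ?_
      have h1 := card_union_le S (univ.image p)
      have h2 : (univ.image p).card ≤ 2 := card_image_le.trans (by simp)
      omega
    rw [this, card_univ]
    exact mul_le_of_le_one_left (by positivity) (min_le_right _ _)
  · have h1 : (E.filter fun e => S ⊆ e) ⊆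
        (univ.filter fun p : Fin 2 → Fin n => GoodSet k E (S ∪ univ.image p)).image
          (fun p => S ∪ univ.image p) := by
      intro e he
      rw [mem_filter] at he
      have hc : (e \ S).card = 2 := by
        rw [card_sdiff_of_subset he.2, hE e he.1]
        omega
      obtain ⟨a, b, -, hab⟩ := card_eq_two.1 hc
      have hSe : S ∪ univ.image ![a, b] = e := by
        have : univ.image ![a, b] = e \ S := by
          rw [hab]
          ext x
          simp [eq_comm]
        rw [this, union_sdiff_of_subset he.2]
      refine mem_image.2 ⟨![a, b], ?_, hSe⟩
      rw [mem_filter, hSe]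
      exact ⟨mem_univ _, fun _ => he.1⟩
    have h2 : degH E S ≤ _ := (card_le_card h1).trans card_image_le
    have h3 := hdeg S (by omega)
    rw [Nat.cast_choose_two] at h3
    calc min (η / 4) 1 * (Fintype.card (Fin 2 → Fin n) : ℝ) ≤ η / 4 * (n : ℝ) ^ 2 := by
          simp only [Fintype.card_fun, Fintype.card_fin, Nat.cast_pow]
          gcongr
          exact min_le_left _ _
      _ ≤ η * (n * (n - 1) / 2) := by nlinarith [mul_pos hη (by linarith : (0 : ℝ) < n)]
      _ ≤ degH E S := h3
      _ ≤ _ := by exact_mod_cast h2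

open Classical in
theorem le_card_good_tuples (hη : 0 < η) (hn : 2 ≤ n) (hE : ∀ e ∈ E, e.card = k)
    (hdeg : ∀ S : Finset (Fin n), S.card = k - 2 → η * (Nat.choose n 2) ≤ (degH E S : ℝ))
    {S : Finset (Fin n)} (s : ℕ) (hS : S.card + (s + 2) ≤ k) :
    min (η / 4) 1 * Fintype.card (Fin (s + 2) → Fin n) ≤
      countSat fun p : Fin (s + 2) → Fin n => GoodSet k E (S ∪ univ.image p) := by
  have h := le_card_filter_prod (A := Fin s → Fin n) (B := Fin 2 → Fin n) (fun _ => True)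
    (fun h p => GoodSet k E ((S ∪ univ.image h) ∪ univ.image p)) (c := 1)
    (d := min (η / 4) 1) (by positivity) (by simp [countSat]) (fun h _ => by
      refine le_card_good_pairs hη hn hE hdeg ?_
      have h1 := card_union_le S (univ.image h)
      have h2 : (univ.image h).card ≤ s := card_image_le.trans (by simp)
      omega)
  calc min (η / 4) 1 * (Fintype.card (Fin (s + 2) → Fin n) : ℝ) = _ := by
        simp only [Fintype.card_fun, Fintype.card_fin]
        push_cast
        rw [pow_add, one_mul]
    _ ≤ _ := h
    _ ≤ _ := by
        norm_cast
        refine countSat_le_of_injective (fun x => Fin.append x.1 x.2) ?_ ?_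
        rotate_left
        · intro x hx
          convert hx.2 using 1
          ext v
          simp only [mem_union, mem_image, mem_univ, true_and, or_assoc]
          refine or_congr_right ?_
          constructor
          · rintro ⟨i, rfl⟩
            induction i using Fin.addCases with
            | left i => exact Or.inl ⟨i, by simp⟩
            | right i => exact Or.inr ⟨i, by simp⟩
          · rintro (⟨i, rfl⟩ | ⟨i, rfl⟩)
            · exact ⟨Fin.castAdd 2 i, by simp⟩
            · exact ⟨Fin.natAdd s i, by simp⟩
        · rintro ⟨a, b⟩ ⟨a', b'⟩ h
          simp only at h
          rw [Prod.mk.injEq]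
          constructor
          · funext i
            simpa using congrFun h (Fin.castAdd 2 i)
          · funext i
            simpa using congrFun h (Fin.natAdd s i)

end Links

section Paths

variable {n k l : ℕ} {E : Finset (Finset (Fin n))}

theorem IsPath.of_goodSet {T : List (Fin n)} (hT : T.Nodup) {p : ℕ} (hp : 1 ≤ p)
    (hlen : T.length = p * (k - l) + l)
    (h : ∀ i : ℕ, i * (k - l) + k ≤ T.length →
      GoodSet k E ((T.drop (i * (k - l))).take k).toFinset) : IsPath k l E T := by
  refine ⟨hT, ⟨p, hp, hlen⟩, fun i hi => h i hi ?_⟩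
  rw [List.toFinset_card_of_nodup
    (hT.sublist ((List.take_sublist _ _).trans (List.drop_sublist _ _)))]
  simp only [List.length_take, List.length_drop]
  omega

theorem List.nodup_of_length_le_card_toFinset {α : Type*} [DecidableEq α] {L : List α}
    (h : L.length ≤ L.toFinset.card) : L.Nodup := by
  rw [List.card_toFinset] at h
  exact List.dedup_eq_self.1 ((List.dedup_sublist L).eq_of_length_le h)

theorem Connected.of_edge {X Y V : Finset (Fin n)} (hl : l < k) (hX : X.card = l) (hY : Y.card = l)
    (hXY : (X ∪ Y ∪ V).card = k) (hV : V.card + 2 * l = k) (h : X ∪ Y ∪ V ∈ E) :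
    Connected k l E X Y V := by
  have hfin : (X.toList ++ (V.toList ++ Y.toList)).toFinset = X ∪ Y ∪ V := by
    ext x
    simp only [List.mem_toFinset, List.mem_append, mem_toList, mem_union]
    tauto
  have hlen : (X.toList ++ (V.toList ++ Y.toList)).length = k := by
    simp only [List.length_append, length_toList]
    omega
  refine ⟨X.toList ++ (V.toList ++ Y.toList), IsPath.of_goodSet (p := 1) ?_ le_rfl ?_ ?_,
    ?_, ?_, ?_, hfin.subset⟩
  · refine List.nodup_of_length_le_card_toFinset ?_
    rw [hfin, hXY, hlen]
  · rw [hlen]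
    omega
  · intro i hi
    rw [hlen] at hi
    have hi0 : i * (k - l) = 0 := by omega
    rw [hi0, List.drop_zero, List.take_of_length_le hlen.le, hfin]
    exact fun _ => h
  · rw [pathSize, hlen, Nat.div_self (by omega)]
    norm_num
  · rw [firstEnd, List.take_left' (by simpa using hX), toList_toFinset]
  · rw [lastEnd, hlen, ← List.append_assoc, List.drop_left', toList_toFinset]
    simp only [List.length_append, length_toList]
    omega

theorem Connected.of_four_edges {X Y V : Finset (Fin n)} {A B C : List (Fin n)}
    {a b c d : Fin n} (hk : k = 2 * l + 1) (hX : X.card = l) (hY : Y.card = l)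
    (hA : A.length = l) (hB : B.length = l) (hC : C.length = l)
    (hV : (X.toList ++ a :: (A ++ b :: (B ++ c :: (C ++ d :: Y.toList)))).toFinset ⊆ X ∪ Y ∪ V)
    (hcard : 5 * l + 4 ≤
      (X.toList ++ a :: (A ++ b :: (B ++ c :: (C ++ d :: Y.toList)))).toFinset.card)
    (h1 : GoodSet k E (X.toList ++ a :: A).toFinset)
    (h2 : GoodSet k E (A ++ b :: B).toFinset)
    (h3 : GoodSet k E (B ++ c :: C).toFinset)
    (h4 : GoodSet k E (C ++ d :: Y.toList).toFinset) :
    Connected k l E X Y V := by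
  have hX' : X.toList.length = l := by simpa using hX
  have hY' : Y.toList.length = l := by simpa using hY
  have hkl : k - l = l + 1 := by omega
  have hdrop : ∀ (A : List (Fin n)) (a : Fin n) (R : List (Fin n)) (m : ℕ), A.length = l →
      (A ++ a :: R).drop (l + 1 + m) = R.drop m := by
    intro A a R m hA
    rw [List.drop_append, List.drop_of_length_le (by omega), hA,
      show l + 1 + m - l = m + 1 by omega]
    simp
  have htake : ∀ (A B : List (Fin n)) (a : Fin n) (R : List (Fin n)), A.length = l →
      B.length = l → (A ++ a :: (B ++ R)).take k = A ++ a :: B := by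
    intro A B a R hA hB
    rw [← List.cons_append, ← List.append_assoc, List.take_left']
    simp only [List.length_append, List.length_cons]
    omega
  set T := X.toList ++ a :: (A ++ b :: (B ++ c :: (C ++ d :: Y.toList))) with hT
  have hlen : T.length = 5 * l + 4 := by
    simp only [hT, List.length_append, List.length_cons]
    omega
  refine ⟨T, IsPath.of_goodSet (p := 4) ?_ (by norm_num) ?_ ?_, ?_, ?_, ?_, hV⟩
  · refine List.nodup_of_length_le_card_toFinset ?_
    rw [hlen]
    exact hcard
  · rw [hlen, hkl]
    ring
  · intro i hi
    rw [hlen, hkl] at hi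
    have hi3 : i ≤ 3 := by
      by_contra! hcon
      have := Nat.mul_le_mul_right (l + 1) hcon
      omega
    rw [hkl]
    interval_cases i
    · rw [zero_mul, List.drop_zero, hT, htake _ _ _ _ hX' hA]
      exact h1
    · rw [show 1 * (l + 1) = l + 1 + 0 by ring, hT, hdrop _ _ _ _ hX', List.drop_zero,
        htake _ _ _ _ hA hB]
      exact h2
    · rw [show 2 * (l + 1) = l + 1 + (l + 1 + 0) by ring, hT, hdrop _ _ _ _ hX',
        hdrop _ _ _ _ hA, List.drop_zero, htake _ _ _ _ hB hC]
      exact h3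
    · rw [show 3 * (l + 1) = l + 1 + (l + 1 + (l + 1 + 0)) by ring, hT, hdrop _ _ _ _ hX',
        hdrop _ _ _ _ hA, hdrop _ _ _ _ hB, List.drop_zero, List.take_of_length_le]
      · exact h4
      · simp only [List.length_append, List.length_cons]
        omega
  · rw [pathSize, hlen, hkl, show 5 * l + 4 - l = 4 * (l + 1) by omega,
      Nat.mul_div_cancel _ (by omega)]
  · rw [firstEnd, hT, List.take_left' hX', toList_toFinset]
  · rw [lastEnd, hlen,
      show 5 * l + 4 - l = l + 1 + (l + 1 + (l + 1 + (l + 1 + 0))) by omega, hT,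
      hdrop _ _ _ _ hX', hdrop _ _ _ _ hA, hdrop _ _ _ _ hB, hdrop _ _ _ _ hC, List.drop_zero,
      toList_toFinset]

end Paths

section Density

variable {n k l : ℕ} {E : Finset (Finset (Fin n))} {η : ℝ}

theorem image_univ_sum_elim {ι κ : Type*} [Fintype ι] [Fintype κ] (f : ι → Fin n)
    (g : κ → Fin n) : univ.image (Sum.elim f g) = univ.image f ∪ univ.image g := by
  ext x
  simp

theorem image_univ_fin_two (p : Fin 2 → Fin n) : univ.image p = {p 0, p 1} := by
  ext x
  simp [Fin.exists_fin_two, eq_comm]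

theorem toFinset_ofFn {s : ℕ} (f : Fin s → Fin n) : (List.ofFn f).toFinset = univ.image f := by
  ext x
  simp

theorem card_union_image_of_injective {ι : Type*} [Fintype ι] {X Y : Finset (Fin n)}
    (hX : X.card = l) (hY : Y.card = l) (hXY : Disjoint X Y) {g : ι → Fin n}
    (hg : Function.Injective g) (hgXY : ∀ i, g i ∉ X ∪ Y) :
    (X ∪ Y ∪ univ.image g).card = 2 * l + Fintype.card ι := by
  rw [card_union_of_disjoint, card_union_of_disjoint hXY, card_image_of_injective _ hg, hX, hY,
    card_univ]
  · ring
  · rw [Finset.disjoint_right]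
    intro x hx
    obtain ⟨i, -, rfl⟩ := mem_image.1 hx
    exact hgXY i

theorem le_card_connected_of_two_mul_add_two_le (hη : 0 < η) (hl : 2 * l + 2 ≤ k)
    (hn : 2 ≤ n) (hE : ∀ e ∈ E, e.card = k)
    (hdeg : ∀ S : Finset (Fin n), S.card = k - 2 → η * (Nat.choose n 2) ≤ (degH E S : ℝ))
    {X Y : Finset (Fin n)} (hX : X.card = l) (hY : Y.card = l) (hXY : Disjoint X Y) :
    min (η / 4) 1 * Fintype.card (Fin (k - 2 * l - 2 + 2) → Fin n) ≤
      countSat fun g : Fin (k - 2 * l - 2 + 2) → Fin n => Function.Injective g →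
        (∀ i, g i ∉ X ∪ Y) → Connected k l E X Y (univ.image g) := by
  have hc := card_union_of_disjoint hXY
  refine (le_card_good_tuples hη hn hE hdeg (S := X ∪ Y) (k - 2 * l - 2) (by omega)).trans ?_
  norm_cast
  refine countSat_le_of_injective id Function.injective_id fun g hg hinj hdis => ?_
  simp only [id_eq] at hinj hdis ⊢
  have h1 := card_union_image_of_injective hX hY hXY hinj hdis
  rw [Fintype.card_fin] at h1
  have h2 : (X ∪ Y ∪ univ.image g).card = k := by omega
  refine Connected.of_edge (by omega) hX hY h2 ?_ (hg h2)
  rw [card_image_of_injective _ hinj, card_univ, Fintype.card_fin]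
  omega

/-- Index type for the vertices chosen on one side of the middle set: `s + 1` vertices and two pairs. -/
abbrev SideIndex (s : ℕ) : Type := Fin (s + 1) ⊕ (Fin 2 ⊕ Fin 2)

theorem le_card_connected_of_eq_two_mul_add_one {s : ℕ} (hη : 0 < η) (hk : k = 2 * (s + 2) + 1)
    (hn : 2 ≤ n) (hE : ∀ e ∈ E, e.card = k)
    (hdeg : ∀ S : Finset (Fin n), S.card = k - 2 → η * (Nat.choose n 2) ≤ (degH E S : ℝ))
    {X Y : Finset (Fin n)} (hX : X.card = s + 2) (hY : Y.card = s + 2) (hXY : Disjoint X Y) :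
    (min (η / 4) 1) ^ 6 *
        Fintype.card (Fin (s + 2) ⊕ (SideIndex s ⊕ SideIndex s) → Fin n) ≤
      countSat fun g : Fin (s + 2) ⊕ (SideIndex s ⊕ SideIndex s) → Fin n =>
        Function.Injective g → (∀ i, g i ∉ X ∪ Y) →
          Connected k (s + 2) E X Y (univ.image g) := by
  set c := min (η / 4) 1 with hc
  have hc0 : 0 < c := by positivity
  have hB : ∀ B : Fin (s + 1) → Fin n, (univ.image B).card ≤ s + 1 := fun B =>
    card_image_le.trans (by simp)
  let P₁ (Z : Finset (Fin n)) (B : Fin (s + 1) → Fin n) (p : Fin 2 → Fin n) : Prop :=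
    GoodSet k E (Z ∪ univ.image B ∪ univ.image p)
  have hP₁ : ∀ Z : Finset (Fin n), Z.card = s + 2 → ∀ B,
      c * Fintype.card (Fin 2 → Fin n) ≤ countSat (P₁ Z B) := fun Z hZ B =>
    le_card_good_pairs hη hn hE hdeg (by
      have h1 := card_union_le Z (univ.image B)
      have h2 := hB B
      omega)
  let P (q : (Fin (s + 1) → Fin n) × (Fin 2 → Fin n) × (Fin 2 → Fin n)) : Prop :=
    P₁ X q.1 q.2.1 ∧ P₁ Y q.1 q.2.2
  have hP : c * c * Fintype.card ((Fin (s + 1) → Fin n) × (Fin 2 → Fin n) × (Fin 2 → Fin n)) ≤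
      countSat P := by
    have h := le_card_filter_prod (A := Fin (s + 1) → Fin n)
      (B := (Fin 2 → Fin n) × (Fin 2 → Fin n)) (fun _ => True)
      (fun B x => P₁ X B x.1 ∧ P₁ Y B x.2) (c := 1) (d := c * c) (by positivity)
      (by simp [countSat])
      (fun B _ => by
        rw [Fintype.card_prod, Nat.cast_mul]
        exact le_card_filter_prod (P₁ X B) (fun _ => P₁ Y B) hc0.le (hP₁ X hX B)
          (fun _ _ => hP₁ Y hY B))
    rw [Fintype.card_prod ((Fin (s + 1) → Fin n)), Nat.cast_mul]
    simpa only [one_mul, true_and] using h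
  let Q (q : (Fin (s + 1) → Fin n) × (Fin 2 → Fin n) × (Fin 2 → Fin n))
      (U : Fin (s + 2) → Fin n) : Prop :=
    GoodSet k E (univ.image q.1 ∪ {q.2.1 0, q.2.2 0} ∪ univ.image U)
  have hQ : ∀ q, P q → c * Fintype.card (Fin (s + 2) → Fin n) ≤ countSat (Q q) := by
    intro q _
    refine le_card_good_tuples hη hn hE hdeg s ?_
    have h1 := card_union_le (univ.image q.1) {q.2.1 0, q.2.2 0}
    have h2 := hB q.1
    have h3 : ({q.2.1 0, q.2.2 0} : Finset (Fin n)).card ≤ 2 := card_le_two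
    omega
  have key := le_card_filter_common (fun q U => P q ∧ Q q U) (c := c * c * c) (by positivity)
    (le_card_filter_prod P Q hc0.le hP hQ)
  refine le_trans (le_of_eq ?_) (key.trans ?_)
  · simp only [Fintype.card_prod, Fintype.card_fun, Fintype.card_fin, Fintype.card_sum]
    push_cast
    ring
  norm_cast
  let φ (q : (Fin (s + 1) → Fin n) × (Fin 2 → Fin n) × (Fin 2 → Fin n)) :
    SideIndex s → Fin n := Sum.elim q.1 (Sum.elim q.2.1 q.2.2)
  refine countSat_le_of_injective
    (fun x => Sum.elim x.1 (Sum.elim (φ x.2.1) (φ x.2.2))) ?_ ?_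
  rotate_left
  · rintro ⟨U, ⟨B, p, r⟩, ⟨B', p', r'⟩⟩ ⟨⟨⟨h1, -⟩, h2⟩, ⟨-, h4⟩, h3⟩ hinj hdis
    simp only [P₁] at h1 h4
    have hcard := card_union_image_of_injective hX hY hXY hinj hdis
    have hfin : X ∪ Y ∪ univ.image (Sum.elim U (Sum.elim (φ (B, p, r)) (φ (B', p', r')))) =
        insert (p' 1) (insert (r 1) (X.toList ++ p 1 :: (List.ofFn B ++ [p 0] ++ r 0 ::
          (List.ofFn U ++ p' 0 :: (List.ofFn B' ++ [r' 0] ++ r' 1 :: Y.toList)))).toFinset) := by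
      simp only [φ, image_univ_sum_elim, image_univ_fin_two, List.toFinset_append,
        List.toFinset_cons, toList_toFinset, toFinset_ofFn, List.toFinset_nil, insert_eq,
        union_empty]
      ac_rfl
    refine Connected.of_four_edges (A := List.ofFn B ++ [p 0]) (B := List.ofFn U)
      (C := List.ofFn B' ++ [r' 0]) (a := p 1) (b := r 0) (c := p' 0) (d := r' 1)
      hk hX hY (by simp) (by simp) (by simp) ?_ ?_ ?_ ?_ ?_ ?_
    · rw [hfin]
      exact (subset_insert _ _).trans (subset_insert _ _)
    · rw [hfin] at hcard
      simp only [Fintype.card_sum, Fintype.card_fin] at hcard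
      have h5 := (card_insert_le _ _).trans (Nat.add_le_add_right (card_insert_le _ _) 1) |>.trans'
        hcard.ge
      omega
    · convert h1 using 1
      simp only [image_univ_fin_two, List.toFinset_append, List.toFinset_cons, toList_toFinset,
        toFinset_ofFn, List.toFinset_nil,
        insert_eq, union_empty]
      ac_rfl
    · convert h2 using 1
      simp only [List.toFinset_append, List.toFinset_cons, toFinset_ofFn, List.toFinset_nil,
        insert_eq, union_empty]
      ac_rfl
    · convert h3 using 1
      simp only [List.toFinset_append, List.toFinset_cons, toFinset_ofFn, List.toFinset_nil,
        insert_eq, union_empty]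
      ac_rfl
    · convert h4 using 1
      simp only [image_univ_fin_two, List.toFinset_append, List.toFinset_cons, toList_toFinset,
        toFinset_ofFn, List.toFinset_nil, insert_eq, union_empty]
      ac_rfl
  · rintro ⟨U, ⟨B, p, r⟩, ⟨B', p', r'⟩⟩ ⟨U₁, ⟨B₁, p₁, r₁⟩, ⟨B₁', p₁', r₁'⟩⟩ h
    simpa [φ, Sum.elim_eq_iff] using h

theorem exists_dense_connected {k l : ℕ} {η : ℝ} (hη : 0 < η) (hk : 4 ≤ k) (hl : 2 * l < k) :
    ∃ (ι : Type) (_ : Fintype ι) (_ : DecidableEq ι) (c : ℝ), 0 < c ∧ c ≤ 1 ∧ ∀ n : ℕ, 2 ≤ n →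
      ∀ E : Finset (Finset (Fin n)), (∀ e ∈ E, e.card = k) →
        (∀ S : Finset (Fin n), S.card = k - 2 → η * (Nat.choose n 2) ≤ (degH E S : ℝ)) →
        ∀ X Y : Finset (Fin n), X.card = l → Y.card = l → Disjoint X Y →
          c * Fintype.card (ι → Fin n) ≤
            countSat fun g : ι → Fin n => Function.Injective g → (∀ i, g i ∉ X ∪ Y) →
              Connected k l E X Y (univ.image g) := by
  rcases Nat.lt_or_ge (2 * l + 1) k with h | h
  · exact ⟨Fin (k - 2 * l - 2 + 2), inferInstance, inferInstance, min (η / 4) 1, by positivity,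
      min_le_right _ _, fun n hn E hE hdeg X Y hX hY hXY =>
        le_card_connected_of_two_mul_add_two_le hη h hn hE hdeg hX hY hXY⟩
  · obtain ⟨s, rfl⟩ : ∃ s, l = s + 2 := ⟨l - 2, by omega⟩
    exact ⟨Fin (s + 2) ⊕ (SideIndex s ⊕ SideIndex s), inferInstance, inferInstance,
      min (η / 4) 1 ^ 6,
      by positivity, pow_le_one₀ (by positivity) (min_le_right _ _),
      fun n hn E hE hdeg X Y hX hY hXY =>
        le_card_connected_of_eq_two_mul_add_one hη (by omega) hn hE hdeg hX hY hXY⟩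

theorem le_card_connected_avoiding {n k l : ℕ} {E : Finset (Finset (Fin n))} {ι : Type*}
    [Fintype ι] [DecidableEq ι] {c : ℝ} {X Y W : Finset (Fin n)} (hn : 0 < n)
    (h : c * Fintype.card (ι → Fin n) ≤
      countSat fun g : ι → Fin n => Function.Injective g → (∀ i, g i ∉ X ∪ Y) →
        Connected k l E X Y (univ.image g))
    (hW : X ∪ Y ⊆ W)
    (hlarge : 2 * ((Fintype.card ι : ℝ) ^ 2 + Fintype.card ι * W.card) ≤ c * n) :
    c / 2 * Fintype.card (ι → Fin n) ≤
      countSat fun g : ι → Fin n => (∀ i, g i ∉ W) ∧ Connected k l E X Y (univ.image g) := by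
  classical
  set bad := countSat fun g : ι → Fin n => ¬ (Function.Injective g ∧ ∀ i, g i ∉ W) with hb
  have h1 : (countSat fun g : ι → Fin n => Function.Injective g → (∀ i, g i ∉ X ∪ Y) →
        Connected k l E X Y (univ.image g)) ≤
      (countSat fun g : ι → Fin n => (∀ i, g i ∉ W) ∧ Connected k l E X Y (univ.image g)) +
        bad := by
    simp only [hb, countSat]
    refine (card_le_card fun g hg => ?_).trans (card_union_le _ _)
    simp only [mem_filter, mem_univ, true_and, mem_union] at hg ⊢
    by_cases hbad : Function.Injective g ∧ ∀ i, g i ∉ W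
    · exact Or.inl ⟨hbad.2, hg hbad.1 fun i hi => hbad.2 i (hW (by simpa using hi))⟩
    · exact Or.inr hbad
  have h1' := h.trans (Nat.cast_le.2 h1)
  push_cast at h1'
  have hbad : (n : ℝ) * bad ≤
      ((Fintype.card ι : ℝ) ^ 2 + Fintype.card ι * W.card) * Fintype.card (ι → Fin n) := by
    have := card_mul_card_degenerate_le (ι := ι) W
    rw [← Fintype.card_fun, Fintype.card_fin] at this
    exact_mod_cast this
  have hn' : (0 : ℝ) < n := by exact_mod_cast hn
  have hbad' : (bad : ℝ) ≤ c / 2 * Fintype.card (ι → Fin n) := by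
    refine le_of_mul_le_mul_left (hbad.trans ?_) hn'
    rw [← mul_assoc]
    gcongr
    linarith
  simp only [Fintype.card_fun, Fintype.card_fin, Nat.cast_pow] at h1' hbad' ⊢
  linarith

end Density

theorem exists_mul_le_and_pow_mul_pow_lt_one {c ε : ℝ} (hc0 : 0 < c) (hc1 : c ≤ 1) (hε : 0 < ε)
    (t K : ℕ) :
    ∃ n₀ : ℕ, ∀ n : ℕ, n₀ ≤ n → ∃ N : ℕ, (N : ℝ) * t ≤ ε * n ∧
      (1 - c) ^ N * (n : ℝ) ^ K < 1 := by
  set δ := ε / (t + 1) with hδ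
  have hδ0 : 0 < δ := by positivity
  have ha : 0 < c * δ := by positivity
  have htend : Filter.Tendsto (fun n : ℕ => (c * δ * n) ^ K * Real.exp (-(c * δ * n)))
      Filter.atTop (nhds 0) :=
    (Real.tendsto_pow_mul_exp_neg_atTop_nhds_zero K).comp
      (tendsto_natCast_atTop_atTop.const_mul_atTop ha)
  obtain ⟨n₀, hn₀⟩ := Filter.eventually_atTop.1
    (htend.eventually_lt_const (show 0 < (c * δ) ^ K * Real.exp (-c) by positivity))
  refine ⟨n₀, fun n hn => ⟨⌊δ * n⌋₊, ?_, ?_⟩⟩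
  · have h1 : (⌊δ * n⌋₊ : ℝ) ≤ δ * n := Nat.floor_le (by positivity)
    calc (⌊δ * n⌋₊ : ℝ) * t ≤ δ * n * (t + 1) := by
          gcongr
          linarith
      _ = ε * n := by
          rw [hδ]
          field_simp
  · have h1 := hn₀ n hn
    rw [mul_pow, mul_assoc] at h1
    have h2 : (n : ℝ) ^ K * Real.exp (-(c * δ * n)) < Real.exp (-c) :=
      lt_of_mul_lt_mul_left h1 (by positivity)
    have h3 : δ * n - 1 ≤ ⌊δ * n⌋₊ := (Nat.sub_one_lt_floor _).le
    have h4 : (1 - c) ^ ⌊δ * (n : ℝ)⌋₊ ≤ Real.exp c * Real.exp (-(c * δ * n)) := by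
      calc (1 - c) ^ ⌊δ * (n : ℝ)⌋₊ ≤ Real.exp (-c) ^ ⌊δ * (n : ℝ)⌋₊ := by
            exact pow_le_pow_left₀ (by linarith) (Real.one_sub_le_exp_neg c) _
        _ = Real.exp (⌊δ * (n : ℝ)⌋₊ * -c) := (Real.exp_nat_mul _ _).symm
        _ ≤ Real.exp (c + -(c * δ * n)) := Real.exp_le_exp.2 (by nlinarith)
        _ = _ := Real.exp_add _ _
    calc (1 - c) ^ ⌊δ * (n : ℝ)⌋₊ * (n : ℝ) ^ K
        ≤ Real.exp c * Real.exp (-(c * δ * n)) * (n : ℝ) ^ K := by gcongr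
      _ = Real.exp c * ((n : ℝ) ^ K * Real.exp (-(c * δ * n))) := by ring
      _ < Real.exp c * Real.exp (-c) := by gcongr
      _ = 1 := by rw [← Real.exp_add, add_neg_cancel, Real.exp_zero]

/-- A reservoir: a small set through which any two disjoint ℓ-sets can be connected, even when
`M` prescribed vertices have to be avoided. -/
theorem exists_reservoir {η ε : ℝ} (hη : 0 < η) (hε : 0 < ε) {k l : ℕ} (hk : 4 ≤ k)
    (hl : 2 * l < k) :
    ∃ t : ℕ, ∀ M : ℕ, ∃ n₀ : ℕ, ∀ n : ℕ, n₀ ≤ n →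
      ∀ E : Finset (Finset (Fin n)), (∀ e ∈ E, e.card = k) →
        (∀ S : Finset (Fin n), S.card = k - 2 → η * (Nat.choose n 2) ≤ (degH E S : ℝ)) →
        ∃ R : Finset (Fin n), (R.card : ℝ) ≤ ε * n ∧
          ∀ X Y W : Finset (Fin n), X.card = l → Y.card = l → Disjoint X Y → X ∪ Y ⊆ W →
            W.card ≤ M → ∃ V ⊆ R, V.card ≤ t ∧ Disjoint V W ∧ Connected k l E X Y V := by
  classical
  obtain ⟨ι, _, _, c, hc0, hc1, hdense⟩ := exists_dense_connected hη hk hl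
  refine ⟨Fintype.card ι, fun M => ?_⟩
  set t := Fintype.card ι with ht
  obtain ⟨n₁, hn₁⟩ := exists_mul_le_and_pow_mul_pow_lt_one (c := c / 2) (by positivity)
    (by linarith) hε t (l + l + M)
  obtain ⟨n₂, hn₂⟩ := exists_nat_ge (2 * ((t : ℝ) ^ 2 + t * M) / c)
  refine ⟨max (max n₁ n₂) (max 2 M), fun n hn E hE hdeg => ?_⟩
  simp only [max_le_iff] at hn
  obtain ⟨⟨h1, h2⟩, h3, h4⟩ := hn
  obtain ⟨N, hN, hNlt⟩ := hn₁ n h1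
  have : Nonempty (Fin n) := ⟨⟨0, by omega⟩⟩
  have hlarge : 2 * ((t : ℝ) ^ 2 + t * M) ≤ c * n := by
    rw [div_le_iff₀' hc0] at hn₂
    refine hn₂.trans ?_
    gcongr
  let F : Finset ((Finset (Fin n) × Finset (Fin n)) × Finset (Fin n)) :=
    ((powersetCard l univ ×ˢ powersetCard l univ) ×ˢ powersetCard M univ).filter
      fun x => Disjoint x.1.1 x.1.2 ∧ x.1.1 ∪ x.1.2 ⊆ x.2
  let G (x : (Finset (Fin n) × Finset (Fin n)) × Finset (Fin n)) : Finset (ι → Fin n) :=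
    univ.filter fun g => (∀ i, g i ∉ x.2) ∧ Connected k l E x.1.1 x.1.2 (univ.image g)
  have hFcard : (F.card : ℝ) ≤ (n : ℝ) ^ (l + l + M) := by
    have : F.card ≤ n ^ (l + l + M) := by
      refine (card_filter_le _ _).trans ?_
      rw [card_product, card_product, card_powersetCard, card_powersetCard, card_univ,
        Fintype.card_fin, pow_add, pow_add]
      gcongr <;> exact Nat.choose_le_pow _ _
    exact_mod_cast this
  have hG : ∀ x ∈ F, c / 2 * Fintype.card (ι → Fin n) ≤ (G x).card := by
    rintro ⟨⟨X, Y⟩, W⟩ hx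
    simp only [F, mem_filter, mem_product, mem_powersetCard_univ] at hx
    obtain ⟨⟨⟨hX, hY⟩, hW⟩, hXY, hsub⟩ := hx
    have h := le_card_connected_avoiding (by omega) (hdense n h3 E hE hdeg X Y hX hY hXY) hsub
      (by rw [hW]; exact hlarge)
    simp only [countSat] at h
    refine h.trans_eq ?_
    simp only [G]
    congr!
  obtain ⟨L, hL, hmiss⟩ := exists_hitting_set F G (c := c / 2) (by linarith) hG N
  have hempty := (hmiss.trans (mul_le_mul_of_nonneg_left hFcard
    (pow_nonneg (by linarith) _))).trans_lt hNlt
  rw [← Nat.cast_one, Nat.cast_lt, Nat.lt_one_iff, card_eq_zero, filter_eq_empty_iff] at hempty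
  have himg : ∀ g : ι → Fin n, (univ.image g).card ≤ t := fun g =>
    card_image_le.trans (by rw [card_univ])
  refine ⟨L.biUnion fun g => univ.image g, ?_, fun X Y W hX hY hXY hsub hW => ?_⟩
  · have : (L.biUnion fun g => univ.image g).card ≤ N * t :=
      (card_biUnion_le_card_mul _ _ _ fun g _ => himg g).trans (Nat.mul_le_mul_right _ hL)
    refine le_trans ?_ hN
    exact_mod_cast this
  · obtain ⟨W', hWW', hW'⟩ := exists_superset_card_eq hW (by simpa using h4)
    have hx : ((X, Y), W') ∈ F := by
      simp only [F, mem_filter, mem_product, mem_powersetCard_univ]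
      exact ⟨⟨⟨hX, hY⟩, hW'⟩, hXY, hsub.trans hWW'⟩
    have hhit : ¬ Disjoint (G ((X, Y), W')) L := fun hd => hempty hx hd
    obtain ⟨g, hgG, hgL⟩ := not_disjoint_iff.1 hhit
    simp only [G, mem_filter, mem_univ, true_and] at hgG
    refine ⟨univ.image g, subset_biUnion_of_mem (fun g => univ.image g) hgL, himg g, ?_, hgG.2⟩
    rw [Finset.disjoint_left]
    intro v hv hvW
    obtain ⟨i, -, rfl⟩ := mem_image.1 hv
    exact hgG.1 i (hWW' hvW)

theorem exists_disjoint_connections {n k l t m j : ℕ} {E : Finset (Finset (Fin n))}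
    {R : Finset (Fin n)}
    (hR : ∀ X Y W : Finset (Fin n), X.card = l → Y.card = l → Disjoint X Y → X ∪ Y ⊆ W →
      W.card ≤ m * (2 * l) + m * t →
        ∃ V ⊆ R, V.card ≤ t ∧ Disjoint V W ∧ Connected k l E X Y V)
    (hj : j ≤ m) {X Y : Fin j → Finset (Fin n)} (hX : ∀ i, (X i).card = l)
    (hY : ∀ i, (Y i).card = l) (hXY : ∀ i, Disjoint (X i) (Y i)) (s : Finset (Fin j)) :
    ∃ V : Fin j → Finset (Fin n),
      (∀ i ∈ s, V i ⊆ R ∧ (V i).card ≤ t ∧ Disjoint (V i) (univ.biUnion fun i' => X i' ∪ Y i') ∧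
        Connected k l E (X i) (Y i) (V i)) ∧
      ∀ i ∈ s, ∀ i' ∈ s, i ≠ i' → Disjoint (V i) (V i') := by
  induction s using Finset.induction_on with
  | empty => exact ⟨fun _ => ∅, by simp⟩
  | insert a s ha ih =>
    obtain ⟨V, hV, hdis⟩ := ih
    have hZ : (univ.biUnion fun i' => X i' ∪ Y i').card ≤ m * (2 * l) := by
      refine (card_biUnion_le_card_mul _ _ (2 * l) fun i _ => ?_).trans ?_
      · refine (card_union_le _ _).trans ?_
        rw [hX, hY, two_mul]
      · rw [card_univ, Fintype.card_fin]
        gcongr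
    have hs : (s.biUnion V).card ≤ m * t := by
      refine (card_biUnion_le_card_mul _ _ t fun i hi => (hV i hi).2.1).trans ?_
      refine Nat.mul_le_mul_right _ (le_trans ?_ hj)
      simpa using card_le_univ s
    obtain ⟨v, hvR, hvt, hvW, hv⟩ := hR (X a) (Y a)
      ((univ.biUnion fun i' => X i' ∪ Y i') ∪ s.biUnion V) (hX a) (hY a) (hXY a)
      ((subset_biUnion_of_mem (fun i' => X i' ∪ Y i') (mem_univ a)).trans subset_union_left)
      ((card_union_le _ _).trans (Nat.add_le_add hZ hs))
    rw [disjoint_union_right, disjoint_biUnion_right (s := v) s V] at hvW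
    have hne : ∀ i ∈ s, i ≠ a := fun i hi h => ha (h ▸ hi)
    refine ⟨Function.update V a v, fun i hi => ?_, fun i hi i' hi' hii' => ?_⟩
    · rcases mem_insert.1 hi with rfl | hi
      · simpa using ⟨hvR, hvt, by simpa using hvW.1, hv⟩
      · rw [Function.update_of_ne (hne i hi)]
        exact hV i hi
    · rcases mem_insert.1 hi with h | h <;> rcases mem_insert.1 hi' with h' | h'
      · exact absurd (h.trans h'.symm) hii'
      · rw [h, Function.update_self, Function.update_of_ne (hne i' h')]
        exact hvW.2 i' h'
      · rw [h', Function.update_self, Function.update_of_ne (hne i h)]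
        exact (hvW.2 i h).symm
      · rw [Function.update_of_ne (hne i h), Function.update_of_ne (hne i' h')]
        exact hdis i h i' h' hii'

theorem stmt3 (η ε : ℝ) (hη : 0 < η) (hε : 0 < ε) (k l m : ℕ) (hk : 4 ≤ k)
    (hl1 : 1 ≤ l) (hl2 : 2 * l < k) (hm : 1 ≤ m) :
    ∃ n₀ : ℕ, ∀ n : ℕ, n₀ ≤ n →
      ∀ E : Finset (Finset (Fin n)), (∀ e ∈ E, e.card = k) →
        (∀ S : Finset (Fin n), S.card = k - 2 →
          η * (Nat.choose n 2) ≤ (degH E S : ℝ)) →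
        ∃ R : Finset (Fin n), (R.card : ℝ) ≤ ε * n ∧
          ∀ j : ℕ, j ≤ m → ∀ X Y : Fin j → Finset (Fin n),
            (∀ i, (X i).card = l) → (∀ i, (Y i).card = l) →
            (∀ i i', i ≠ i' → Disjoint (X i) (X i')) →
            (∀ i i', i ≠ i' → Disjoint (Y i) (Y i')) →
            (∀ i i', Disjoint (X i) (Y i')) →
            ∃ T : Fin j → List (Fin n),
              (∀ i, IsPath k l E (T i)) ∧
              (∀ i, pathSize k l (T i) ≤ 4) ∧
              (∀ i i', i ≠ i' → Disjoint (T i).toFinset (T i').toFinset) ∧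
              (∀ i, firstEnd l (T i) = X i) ∧
              (∀ i, lastEnd l (T i) = Y i) ∧
              (∀ i, (T i).toFinset ⊆ (Finset.univ.biUnion fun i' => X i' ∪ Y i') ∪ R) := by
  obtain ⟨t, ht⟩ := exists_reservoir hη hε hk hl2
  obtain ⟨n₀, hn₀⟩ := ht (m * (2 * l) + m * t)
  refine ⟨n₀, fun n hn E hE hdeg => ?_⟩
  obtain ⟨R, hRcard, hR⟩ := hn₀ n hn E hE hdeg
  refine ⟨R, hRcard, fun j hj X Y hX hY hXX hYY hXY => ?_⟩
  obtain ⟨V, hV, hdis⟩ :=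
    exists_disjoint_connections hR hj hX hY (fun i => hXY i i) (univ : Finset (Fin j))
  choose T hpath hsize hfirst hlast hsub using fun i => (hV i (mem_univ i)).2.2.2
  have hZ : ∀ i i', Disjoint (V i) (X i' ∪ Y i') := fun i i' =>
    (hV i (mem_univ i)).2.2.1.mono_right
      (subset_biUnion_of_mem (fun i' => X i' ∪ Y i') (mem_univ i'))
  refine ⟨T, hpath, hsize, fun i i' hii' => ?_, hfirst, hlast, fun i => (hsub i).trans ?_⟩
  · refine Disjoint.mono (hsub i) (hsub i') ?_
    simp only [disjoint_union_left, disjoint_union_right] at hZ ⊢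
    exact ⟨⟨⟨⟨hXX i i' hii', (hXY i' i).symm⟩, (hZ i i').1⟩, ⟨hXY i i', hYY i i' hii'⟩,
      (hZ i i').2⟩, ⟨(hZ i' i).1.symm, (hZ i' i).2.symm⟩,
      hdis i (mem_univ i) i' (mem_univ i') hii'⟩
  · exact union_subset_union (subset_biUnion_of_mem (fun i' => X i' ∪ Y i') (mem_univ i))
      (hV i (mem_univ i)).1
end

section
/- For every η, ζ > 0 and all integers k ≥ 4 and 1 ≤ ℓ < k/2 there exists ε > 0 such that the following holds for all sufficiently large n: if H = (V,E) is a k-uniform hypergraph on n vertices with δ_{k−2}(H) ≥ η·C(n,2), then there is an ℓ-path A in H with |V(A)| ≤ ζn such that for every subset U ⊆ V \ V(A) with |U| ≤ εn and |U| divisible by k−ℓ there exists an ℓ-path Q in H with V(Q) = V(A) ∪ U such that A and Q have the same ends. -/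
open Finset

/-- The predicate `P` holds on at least a proportion `c` of the finite type `α`. -/
def Dens {α : Type} [Fintype α] (c : ℝ) (P : α → Prop) : Prop :=
  c * Fintype.card α ≤ ({a | P a}.ncard : ℝ)

theorem dens_iff {α : Type} [Fintype α] {c : ℝ} {P : α → Prop} [DecidablePred P] :
    Dens c P ↔ c * Fintype.card α ≤ ((univ.filter P).card : ℝ) := by
  rw [Dens, Set.ncard_eq_toFinset_card', Set.toFinset_ofPred]

theorem Dens.mono {α : Type} [Fintype α] {c c' : ℝ} {P Q : α → Prop} (h : Dens c P)
    (hc : c' ≤ c) (hPQ : ∀ a, P a → Q a) : Dens c' Q := by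
  have h1 : ({a | P a}.ncard : ℝ) ≤ ({a | Q a}.ncard : ℝ) := by
    exact_mod_cast Set.ncard_le_ncard (fun a ha => hPQ a ha) (Set.toFinite _)
  exact le_trans (mul_le_mul_of_nonneg_right hc (by positivity)) (le_trans h h1)

theorem Dens.equiv {α β : Type} [Fintype α] [Fintype β] {c : ℝ} {P : β → Prop} (e : α ≃ β)
    (h : Dens c P) : Dens c (fun a => P (e a)) := by
  classical
  rw [dens_iff] at h ⊢
  rw [Fintype.card_congr e]
  have : (univ.filter fun a => P (e a)).card = (univ.filter P).card :=
    Finset.card_bij (fun a _ => e a) (by simp) (by simp) (fun b hb => ⟨e.symm b, by simpa using hb⟩)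
  rwa [this]

theorem Dens.prod {α β : Type} [Fintype α] [Fintype β] {c₁ c₂ : ℝ} {P : α → Prop}
    {Q : α → β → Prop} (h₁ : Dens c₁ P) (hc₂ : 0 ≤ c₂) (h₂ : ∀ a, P a → Dens c₂ (Q a)) :
    Dens (c₁ * c₂) (fun x : α × β => P x.1 ∧ Q x.1 x.2) := by
  classical
  rw [dens_iff] at h₁ ⊢
  have h₃ : ∀ a, P a → c₂ * Fintype.card β ≤ ((univ.filter (Q a)).card : ℝ) :=
    fun a ha => dens_iff.1 (h₂ a ha)
  have e : (univ.filter fun x : α × β => P x.1 ∧ Q x.1 x.2).card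
      = ∑ a ∈ univ.filter P, (univ.filter (Q a)).card := by
    rw [← Finset.card_sigma]
    refine Finset.card_bij (fun x _ => ⟨x.1, x.2⟩) (by simp) ?_ ?_
    · rintro ⟨a, b⟩ _ ⟨a', b'⟩ _ h
      simpa using h
    · rintro ⟨a, b⟩ h
      exact ⟨(a, b), by simpa using h, rfl⟩
  rw [e]
  push_cast
  calc c₁ * c₂ * (Fintype.card (α × β) : ℝ)
      = (c₁ * Fintype.card α) * (c₂ * Fintype.card β) := by
        rw [Fintype.card_prod]; push_cast; ring
    _ ≤ ((univ.filter P).card : ℝ) * (c₂ * Fintype.card β) := by gcongr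
    _ = ∑ a ∈ univ.filter P, c₂ * (Fintype.card β : ℝ) := by simp
    _ ≤ _ := Finset.sum_le_sum fun a ha => h₃ a (by simpa using ha)

theorem Dens.pi {ι β : Type} [Fintype ι] [DecidableEq ι] [Fintype β] {c : ℝ} (hc : 0 ≤ c)
    {Q : ι → β → Prop} (h : ∀ i, Dens c (Q i)) :
    Dens (c ^ Fintype.card ι) (fun f : ι → β => ∀ i, Q i (f i)) := by
  classical
  rw [dens_iff]
  have h' : ∀ i, c * Fintype.card β ≤ ((univ.filter (Q i)).card : ℝ) := fun i => dens_iff.1 (h i)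
  have e : (univ.filter fun f : ι → β => ∀ i, Q i (f i))
      = Fintype.piFinset fun i => univ.filter (Q i) := by
    ext f; simp [Fintype.mem_piFinset]
  rw [e, Fintype.card_piFinset]
  push_cast
  calc c ^ Fintype.card ι * (Fintype.card (ι → β) : ℝ) = ∏ _i : ι, (c * Fintype.card β) := by
        simp [mul_pow]
    _ ≤ _ := Finset.prod_le_prod (fun _ _ => by positivity) fun i _ => h' i

theorem Dens.dup {α β : Type} [Fintype α] [Fintype β] {c : ℝ} (hc : 0 ≤ c)
    {P : α × β → Prop} (h : Dens c P) (t : ℕ) :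
    Dens (c ^ (t + 1)) (fun x : α × (Fin (t + 1) → β) => ∀ s, P (x.1, x.2 s)) := by
  classical
  rw [dens_iff] at h ⊢
  set N : α → ℕ := fun a => (univ.filter fun b => P (a, b)).card with hN
  have e1 : (univ.filter P).card = ∑ a, N a := by
    rw [hN, ← Finset.card_sigma]
    refine Finset.card_bij (fun x _ => ⟨x.1, x.2⟩) (by simp) ?_ ?_
    · rintro ⟨a, b⟩ _ ⟨a', b'⟩ _ h
      simpa using h
    · rintro ⟨a, b⟩ h
      exact ⟨(a, b), by simpa using h, rfl⟩
  have e2 : (univ.filter fun x : α × (Fin (t + 1) → β) => ∀ s, P (x.1, x.2 s)).card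
      = ∑ a, (N a) ^ (t + 1) := by
    have : ∀ a, (N a) ^ (t + 1)
        = (Fintype.piFinset fun _ : Fin (t + 1) => univ.filter fun b => P (a, b)).card := by
      intro a; simp [Fintype.card_piFinset, hN]
    simp_rw [this]
    rw [← Finset.card_sigma]
    refine Finset.card_bij (fun x _ => ⟨x.1, x.2⟩) (by simp [Fintype.mem_piFinset]) ?_ ?_
    · rintro ⟨a, b⟩ _ ⟨a', b'⟩ _ h
      simpa using h
    · rintro ⟨a, b⟩ h
      exact ⟨(a, b), by simpa [Fintype.mem_piFinset] using h, rfl⟩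
  rw [e1] at h
  rw [e2]
  push_cast at h ⊢
  rcases isEmpty_or_nonempty α with hα | hα
  · simp
  have hpos : (0 : ℝ) < Fintype.card α := by exact_mod_cast Fintype.card_pos
  have key := pow_sum_div_card_le_sum_pow (s := (univ : Finset α)) (f := fun a => (N a : ℝ))
    (fun a _ => by positivity) t
  refine le_trans ?_ key
  rw [le_div_iff₀ (by simpa using pow_pos hpos t)]
  calc c ^ (t + 1) * (Fintype.card (α × (Fin (t + 1) → β)) : ℝ) * ((univ : Finset α).card : ℝ) ^ t
      = (c * (Fintype.card (α × β) : ℝ)) ^ (t + 1) := by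
        simp [Fintype.card_prod, Finset.card_univ]; ring
    _ ≤ _ := by gcongr

/-- `vs` lists the entries of the elements of `α`, seen as `M`-tuples of vertices. -/
def IsTup {n : ℕ} {α : Type} (M : ℕ) (vs : α → Multiset (Fin n)) : Prop :=
  ∃ e : α ≃ (Fin M → Fin n), ∀ a, vs a = ∑ i, {e a i}

theorem isTup_fn {n : ℕ} (m : ℕ) : IsTup m (fun f : Fin m → Fin n => ∑ i, {f i}) :=
  ⟨Equiv.refl _, fun _ => rfl⟩

theorem isTup_base {n : ℕ} : IsTup 1 (fun x : Fin n => {x}) :=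
  ⟨(Equiv.funUnique (Fin 1) (Fin n)).symm, fun a => by simp⟩

theorem IsTup.prod {n : ℕ} {α β : Type} {M N : ℕ} {vs : α → Multiset (Fin n)}
    {ws : β → Multiset (Fin n)} (h₁ : IsTup M vs) (h₂ : IsTup N ws) :
    IsTup (M + N) (fun x : α × β => vs x.1 + ws x.2) := by
  obtain ⟨e, he⟩ := h₁
  obtain ⟨f, hf⟩ := h₂
  refine ⟨(e.prodCongr f).trans (Fin.appendEquiv M N), fun a => ?_⟩
  simp [Fin.sum_univ_add, he, hf, Fin.appendEquiv]

theorem IsTup.pi {n : ℕ} {α : Type} {M : ℕ} {vs : α → Multiset (Fin n)} (h : IsTup M vs)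
    (t : ℕ) : IsTup (t * M) (fun f : Fin t → α => ∑ i, vs (f i)) := by
  obtain ⟨e, he⟩ := h
  refine ⟨((Equiv.piCongrRight fun _ => e).trans (Equiv.curry _ _ _).symm).trans
    (Equiv.arrowCongr finProdFinEquiv (Equiv.refl _)), fun a => ?_⟩
  rw [← Equiv.sum_comp finProdFinEquiv, Fintype.sum_prod_type]
  simp [he]

theorem IsTup.card {n : ℕ} {α : Type} [Fintype α] {M : ℕ} {vs : α → Multiset (Fin n)}
    (h : IsTup M vs) : Fintype.card α = n ^ M := by
  obtain ⟨e, -⟩ := h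
  simp [Fintype.card_congr e]

theorem IsTup.card_vs {n : ℕ} {α : Type} {M : ℕ} {vs : α → Multiset (Fin n)}
    (h : IsTup M vs) (a : α) : (vs a).card = M := by
  obtain ⟨e, he⟩ := h
  simp [he]

theorem card_coord_eq_mul_le {n M : ℕ} (i : Fin M) (g : (Fin M → Fin n) → Fin n)
    (hg : ∀ φ y, g (Function.update φ i y) = g φ) :
    (univ.filter fun φ : Fin M → Fin n => φ i = g φ).card * n ≤ n ^ M := by
  have h : ((univ.filter fun φ : Fin M → Fin n => φ i = g φ) ×ˢ (univ : Finset (Fin n))).card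
      ≤ (univ : Finset (Fin M → Fin n)).card := by
    refine Finset.card_le_card_of_injOn (fun x => Function.update x.1 i x.2) (by simp) ?_
    rintro ⟨φ, y⟩ hφ ⟨ψ, z⟩ hψ h
    simp only [coe_product, Set.mem_prod, mem_coe, mem_filter, mem_univ, true_and] at hφ hψ h
    have hy : y = z := by simpa using congrFun h i
    have hgg : g φ = g ψ := by rw [← hg φ y, h, hg]
    have : φ = ψ := by
      funext j
      by_cases hj : j = i
      · rw [hj, hφ.1, hψ.1, hgg]
      · simpa [hj] using congrFun h j
    rw [this, hy]
  simpa using h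

theorem Dens.nodup {n M : ℕ} (hn : 0 < n) {α : Type} [Fintype α] {vs : α → Multiset (Fin n)}
    (hT : IsTup M vs) {c : ℝ} {P : α → Prop} (h : Dens c P) (F : Finset (Fin n))
    (hc : ((M * M + M * F.card : ℕ) : ℝ) ≤ c / 2 * n) :
    Dens (c / 2) (fun a => P a ∧ (vs a).Nodup ∧ ∀ x ∈ F, x ∉ vs a) := by
  classical
  obtain ⟨e, he⟩ := hT
  suffices H : Dens (c / 2) (fun φ : Fin M → Fin n => P (e.symm φ) ∧
      (∑ i, ({φ i} : Multiset (Fin n))).Nodup ∧ ∀ x ∈ F, x ∉ ∑ i, ({φ i} : Multiset (Fin n))) by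
    refine (H.equiv e).mono le_rfl fun a ha => ?_
    simpa [he] using ha
  have h' := dens_iff.1 (h.equiv e.symm)
  rw [dens_iff]
  set A := univ.filter fun φ : Fin M → Fin n => P (e.symm φ)
  set B₁ := (univ : Finset (Fin M × Fin M)).biUnion fun p =>
    if p.1 = p.2 then ∅ else univ.filter fun φ : Fin M → Fin n => φ p.1 = φ p.2
  set B₂ := ((univ : Finset (Fin M)) ×ˢ F).biUnion fun p =>
    univ.filter fun φ : Fin M → Fin n => φ p.1 = p.2
  set G := univ.filter fun φ : Fin M → Fin n => P (e.symm φ) ∧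
      (∑ i, ({φ i} : Multiset (Fin n))).Nodup ∧ ∀ x ∈ F, x ∉ ∑ i, ({φ i} : Multiset (Fin n))
  have hsub : A ⊆ G ∪ (B₁ ∪ B₂) := by
    intro φ hφ
    by_contra hcon
    simp only [mem_union, not_or] at hcon
    obtain ⟨hG, h1, h2⟩ := hcon
    apply hG
    have hφ' : P (e.symm φ) := by simpa [A] using hφ
    have hinj : Function.Injective φ := by
      intro i j hij
      by_contra hne
      apply h1
      simp only [B₁, mem_biUnion, mem_univ, true_and]
      exact ⟨(i, j), by simp [hne, hij]⟩
    have hmap : (∑ i, ({φ i} : Multiset (Fin n))) = univ.val.map φ := by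
      rw [← Multiset.sum_map_singleton (univ.val.map φ), Multiset.map_map]; rfl
    simp only [G, mem_filter, mem_univ, true_and]
    refine ⟨hφ', ?_, ?_⟩
    · rw [hmap]
      exact Multiset.Nodup.map hinj univ.nodup
    · intro x hx hx'
      rw [hmap] at hx'
      obtain ⟨i, -, hi⟩ := Multiset.mem_map.1 hx'
      apply h2
      simp only [B₂, mem_biUnion]
      exact ⟨(i, x), by simp [hx, hi]⟩
  have hB₁ : B₁.card * n ≤ M * M * n ^ M := by
    calc B₁.card * n ≤ (∑ p : Fin M × Fin M, (if p.1 = p.2 then ∅ else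
          univ.filter fun φ : Fin M → Fin n => φ p.1 = φ p.2).card) * n :=
          Nat.mul_le_mul_right _ card_biUnion_le
      _ ≤ ∑ p : Fin M × Fin M, n ^ M := by
          rw [sum_mul]
          refine sum_le_sum fun p _ => ?_
          split_ifs with hp
          · simp
          · exact card_coord_eq_mul_le p.1 (fun φ => φ p.2) fun φ y => by
              simp [Function.update_of_ne (Ne.symm hp)]
      _ = M * M * n ^ M := by simp
  have hB₂ : B₂.card * n ≤ M * F.card * n ^ M := by
    calc B₂.card * n ≤ (∑ p ∈ (univ : Finset (Fin M)) ×ˢ F,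
          (univ.filter fun φ : Fin M → Fin n => φ p.1 = p.2).card) * n :=
          Nat.mul_le_mul_right _ card_biUnion_le
      _ ≤ ∑ p ∈ (univ : Finset (Fin M)) ×ˢ F, n ^ M := by
          rw [sum_mul]
          exact sum_le_sum fun p _ => card_coord_eq_mul_le p.1 (fun _ => p.2) fun φ y => rfl
      _ = M * F.card * n ^ M := by simp
  have hA : A.card ≤ G.card + (B₁.card + B₂.card) :=
    (card_le_card hsub).trans ((card_union_le _ _).trans
      (Nat.add_le_add_left (card_union_le _ _) _))
  have hA' : (A.card : ℝ) ≤ G.card + (B₁.card + B₂.card) := by exact_mod_cast hA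
  have hB : ((B₁.card : ℝ) + B₂.card) * n ≤ c / 2 * n * (n : ℝ) ^ M := by
    have : ((B₁.card : ℝ) + B₂.card) * n ≤ ((M * M + M * F.card : ℕ) : ℝ) * (n : ℝ) ^ M := by
      have := Nat.add_le_add hB₁ hB₂
      rw [← Nat.add_mul, ← Nat.add_mul] at this
      exact_mod_cast this
    exact this.trans (by gcongr)
  have hn' : (0 : ℝ) < n := by exact_mod_cast hn
  have hB' : (B₁.card : ℝ) + B₂.card ≤ c / 2 * (n : ℝ) ^ M := by
    refine le_of_mul_le_mul_right (hB.trans_eq ?_) hn'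
    ring
  have hcard : (Fintype.card (Fin M → Fin n) : ℝ) = (n : ℝ) ^ M := by simp
  rw [hcard] at h' ⊢
  linarith

/-- A `k`-uniform hypergraph whose minimum `(k - 2)`-degree is at least `η * (n choose 2)`. -/
structure DegCond {n : ℕ} (η : ℝ) (k : ℕ) (E : Finset (Finset (Fin n))) : Prop where
  card : ∀ e ∈ E, e.card = k
  deg : ∀ S : Finset (Fin n), S.card = k - 2 → η * (Nat.choose n 2) ≤ (degH E S : ℝ)

theorem DegCond.nodup {n k : ℕ} {η : ℝ} {E : Finset (Finset (Fin n))} (hE : DegCond η k E)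
    {s : Multiset (Fin n)} (hs : s.card = k) (h : s.toFinset ∈ E) : s.Nodup := by
  rw [← Multiset.toFinset_card_eq_card_iff_nodup, hE.card _ h, hs]

theorem DegCond.dens_pair {n k : ℕ} {η : ℝ} (hη : 0 < η) {E : Finset (Finset (Fin n))}
    (hE : DegCond η k E) (hn : 2 ≤ n) {B : Multiset (Fin n)} (hB : B.Nodup)
    (hk : B.card + 2 = k) :
    Dens (η / 4) (fun R : Fin 2 → Fin n => (B + ∑ i, {R i}).toFinset ∈ E) := by
  classical
  have hd := hE.deg B.toFinset (by rw [Multiset.toFinset_card_of_nodup hB]; omega)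
  rw [dens_iff]
  have h1 : degH E B.toFinset
      ≤ (univ.filter fun R : Fin 2 → Fin n => (B + ∑ i, {R i}).toFinset ∈ E).card := by
    refine Finset.card_le_card_of_surjOn (fun R => (B + ∑ i, {R i}).toFinset) ?_
    intro e he
    simp only [coe_filter, Set.mem_ofPred_eq] at he
    have hc : (e \ B.toFinset).card = 2 := by
      rw [card_sdiff_of_subset he.2, hE.card e he.1, Multiset.toFinset_card_of_nodup hB]
      omega
    obtain ⟨x, y, -, hxy⟩ := Finset.card_eq_two.1 hc
    have heq : (B + ∑ i, ({(![x, y] : Fin 2 → Fin n) i} : Multiset (Fin n))).toFinset = e := by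
      rw [← Finset.union_sdiff_of_subset he.2, hxy]
      ext z; simp [Fin.sum_univ_two]
    refine ⟨![x, y], ?_, heq⟩
    simp only [coe_filter, Set.mem_ofPred_eq, mem_univ, true_and]
    rw [heq]; exact he.1
  refine le_trans ?_ (hd.trans (by exact_mod_cast h1))
  rw [Nat.cast_choose_two]
  have : (2 : ℝ) ≤ n := by exact_mod_cast hn
  simp only [Fintype.card_pi, Fintype.card_fin, prod_const, card_univ]
  push_cast
  nlinarith [mul_nonneg hη.le (mul_nonneg (by linarith : (0 : ℝ) ≤ n) (by linarith : (0:ℝ) ≤ n - 2))]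

theorem DegCond.dens {n k m : ℕ} {η : ℝ} (hη : 0 < η) {E : Finset (Finset (Fin n))}
    (hE : DegCond η k E) (hn : 2 + 2 * k * k ≤ n) {B : Multiset (Fin n)} (hB : B.Nodup)
    (hk : B.card + m = k) (hm : 2 ≤ m) {α : Type} [Fintype α] {vs : α → Multiset (Fin n)}
    (hT : IsTup m vs) :
    Dens (η / 8) (fun a => (B + vs a).toFinset ∈ E) := by
  classical
  obtain ⟨e, he⟩ := hT
  obtain ⟨m, rfl⟩ : ∃ m', m = m' + 2 := ⟨m - 2, by omega⟩
  have h1 : Dens 1 (fun _ : Fin m → Fin n => True) := by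
    rw [dens_iff]; simp
  have h2 := h1.nodup (by omega) (isTup_fn m) B.toFinset (by
    rw [Multiset.toFinset_card_of_nodup hB]
    have : 2 * (m * m + m * B.card) ≤ n := by nlinarith
    have : (2 : ℝ) * ((m * m + m * B.card : ℕ) : ℝ) ≤ n := by exact_mod_cast this
    linarith)
  have h3 := h2.prod (β := Fin 2 → Fin n) (c₂ := η / 4)
    (Q := fun R R' => (B + ∑ i, {R i} + ∑ i, {R' i}).toFinset ∈ E) (by positivity) (by
      intro R hR
      refine hE.dens_pair hη (by omega) ?_ ?_
      · rw [Multiset.nodup_add]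
        refine ⟨hB, hR.2.1, ?_⟩
        rw [Multiset.disjoint_left]
        exact fun {x} hx => hR.2.2 x (by simpa using hx)
      · simp; omega)
  refine ((h3.equiv (Fin.appendEquiv m 2).symm).equiv e).mono (by linarith) fun a ha => ?_
  have := ha.2
  rw [he, Fin.sum_univ_add, ← add_assoc]
  exact this

/-- `S ++ I ++ T` is the vertex list of an `l`-walk with ends `S` and `T` in the hypergraph `E`
with edges of size `2 * l + m`; repeated vertices are allowed. -/
inductive Seg {n : ℕ} (E : Finset (Finset (Fin n))) (l m : ℕ) :
    List (Fin n) → List (Fin n) → List (Fin n) → Prop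
  | edge {S M T : List (Fin n)} (hS : S.length = l) (hM : M.length = m) (hT : T.length = l)
      (h : ((S : Multiset (Fin n)) + M + T).toFinset ∈ E) : Seg E l m S M T
  | trans {S M T N R : List (Fin n)} (h₁ : Seg E l m S M T) (h₂ : Seg E l m T N R) :
      Seg E l m S (M ++ T ++ N) R

namespace Seg

variable {n : ℕ} {E : Finset (Finset (Fin n))} {l m : ℕ} {S I T : List (Fin n)}

theorem length_left (h : Seg E l m S I T) : S.length = l := by
  induction h with
  | edge hS => exact hS
  | trans _ _ h => exact h

theorem length_right (h : Seg E l m S I T) : T.length = l := by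
  induction h with
  | edge _ _ hT => exact hT
  | trans _ _ _ h => exact h

theorem windows (h : Seg E l m S I T) :
    ∃ p : ℕ, 1 ≤ p ∧ (S ++ I ++ T).length = p * (l + m) + l ∧
      ∀ i < p, (((S ++ I ++ T).drop (i * (l + m))).take (2 * l + m)).toFinset ∈ E := by
  induction h with
  | @edge S M T hS hM hT h =>
    refine ⟨1, le_rfl, by simp [hS, hM, hT]; omega, ?_⟩
    intro i hi
    obtain rfl : i = 0 := by omega
    rw [Nat.zero_mul, List.drop_zero, List.take_of_length_le (by simp [hS, hM, hT]; omega)]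
    rwa [Multiset.coe_add, Multiset.coe_add] at h
  | @trans S M T N R h₁ h₂ ih₁ ih₂ =>
    obtain ⟨p, hp, hpl, hpw⟩ := ih₁
    obtain ⟨q, hq, hql, hqw⟩ := ih₂
    have hT := h₁.length_right
    refine ⟨p + q, by omega, ?_, ?_⟩
    · simp only [List.length_append] at hpl hql ⊢
      rw [Nat.add_mul]; omega
    · intro i hi
      rcases lt_or_ge i p with hip | hip
      · have h1 : S ++ (M ++ T ++ N) ++ R = (S ++ M ++ T) ++ (N ++ R) := by simp
        have h2 : i * (l + m) + (l + m) ≤ p * (l + m) := by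
          rw [← Nat.succ_mul]; exact Nat.mul_le_mul_right _ hip
        rw [h1, List.drop_append_of_le_length (by omega),
          List.take_append_of_le_length (by rw [List.length_drop]; omega)]
        exact hpw i hip
      · obtain ⟨j, rfl⟩ := Nat.exists_eq_add_of_le hip
        have h1 : S ++ (M ++ T ++ N) ++ R = (S ++ M) ++ (T ++ N ++ R) := by simp
        have h2 : (S ++ M).length = p * (l + m) := by
          simp only [List.length_append] at hpl ⊢; omega
        rw [h1, Nat.add_mul, ← h2, ← List.drop_drop, List.drop_left]
        exact hqw j (by omega)

theorem isPath {k : ℕ} (hk : k = 2 * l + m) (hm : 0 < l + m) (h : Seg E l m S I T)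
    (hn : (S ++ I ++ T).Nodup) : IsPath k l E (S ++ I ++ T) := by
  obtain ⟨p, hp, hpl, hpw⟩ := h.windows
  have hkl : k - l = l + m := by omega
  refine ⟨hn, ⟨p, hp, by rw [hkl]; exact hpl⟩, fun i hi => ?_⟩
  rw [hkl] at hi ⊢
  rw [hk]
  refine hpw i ?_
  by_contra hcon
  have : p * (l + m) ≤ i * (l + m) := Nat.mul_le_mul_right _ (not_lt.1 hcon)
  omega

theorem firstEnd_eq (h : Seg E l m S I T) : firstEnd l (S ++ I ++ T) = S.toFinset := by
  rw [firstEnd, List.append_assoc, ← h.length_left, List.take_left]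

theorem lastEnd_eq (h : Seg E l m S I T) : lastEnd l (S ++ I ++ T) = T.toFinset := by
  have : (S ++ I ++ T).length - l = (S ++ I).length := by
    simp [h.length_right]; omega
  rw [lastEnd, this, List.drop_left]

/-- Two edges sharing `D₂` together with one more vertex. -/
theorem two_edges {Y₁ Dr D₂ Hr Y₃ : List (Fin n)} {y v w : Fin n} {a d : ℕ}
    (h1 : Y₁.length = a + 1) (hr : Dr.length = d) (h2 : D₂.length = a) (hr' : Hr.length = d)
    (h3 : Y₃.length = a + 1)
    (he : ((Y₁ : Multiset (Fin n)) + Dr + D₂ + {y} + {v}).toFinset ∈ E)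
    (he' : ((D₂ : Multiset (Fin n)) + {v} + {w} + Hr + Y₃).toFinset ∈ E) :
    Seg E (a + 1) (d + 1) Y₁ (y :: Dr ++ (v :: D₂) ++ (w :: Hr)) Y₃ := by
  refine Seg.trans (T := v :: D₂) (Seg.edge h1 (by simp [hr]) (by simp [h2]) ?_)
    (Seg.edge (by simp [h2]) (by simp [hr']) h3 ?_)
  · convert he using 2
    simp only [← Multiset.cons_coe, ← Multiset.singleton_add]
    abel
  · convert he' using 2
    simp only [← Multiset.cons_coe, ← Multiset.singleton_add]
    abel

end Seg

/-- The vertices of a list of segments, each given by its ends and its interior. -/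
def segVerts {n : ℕ} (L : List (List (Fin n) × List (Fin n) × List (Fin n))) :
    Multiset (Fin n) :=
  (L.map fun q => ((q.1 : Multiset (Fin n)) + q.2.1 + q.2.2)).sum

/-- `L'` consists of segments of `E` which have the same ends as the entries of `L`. -/
def Replaces {n : ℕ} (E : Finset (Finset (Fin n))) (l m : ℕ)
    (L L' : List (List (Fin n) × List (Fin n) × List (Fin n))) : Prop :=
  List.Forall₂ (fun q q' => q'.1 = q.1 ∧ q'.2.2 = q.2.2 ∧ Seg E l m q'.1 q'.2.1 q'.2.2) L L'

theorem segVerts_cons {n : ℕ} (q : List (Fin n) × List (Fin n) × List (Fin n))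
    (L : List (List (Fin n) × List (Fin n) × List (Fin n))) :
    segVerts (q :: L) = ((q.1 : Multiset (Fin n)) + q.2.1 + q.2.2) + segVerts L := by
  simp [segVerts]

theorem segVerts_append {n : ℕ} (L L' : List (List (Fin n) × List (Fin n) × List (Fin n))) :
    segVerts (L ++ L') = segVerts L + segVerts L' := by
  simp [segVerts]

theorem segVerts_ofFn {n t : ℕ} (f : Fin t → List (Fin n) × List (Fin n) × List (Fin n)) :
    segVerts (List.ofFn f)
      = ∑ i, (((f i).1 : Multiset (Fin n)) + (f i).2.1 + (f i).2.2) := by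
  simp [segVerts, List.map_ofFn, List.sum_ofFn]

theorem segVerts_flatten {n t : ℕ}
    (f : Fin t → List (List (Fin n) × List (Fin n) × List (Fin n))) :
    segVerts (List.ofFn f).flatten = ∑ i, segVerts (f i) := by
  rw [segVerts, List.map_flatten, List.sum_flatten, List.map_ofFn, List.map_ofFn, List.sum_ofFn]
  rfl

theorem Replaces.flatten {n t l m : ℕ} {E : Finset (Finset (Fin n))}
    {f g : Fin t → List (List (Fin n) × List (Fin n) × List (Fin n))}
    (h : ∀ i, Replaces E l m (f i) (g i)) :
    Replaces E l m (List.ofFn f).flatten (List.ofFn g).flatten := by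
  induction t with
  | zero => simp [Replaces]
  | succ t ih =>
    rw [List.ofFn_succ, List.ofFn_succ, List.flatten_cons, List.flatten_cons]
    exact List.rel_append (h 0) (ih fun i => h i.succ)

/-- The vertices in position `j` of a ladder: the first `j` entries of `x' j`, then the entries
of `x j` from position `j` on. -/
def rung {n : ℕ} (x x' : ℕ → List (Fin n)) (j : ℕ) : List (Fin n) :=
  (x' j).take j ++ (x j).drop j

/-- The interior of the walk which reaches `rung x x' j` starting with the vertex `v`. -/
def ladder {n : ℕ} (v : Fin n) (x x' y : ℕ → List (Fin n)) : ℕ → List (Fin n)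
  | 0 => [v]
  | j + 1 => (ladder v x x' y j ++ rung x x' j ++ ((x' j).drop j).take 1) ++ y j ++
      ((x (j + 1)).drop j).take 1

section ladder

variable {n l : ℕ} {E : Finset (Finset (Fin n))} {v : Fin n} {x x' y : ℕ → List (Fin n)}

theorem coe_take_succ (L : List (Fin n)) (j : ℕ) :
    ((L.take (j + 1) : List (Fin n)) : Multiset (Fin n)) = L.take j + (L.drop j).take 1 := by
  rw [List.take_add, Multiset.coe_add]

theorem coe_take_add_drop (L : List (Fin n)) (j : ℕ) :
    ((L.take j : List (Fin n)) : Multiset (Fin n)) + L.drop j = L := by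
  rw [Multiset.coe_add, List.take_append_drop]

theorem coe_drop_eq (L : List (Fin n)) (j : ℕ) :
    ((L.drop j : List (Fin n)) : Multiset (Fin n)) = (L.drop j).take 1 + L.drop (j + 1) := by
  rw [← coe_take_add_drop (L.drop j) 1, List.drop_drop]

theorem ladder_length (hx : ∀ i, (x i).length = l) (hx' : ∀ i, (x' i).length = l)
    (hy : ∀ i, (y i).length = l) : ∀ j ≤ l, (ladder v x x' y j).length = 1 + j * (2 * l + 2)
  | 0, _ => by simp [ladder]
  | j + 1, hj => by
    simp only [ladder, rung, List.length_append, List.length_take, List.length_drop, hx, hx', hy,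
      ladder_length hx hx' hy j (by omega), Nat.add_mul]
    omega

theorem ladder_le : ∀ j, ((ladder v x x' y j : List (Fin n)) : Multiset (Fin n)) + rung x x' j ≤
      {v} + ∑ i ∈ range j, ((y i : Multiset (Fin n)) + x i + x' i) + x j + (x' j).take j
  | 0 => by simp [ladder, rung]
  | j + 1 => by
    have ih := ladder_le j
    have h1 : ((x' j).take j : Multiset (Fin n)) + ((x' j).drop j).take 1 ≤ x' j := by
      rw [← coe_take_succ (x' j) j]
      exact (List.take_sublist _ _).subperm
    have h2 : (((x (j + 1)).drop j).take 1 : Multiset (Fin n)) + (x (j + 1)).drop (j + 1)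
        ≤ x (j + 1) := by
      rw [← coe_drop_eq]
      exact (List.drop_sublist _ _).subperm
    rw [sum_range_succ]
    simp only [ladder, ← Multiset.coe_add] at ih ⊢
    rw [rung.eq_def x x' (j + 1), ← Multiset.coe_add]
    calc _ = ((ladder v x x' y j : Multiset (Fin n)) + rung x x' j)
          + ((x' j).drop j).take 1 + y j + ((((x (j + 1)).drop j).take 1 : Multiset (Fin n))
            + (x (j + 1)).drop (j + 1)) + (x' (j + 1)).take (j + 1) := by abel
      _ ≤ ({v} + ∑ i ∈ range j, ((y i : Multiset (Fin n)) + x i + x' i) + x j + (x' j).take j)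
          + ((x' j).drop j).take 1 + y j + x (j + 1) + (x' (j + 1)).take (j + 1) := by gcongr
      _ = {v} + ∑ i ∈ range j, ((y i : Multiset (Fin n)) + x i + x' i) + x j
          + ((x' j).take j + ((x' j).drop j).take 1) + y j + x (j + 1)
          + (x' (j + 1)).take (j + 1) := by abel
      _ ≤ {v} + ∑ i ∈ range j, ((y i : Multiset (Fin n)) + x i + x' i) + x j
          + x' j + y j + x (j + 1) + (x' (j + 1)).take (j + 1) := by gcongr
      _ = _ := by abel

theorem ladder_seg {S : List (Fin n)} (hS : S.length = l) (hx : ∀ i, (x i).length = l)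
    (hx' : ∀ i, (x' i).length = l) (hy : ∀ i, (y i).length = l)
    (h0 : ((S : Multiset (Fin n)) + {v} + x 0).toFinset ∈ E)
    (hi : ∀ i < l, ∀ s ∈ ({i, i + 1} : Set ℕ),
      (((x' s).take (i + 1) : Multiset (Fin n)) + (x s).drop i + y i).toFinset ∈ E) :
    ∀ j ≤ l, Seg E l 1 S (ladder v x x' y j) (rung x x' j)
  | 0, _ => by
    refine Seg.edge hS rfl (by simp [rung, hx]) ?_
    simpa [rung, ladder] using h0
  | j + 1, hj => by
    have ih := ladder_seg hS hx hx' hy h0 hi j (by omega)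
    refine (ih.trans (Seg.edge ih.length_right ?_ (hy j) ?_)).trans
      (Seg.edge (hy j) ?_ ?_ ?_)
    · simp [hx']; omega
    · convert hi j (by omega) j (by simp) using 2
      rw [coe_take_succ (x' j) j, rung, ← Multiset.coe_add]
      abel
    · simp [hx]; omega
    · simp [rung, hx, hx']; omega
    · convert hi j (by omega) (j + 1) (by simp) using 2
      rw [coe_drop_eq (x (j + 1)) j, rung, ← Multiset.coe_add]
      abel

end ladder

theorem coe_ofFn {n t : ℕ} (f : Fin t → Fin n) :
    ((List.ofFn f : List (Fin n)) : Multiset (Fin n)) = ∑ i, {f i} := by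
  rw [← Multiset.sum_map_singleton (List.ofFn f : Multiset (Fin n)), Multiset.map_coe,
    Multiset.sum_coe, List.map_ofFn, List.sum_ofFn]
  rfl

theorem ladder_dens {n l : ℕ} (hl : 2 ≤ l) {η : ℝ} (hη : 0 < η) {E : Finset (Finset (Fin n))}
    (hE : DegCond η (2 * l + 1) E) (hn : 2 + 2 * (2 * l + 1) * (2 * l + 1) ≤ n)
    (hn' : ((4 * (l + 1) * (l + 1) : ℕ) : ℝ) ≤ (η / 8 * (η / 8)) / 2 * n)
    {S T : List (Fin n)} (hS : S.length = l)
    (hT : T.length = l) (hSn : S.Nodup) (hTn : T.Nodup) :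
    Dens (((η / 8 * (η / 8)) / 2 * (η / 8) ^ l) ^ (l + 1))
      (fun a : ((Fin n × Fin n) × (Fin l → Fin l → Fin n)) ×
          (Fin (l + 1) → (Fin l → Fin n) × (Fin l → Fin n)) => ∀ s,
        ((S : Multiset (Fin n)) + {a.1.1.1} + List.ofFn (a.2 s).1).toFinset ∈ E ∧
        ((List.ofFn (a.2 s).2 : Multiset (Fin n)) + {a.1.1.2} + T).toFinset ∈ E ∧
        ∀ i : Fin l, (((List.ofFn (a.2 s).2).take (i + 1) : Multiset (Fin n)) +
          (List.ofFn (a.2 s).1).drop i + List.ofFn (a.1.2 i)).toFinset ∈ E) := by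
  have hb := isTup_base.prod (isTup_fn (n := n) l)
  have key : ∀ S : List (Fin n), S.length = l → S.Nodup →
      Dens (η / 8) (fun b : Fin n × (Fin l → Fin n) =>
        ((S : Multiset (Fin n)) + ({b.1} + ∑ i, {b.2 i})).toFinset ∈ E) := by
    intro S hS hSn
    exact hE.dens hη hn (Multiset.coe_nodup.2 hSn) (by simp [hS]; omega) (by omega) hb
  have h1 := ((key S hS hSn).prod (by positivity) fun _ _ => key T hT hTn).nodup (by omega)
    (hb.prod hb) ∅ (by
      refine le_trans (le_of_eq ?_) hn'
      norm_cast
      simp only [card_empty]; ring)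
  have h2 := h1.prod (β := Fin l → Fin l → Fin n) (c₂ := (η / 8) ^ l)
    (Q := fun b Y => ∀ i : Fin l, (((List.ofFn b.2.2).take (i + 1) : Multiset (Fin n)) +
          (List.ofFn b.1.2).drop i + ∑ j, {Y i j}).toFinset ∈ E) (by positivity) (by
      intro b hb
      have := Dens.pi (ι := Fin l) (β := Fin l → Fin n) (c := η / 8)
        (Q := fun i Y => (((List.ofFn b.2.2).take (i + 1) : Multiset (Fin n)) +
          (List.ofFn b.1.2).drop i + ∑ j, {Y j}).toFinset ∈ E) (by positivity) (by
          intro i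
          refine hE.dens hη hn (Multiset.nodup_of_le ?_ hb.2.1) ?_ hl (isTup_fn l)
          · calc _ ≤ ((List.ofFn b.2.2 : Multiset (Fin n))) + List.ofFn b.1.2 :=
                  add_le_add (List.take_sublist _ _).subperm (List.drop_sublist _ _).subperm
              _ ≤ ((List.ofFn b.2.2 : Multiset (Fin n))) + List.ofFn b.1.2
                  + ({b.1.1} + {b.2.1}) := Multiset.le_add_right _ _
              _ = _ := by rw [coe_ofFn, coe_ofFn]; abel
          · have := i.2
            simp
            omega)
      simpa using this)
  let e : ((Fin n × Fin n) × (Fin l → Fin l → Fin n)) × ((Fin l → Fin n) × (Fin l → Fin n)) ≃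
      ((Fin n × (Fin l → Fin n)) × (Fin n × (Fin l → Fin n))) × (Fin l → Fin l → Fin n) :=
    { toFun := fun a => (((a.1.1.1, a.2.1), (a.1.1.2, a.2.2)), a.1.2)
      invFun := fun b => (((b.1.1.1, b.1.2.1), b.2), (b.1.1.2, b.1.2.2))
      left_inv := fun _ => rfl
      right_inv := fun _ => rfl }
  refine ((h2.equiv e).dup (by positivity) l).mono le_rfl fun a ha s => ?_
  obtain ⟨⟨⟨h3, h4⟩, -⟩, h5⟩ := ha s
  refine ⟨?_, ?_, fun i => ?_⟩
  · rw [coe_ofFn, add_assoc]; exact h3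
  · rw [coe_ofFn, add_comm, add_comm _ ({_} : Multiset (Fin n))]; exact h4
  · rw [coe_ofFn (a.1.2 i)]; exact h5 i

theorem connect_dens_one {l : ℕ} (hl : 2 ≤ l) {η : ℝ} (hη : 0 < η) :
    ∃ M N : ℕ, ∃ c : ℝ, 0 < c ∧ ∃ n₀ : ℕ, ∀ n : ℕ, n₀ ≤ n →
      ∃ f : (Fin M → Fin n) → List (Fin n),
        (∀ φ, (f φ).length = N ∧ (f φ : Multiset (Fin n)) ≤ ∑ i, {φ i}) ∧
        ∀ E : Finset (Finset (Fin n)), DegCond η (2 * l + 1) E → ∀ S T : List (Fin n),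
          S.length = l → T.length = l → (S ++ T).Nodup →
            Dens c (fun φ => Seg E l 1 S (f φ) T) := by
  obtain ⟨n₁, hn₁⟩ := exists_nat_ge (((4 * (l + 1) * (l + 1) : ℕ) : ℝ) / ((η / 8 * (η / 8)) / 2))
  have : NeZero l := ⟨by omega⟩
  refine ⟨(1 + 1 + l * l) + (l + 1) * (l + l), 1 + l * (2 * l + 2) + l + 1,
    ((η / 8 * (η / 8)) / 2 * (η / 8) ^ l) ^ (l + 1), by positivity,
    max n₁ (2 + 2 * (2 * l + 1) * (2 * l + 1)), fun n hn => ?_⟩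
  obtain ⟨e, he⟩ := ((isTup_base.prod isTup_base).prod ((isTup_fn (n := n) l).pi l)).prod
    (((isTup_fn (n := n) l).prod (isTup_fn (n := n) l)).pi (l + 1))
  let x := fun (a : ((Fin n × Fin n) × (Fin l → Fin l → Fin n)) ×
    (Fin (l + 1) → (Fin l → Fin n) × (Fin l → Fin n))) (i : ℕ) =>
      List.ofFn (a.2 (Fin.ofNat (l + 1) i)).1
  let x' := fun (a : ((Fin n × Fin n) × (Fin l → Fin l → Fin n)) ×
    (Fin (l + 1) → (Fin l → Fin n) × (Fin l → Fin n))) (i : ℕ) =>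
      List.ofFn (a.2 (Fin.ofNat (l + 1) i)).2
  let y := fun (a : ((Fin n × Fin n) × (Fin l → Fin l → Fin n)) ×
    (Fin (l + 1) → (Fin l → Fin n) × (Fin l → Fin n))) (i : ℕ) =>
      List.ofFn (a.1.2 (Fin.ofNat l i))
  have hx : ∀ a i, (x a i).length = l := by simp [x]
  have hx' : ∀ a i, (x' a i).length = l := by simp [x']
  have hy : ∀ a i, (y a i).length = l := by simp [y]
  let g := fun a => ladder a.1.1.1 (x a) (x' a) (y a) l ++ rung (x a) (x' a) l ++ [a.1.1.2]
  refine ⟨fun φ => g (e.symm φ), fun φ => ⟨?_, ?_⟩, fun E hE S T hS hT hST => ?_⟩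
  · simp [g, ladder_length (hx _) (hx' _) (hy _) l le_rfl, rung, hx, hx', add_assoc]
  · have h1 := ladder_le (v := (e.symm φ).1.1.1) (x := x (e.symm φ)) (x' := x' (e.symm φ))
      (y := y (e.symm φ)) l
    have h2 := he (e.symm φ)
    rw [e.apply_symm_apply] at h2
    rw [← h2]
    simp only [g, ← Multiset.coe_add] at h1 ⊢
    refine (add_le_add_left h1 _).trans ?_
    rw [List.take_of_length_le (by rw [hx'])]
    refine le_of_eq ?_
    rw [Finset.sum_range]
    simp only [x, x', y, coe_ofFn, Finset.sum_add_distrib, Fin.sum_univ_castSucc (n := l)]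
    simp [Fin.ofNat_eq_cast, -Multiset.singleton_add]
    abel
  · have hd := ladder_dens hl hη hE (le_trans (le_max_right _ _) hn) (by
      rw [div_le_iff₀ (by positivity)] at hn₁
      refine hn₁.trans ?_
      rw [mul_comm]
      gcongr
      exact le_trans (le_max_left _ _) hn) hS hT
      (List.nodup_append.1 hST).1 (List.nodup_append.1 hST).2.1
    refine (hd.equiv e.symm).mono le_rfl fun φ h => ?_
    have h1 := ladder_seg hS (hx (e.symm φ)) (hx' (e.symm φ)) (hy (e.symm φ)) (h _).1 (by
      intro i hi s hs
      have := (h (Fin.ofNat (l + 1) s)).2.2 (Fin.ofNat l i)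
      rw [Fin.val_ofNat, Nat.mod_eq_of_lt hi] at this
      exact this) l le_rfl
    refine h1.trans (Seg.edge h1.length_right rfl hT ?_)
    have := (h (Fin.ofNat (l + 1) l)).2.1
    rw [rung, List.take_of_length_le (by rw [hx']), List.drop_of_length_le (by rw [hx]),
      List.append_nil]
    exact this

/-- Two disjoint ends are connected by a positive proportion of the tuples of a bounded size. -/
theorem connect_dens {a d : ℕ} (had : 1 ≤ a + d) {η : ℝ} (hη : 0 < η) :
    ∃ M N : ℕ, ∃ c : ℝ, 0 < c ∧ ∃ n₀ : ℕ, ∀ n : ℕ, n₀ ≤ n →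
      ∃ f : (Fin M → Fin n) → Fin N → Fin n,
        (∀ φ, ∑ i, {f φ i} ≤ ∑ i, ({φ i} : Multiset (Fin n))) ∧
        ∀ E : Finset (Finset (Fin n)), DegCond η (2 * a + 3 + d) E → ∀ S T : List (Fin n),
          S.length = a + 1 → T.length = a + 1 → (S ++ T).Nodup →
            Dens c (fun φ => Seg E (a + 1) (d + 1) S (List.ofFn (f φ)) T) := by
  rcases Nat.eq_zero_or_pos d with rfl | hd
  · obtain ⟨M, N, c, hc, n₀, H⟩ := connect_dens_one (l := a + 1) (by omega) hη
    refine ⟨M, N, c, hc, n₀, fun n hn => ?_⟩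
    obtain ⟨f, hf, hE⟩ := H n hn
    have hf' : ∀ φ, List.ofFn (fun i => (f φ).get (Fin.cast (hf φ).1.symm i)) = f φ := by
      intro φ
      have := List.ofFn_congr (hf φ).1 (f φ).get
      rw [List.ofFn_get] at this
      exact this.symm
    refine ⟨fun φ i => (f φ).get (Fin.cast (hf φ).1.symm i), fun φ => ?_,
      fun E hE' S T hS hT hST => ?_⟩
    · rw [← coe_ofFn, hf']
      exact (hf φ).2
    · simp only [hf']
      exact hE E hE' S T hS hT hST
  · refine ⟨d + 1, d + 1, η / 8, by positivity, 2 + 2 * (2 * a + 3 + d) * (2 * a + 3 + d),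
      fun n hn => ⟨id, fun φ => le_rfl, fun E hE S T hS hT hST => ?_⟩⟩
    refine (hE.dens (m := d + 1) hη hn (B := (S : Multiset (Fin n)) + T)
      (Multiset.coe_nodup.2 hST) (by simp [hS, hT]; omega) (by omega) (isTup_fn _)).mono le_rfl
      fun φ h => Seg.edge hS (by simp) hT ?_
    rw [id, coe_ofFn, add_right_comm]
    exact h

theorem Dens.exists {α : Type} [Fintype α] [Nonempty α] {c : ℝ} (hc : 0 < c) {P : α → Prop}
    (h : Dens c P) : ∃ a, P a := by
  by_contra hcon
  push Not at hcon
  have h1 : {a | P a} = ∅ := Set.eq_empty_iff_forall_notMem.2 hcon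
  rw [Dens, h1, Set.ncard_empty, Nat.cast_zero] at h
  have h2 : (0 : ℝ) < Fintype.card α := by exact_mod_cast Fintype.card_pos
  exact absurd h (not_le.2 (mul_pos hc h2))

/-- Two disjoint ends are connected by a path which avoids a given small set. -/
theorem exists_connect {a d : ℕ} (had : 1 ≤ a + d) {η : ℝ} (hη : 0 < η) :
    ∃ N : ℕ, ∃ κ : ℝ, 0 < κ ∧ ∃ n₀ : ℕ, ∀ n : ℕ, n₀ ≤ n →
      ∀ E : Finset (Finset (Fin n)), DegCond η (2 * a + 3 + d) E → ∀ S T : List (Fin n),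
        S.length = a + 1 → T.length = a + 1 → (S ++ T).Nodup → ∀ F : Finset (Fin n),
          (F.card : ℝ) ≤ κ * n → ∃ I : List (Fin n), I.length = N ∧ I.Nodup ∧
            (∀ x ∈ F, x ∉ I) ∧ Seg E (a + 1) (d + 1) S I T := by
  obtain ⟨M, N, c, hc, n₀, H⟩ := connect_dens had hη
  obtain ⟨n₁, hn₁⟩ := exists_nat_ge ((M * M : ℝ) / (c / 4))
  refine ⟨N, c / 4 / (M + 1), by positivity, max (max n₀ n₁) 1, fun n hn E hE S T hS hT hST F hF => ?_⟩
  have hn1 : 1 ≤ n := le_trans (le_max_right _ _) hn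
  have hn2 : n₁ ≤ n := le_trans (le_trans (le_max_right _ _) (le_max_left _ _)) hn
  obtain ⟨f, hf, hE'⟩ := H n (le_trans (le_trans (le_max_left _ _) (le_max_left _ _)) hn)
  have h1 : (M * M : ℝ) ≤ c / 4 * n := by
    rw [div_le_iff₀ (by positivity)] at hn₁
    refine hn₁.trans ?_
    rw [mul_comm]
    gcongr
  have h2 : (M * F.card : ℝ) ≤ c / 4 * n := by
    calc (M * F.card : ℝ) ≤ (M + 1) * (c / 4 / (M + 1) * n) := by gcongr; linarith
      _ = c / 4 * n := by field_simp
  have hd := (hE' E hE S T hS hT hST).nodup hn1 (isTup_fn M) F (by push_cast; linarith)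
  have : Nonempty (Fin n) := ⟨⟨0, hn1⟩⟩
  obtain ⟨φ, hφ, hφn, hφF⟩ := hd.exists (by positivity)
  refine ⟨List.ofFn (f φ), by simp, ?_, fun x hx hx' => ?_, hφ⟩
  · rw [← Multiset.coe_nodup, coe_ofFn]
    exact Multiset.nodup_of_le (hf φ) hφn
  · refine hφF x hx (Multiset.mem_of_le (hf φ) ?_)
    rw [← coe_ofFn]
    exact hx'

/-- The tuples which fill an edge of size `2 * a + 3 + d` up to two vertices. -/
abbrev Tri (n a d : ℕ) : Type := (Fin (a + 1) → Fin n) × (Fin d → Fin n) × (Fin a → Fin n)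

/-- The vertices of a triple of tuples. -/
def Tri.verts {n a d : ℕ} (D : Tri n a d) : Multiset (Fin n) :=
  ∑ i, {D.1 i} + (∑ i, {D.2.1 i} + ∑ i, {D.2.2 i})

/-- The tuples which fill an edge of size `2 * a + 3 + d` up to `a + 2` vertices. -/
abbrev Duo (n a d : ℕ) : Type := (Fin d → Fin n) × (Fin (a + 1) → Fin n)

/-- The vertices of a pair of tuples. -/
def Duo.verts {n a d : ℕ} (R : Duo n a d) : Multiset (Fin n) :=
  ∑ i, {R.1 i} + ∑ i, {R.2 i}

/-- A segment with two edges, in which `y` can be exchanged for another vertex. -/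
def exch {n a d : ℕ} (D : Tri n a d) (R : Duo n a d) (y v w : Fin n) :
    List (Fin n) × List (Fin n) × List (Fin n) :=
  (List.ofFn D.1, y :: List.ofFn D.2.1 ++ (v :: List.ofFn D.2.2) ++ (w :: List.ofFn R.1),
    List.ofFn R.2)

section exch

variable {n a d : ℕ} {E : Finset (Finset (Fin n))}

theorem exch_seg {D : Tri n a d} {R : Duo n a d} {y v w : Fin n}
    (h : ({y} + {v} + D.verts).toFinset ∈ E)
    (h' : (∑ i, {D.2.2 i} + {v} + {w} + R.verts).toFinset ∈ E) :
    Seg E (a + 1) (d + 1) (exch D R y v w).1 (exch D R y v w).2.1 (exch D R y v w).2.2 := by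
  refine Seg.two_edges (Y₁ := List.ofFn D.1) (Dr := List.ofFn D.2.1) (D₂ := List.ofFn D.2.2)
    (Hr := List.ofFn R.1) (Y₃ := List.ofFn R.2) (by simp) (by simp) (by simp) (by simp) (by simp)
    ?_ ?_
  · convert h using 2
    simp only [coe_ofFn, Tri.verts]
    abel
  · convert h' using 2
    simp only [coe_ofFn, Duo.verts]
    abel

theorem exch_verts (D : Tri n a d) (R : Duo n a d) (y v w : Fin n) :
    (((exch D R y v w).1 : Multiset (Fin n)) + (exch D R y v w).2.1 + (exch D R y v w).2.2)
      = D.verts + R.verts + {y} + {v} + {w} := by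
  simp only [exch, ← Multiset.coe_add, ← Multiset.cons_coe, coe_ofFn, Tri.verts, Duo.verts,
    ← Multiset.singleton_add]
  abel

end exch

/-- The segments of an absorber. -/
def absorber {n a d r N : ℕ} (S T : Fin (a + 1) → Fin n) (A : Fin N → Fin n)
    (x y z : Fin (r + N) → Fin n) (L : Fin (r + N) → Tri n a d) (R : Fin (r + N) → Duo n a d)
    (p v w : Fin r → Fin n) (D : Fin r → Tri n a d) (R' : Fin r → Duo n a d) :
    List (List (Fin n) × List (Fin n) × List (Fin n)) :=
  (List.ofFn S, List.ofFn A, List.ofFn T) ::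
    (List.ofFn (fun i => exch (L i) (R i) (y i) (x i) (z i)) ++
      List.ofFn (fun j => exch (D j) (R' j) (p j) (v j) (w j)))

section absorber

variable {n a d r N : ℕ} {E : Finset (Finset (Fin n))} {S T : Fin (a + 1) → Fin n}
  {A : Fin N → Fin n} {x y z : Fin (r + N) → Fin n} {L : Fin (r + N) → Tri n a d}
  {R : Fin (r + N) → Duo n a d} {p v w : Fin r → Fin n} {D : Fin r → Tri n a d}
  {R' : Fin r → Duo n a d}

theorem absorber_verts : segVerts (absorber S T A x y z L R p v w D R') =
    ∑ i, {S i} + ∑ i, {A i} + ∑ i, {T i} +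
      ∑ i, ((L i).verts + (R i).verts + {y i} + {x i} + {z i}) +
        ∑ j, ((D j).verts + (R' j).verts + {p j} + {v j} + {w j}) := by
  simp only [absorber, segVerts_cons, segVerts_append, segVerts_ofFn, exch_verts, coe_ofFn]
  abel

theorem replaces_append {l m : ℕ} {L₁ L₂ L₁' L₂' : List (List (Fin n) × List (Fin n) × List (Fin n))}
    (h₁ : Replaces E l m L₁ L₁') (h₂ : Replaces E l m L₂ L₂') :
    Replaces E l m (L₁ ++ L₂) (L₁' ++ L₂') :=
  List.rel_append h₁ h₂

theorem replaces_ofFn {l m t : ℕ} {f g : Fin t → List (Fin n) × List (Fin n) × List (Fin n)}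
    (h : ∀ i, (g i).1 = (f i).1 ∧ (g i).2.2 = (f i).2.2 ∧
      Seg E l m (g i).1 (g i).2.1 (g i).2.2) :
    Replaces E l m (List.ofFn f) (List.ofFn g) := by
  rw [Replaces, List.forall₂_iff_get]
  refine ⟨by simp, fun i h₁ h₂ => ?_⟩
  simp only [List.get_eq_getElem, List.getElem_ofFn]
  exact h _

theorem absorber_replaces {x' y' z' : Fin (r + N) → Fin n}
    {p' v' w' : Fin r → Fin n} {I : List (Fin n)}
    (h₁ : Seg E (a + 1) (d + 1) (List.ofFn S) I (List.ofFn T))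
    (h₂ : ∀ i, ({y' i} + {x' i} + (L i).verts).toFinset ∈ E)
    (h₃ : ∀ i, (∑ t, {(L i).2.2 t} + {x' i} + {z' i} + (R i).verts).toFinset ∈ E)
    (h₄ : ∀ i, ({p' i} + {v' i} + (D i).verts).toFinset ∈ E)
    (h₅ : ∀ i, (∑ t, {(D i).2.2 t} + {v' i} + {w' i} + (R' i).verts).toFinset ∈ E) :
    Replaces E (a + 1) (d + 1) (absorber S T A x y z L R p v w D R')
      ((List.ofFn S, I, List.ofFn T) ::
        (List.ofFn (fun i => exch (L i) (R i) (y' i) (x' i) (z' i)) ++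
          List.ofFn (fun j => exch (D j) (R' j) (p' j) (v' j) (w' j)))) :=
  List.Forall₂.cons ⟨rfl, rfl, h₁⟩ (replaces_append
    (replaces_ofFn fun i => ⟨rfl, rfl, exch_seg (h₂ i) (h₃ i)⟩)
    (replaces_ofFn fun i => ⟨rfl, rfl, exch_seg (h₄ i) (h₅ i)⟩))

/-- An absorber can be rerouted so that it gains the vertices of `u`. -/
theorem absorber_absorbs {u : Fin r → Fin n}
    (h₁ : Seg E (a + 1) (d + 1) (List.ofFn S) (List.ofFn A) (List.ofFn T))
    (h₁' : Seg E (a + 1) (d + 1) (List.ofFn S) (List.ofFn y) (List.ofFn T))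
    (h₂ : ∀ i, ({y i} + {x i} + (L i).verts).toFinset ∈ E)
    (h₂' : ∀ i, ({Fin.append p A i} + {z i} + (L i).verts).toFinset ∈ E)
    (h₃ : ∀ i, (∑ t, {(L i).2.2 t} + {x i} + {z i} + (R i).verts).toFinset ∈ E)
    (h₄ : ∀ i, ({p i} + {v i} + (D i).verts).toFinset ∈ E)
    (h₄' : ∀ i, ({u i} + {w i} + (D i).verts).toFinset ∈ E)
    (h₅ : ∀ i, (∑ t, {(D i).2.2 t} + {v i} + {w i} + (R' i).verts).toFinset ∈ E) :
    Replaces E (a + 1) (d + 1) (absorber S T A x y z L R p v w D R')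
        (absorber S T A x y z L R p v w D R') ∧
      ∃ L', Replaces E (a + 1) (d + 1) (absorber S T A x y z L R p v w D R') L' ∧
        segVerts L' = segVerts (absorber S T A x y z L R p v w D R') + ∑ i, {u i} := by
  refine ⟨absorber_replaces h₁ h₂ h₃ h₄ h₅, _, absorber_replaces (z' := x) (w' := v) h₁' h₂'
    (fun i => ?_) h₄' (fun i => ?_), ?_⟩
  · rw [add_right_comm (∑ t, _) {z i}]; exact h₃ i
  · rw [add_right_comm (∑ t, _) {w i}]; exact h₅ i
  · rw [absorber_verts, segVerts_cons, segVerts_append, segVerts_ofFn, segVerts_ofFn]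
    simp only [exch_verts, coe_ofFn, Finset.sum_add_distrib]
    rw [Fin.sum_univ_add (fun i => ({Fin.append p A i} : Multiset (Fin n)))]
    simp only [Fin.append_left, Fin.append_right]
    abel

end absorber

theorem eventually_nodup (M : ℕ) {c : ℝ} (hc : 0 < c) : ∃ n₀ : ℕ, ∀ n : ℕ, n₀ ≤ n →
    ∀ {α : Type} [Fintype α] {vs : α → Multiset (Fin n)} {P : α → Prop}, IsTup M vs →
      Dens c P → Dens (c / 2) (fun a => P a ∧ (vs a).Nodup) := by
  obtain ⟨n₁, hn₁⟩ := exists_nat_ge (((M * M : ℕ) : ℝ) / (c / 2))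
  refine ⟨max n₁ 1, fun n hn α _ vs P hT h => ?_⟩
  refine (h.nodup (le_trans (le_max_right _ _) hn) hT ∅ ?_).mono le_rfl
    fun a ha => ⟨ha.1, ha.2.1⟩
  rw [div_le_iff₀ (by positivity)] at hn₁
  rw [card_empty, Nat.mul_zero, Nat.add_zero]
  refine hn₁.trans ?_
  rw [mul_comm]
  gcongr
  exact le_trans (le_max_left _ _) hn

theorem isTup_tri {n a d : ℕ} : IsTup (a + 1 + (d + a)) (Tri.verts : Tri n a d → _) :=
  (isTup_fn _).prod ((isTup_fn _).prod (isTup_fn _))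

theorem isTup_duo {n a d : ℕ} : IsTup (d + (a + 1)) (Duo.verts : Duo n a d → _) :=
  (isTup_fn _).prod (isTup_fn _)

/-- The part of an absorber which is shared by all ways of rerouting it. -/
abbrev Core (n a d r : ℕ) : Type :=
  ((Fin (a + 1) → Fin n) × (Fin (a + 1) → Fin n)) × (Fin r → (Tri n a d × Fin n) × Fin n)

/-- The vertices of the core of an absorber. -/
def Core.verts {n a d r : ℕ} (o : Core n a d r) : Multiset (Fin n) :=
  ∑ i, {o.1.1 i} + ∑ i, {o.1.2 i} + ∑ j, ((o.2 j).1.1.verts + {(o.2 j).1.2} + {(o.2 j).2})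

/-- The part of an absorber which is released when it is rerouted. -/
abbrev Loose (n r M : ℕ) : Type := (Fin r → Fin n) × (Fin M → Fin n)

/-- The vertices of the loose part of an absorber. -/
def Loose.verts {n r M : ℕ} (x : Loose n r M) : Multiset (Fin n) := ∑ i, {x.1 i} + ∑ i, {x.2 i}

/-- The part of an absorber along which the path is rerouted. -/
abbrev Detour (n a d M : ℕ) : Type :=
  ((Fin (d + 1) → Fin n) × (Fin (a + 1) → Fin n)) × (Fin M → Fin n)

/-- The vertices of the detour of an absorber. -/
def Detour.verts {n a d M : ℕ} (y : Detour n a d M) : Multiset (Fin n) :=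
  ∑ i, {y.1.1 i} + ∑ i, {y.1.2 i} + ∑ i, {y.2 i}

theorem isTup_core {n a d r : ℕ} :
    IsTup (a + 1 + (a + 1) + r * (a + 1 + (d + a) + 1 + 1)) (Core.verts : Core n a d r → _) :=
  ((isTup_fn _).prod (isTup_fn _)).prod (((isTup_tri.prod isTup_base).prod isTup_base).pi r)

theorem isTup_loose {n r M : ℕ} : IsTup (r + M) (Loose.verts : Loose n r M → _) :=
  (isTup_fn _).prod (isTup_fn _)

theorem isTup_detour {n a d M : ℕ} :
    IsTup (d + 1 + (a + 1) + M) (Detour.verts : Detour n a d M → _) :=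
  ((isTup_fn _).prod (isTup_fn _)).prod (isTup_fn _)

/-- The loose part can be replaced by the detour, and the vertices of `u` can be exchanged for
vertices of the loose part. -/
structure CoreGood {n a d r M N : ℕ} (E : Finset (Finset (Fin n)))
    (f : (Fin M → Fin n) → Fin N → Fin n) (u : Fin r → Fin n)
    (o : Core n a d r) (x : Loose n r M) (y : Detour n a d M) : Prop where
  seg : Seg E (a + 1) (d + 1) (List.ofFn o.1.1) (List.ofFn (f x.2)) (List.ofFn o.1.2)
  seg' : Seg E (a + 1) (d + 1) (List.ofFn o.1.1)
    (List.ofFn y.1.1 ++ List.ofFn y.1.2 ++ List.ofFn (f y.2)) (List.ofFn o.1.2)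
  edge : ∀ j, ({u j} + {(o.2 j).1.2} + (o.2 j).1.1.verts).toFinset ∈ E
  edge' : ∀ j, ({x.1 j} + {(o.2 j).2} + (o.2 j).1.1.verts).toFinset ∈ E

theorem gadget_dens {n a d : ℕ} {η : ℝ} (hη : 0 < η) {E : Finset (Finset (Fin n))}
    (hE : DegCond η (2 * a + 3 + d) E) (hn : 2 + 2 * (2 * a + 3 + d) * (2 * a + 3 + d) ≤ n)
    (u : Fin n) :
    Dens (η / 8 * (η / 8)) (fun q : (Tri n a d × Fin n) × (Fin n × Fin n) =>
      ({u} + {q.1.2} + q.1.1.verts).toFinset ∈ E ∧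
        ({q.2.2} + {q.2.1} + q.1.1.verts).toFinset ∈ E) := by
  refine Dens.prod (α := Tri n a d × Fin n) (β := Fin n × Fin n) (c₁ := η / 8) (c₂ := η / 8)
    (P := fun q => ({u} + {q.2} + q.1.verts).toFinset ∈ E)
    (Q := fun q p => ({p.2} + {p.1} + q.1.verts).toFinset ∈ E) ?_ (by positivity) ?_
  · refine (hE.dens hη hn (B := {u}) (Multiset.nodup_singleton u) ?_ ?_
      (isTup_tri.prod isTup_base)).mono le_rfl fun q hq => ?_
    · rw [Multiset.card_singleton]; omega
    · omega
    · rw [add_assoc, add_comm ({q.2} : Multiset (Fin n))]; exact hq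
  · intro q hq
    have hq' := hE.nodup (by simp [isTup_tri.card_vs]; omega) hq
    refine (hE.dens hη hn (B := q.1.verts)
      (Multiset.nodup_of_le (Multiset.le_add_left _ _) hq') ?_ le_rfl
      (isTup_base.prod isTup_base)).mono le_rfl fun p hp => ?_
    · rw [isTup_tri.card_vs]; omega
    · rw [add_comm, add_comm ({p.2} : Multiset (Fin n))]; exact hp

theorem core_dens {a d : ℕ} (r M N : ℕ) {η c₀ : ℝ} (hη : 0 < η) (hc₀ : 0 < c₀) :
    ∃ c : ℝ, 0 < c ∧ ∃ n₀ : ℕ, ∀ n : ℕ, n₀ ≤ n → ∀ f : (Fin M → Fin n) → Fin N → Fin n,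
      ∀ E : Finset (Finset (Fin n)), DegCond η (2 * a + 3 + d) E →
        (∀ S T : List (Fin n), S.length = a + 1 → T.length = a + 1 → (S ++ T).Nodup →
          Dens c₀ (fun φ => Seg E (a + 1) (d + 1) S (List.ofFn (f φ)) T)) →
        ∀ u : Fin r → Fin n,
          Dens c (fun ω : (Core n a d r × Loose n r M) × Detour n a d M =>
            CoreGood E f u ω.1.1 ω.1.2 ω.2 ∧
              (ω.1.1.verts + ω.1.2.verts + ω.2.verts).Nodup) := by
  obtain ⟨n₁, h₁⟩ := eventually_nodup (a + 1 + (a + 1)) (c := 1) one_pos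
  obtain ⟨n₂, h₂⟩ := eventually_nodup (a + 1 + (a + 1) + (d + 1 + (a + 1)))
    (c := 1 / 2 * (η / 8)) (by positivity)
  obtain ⟨n₃, h₃⟩ := eventually_nodup (a + 1 + (a + 1) + r * (a + 1 + (d + a) + 1 + 1) + (r + M) +
    (d + 1 + (a + 1) + M)) (c := 1 / 2 * (η / 8) / 2 * (c₀ * c₀ * (η / 8 * (η / 8)) ^ r))
    (by positivity)
  refine ⟨1 / 2 * (η / 8) / 2 * (c₀ * c₀ * (η / 8 * (η / 8)) ^ r) / 2, by positivity,
    n₁ + n₂ + n₃ + (2 + 2 * (2 * a + 3 + d) * (2 * a + 3 + d)), fun n hn f E hE hf u => ?_⟩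
  have hn' : 2 + 2 * (2 * a + 3 + d) * (2 * a + 3 + d) ≤ n := by omega
  have hST : IsTup (n := n) (a + 1 + (a + 1))
      (fun x : (Fin (a + 1) → Fin n) × (Fin (a + 1) → Fin n) => ∑ i, {x.1 i} + ∑ i, {x.2 i}) :=
    (isTup_fn _).prod (isTup_fn _)
  have hbX : IsTup (n := n) (d + 1 + (a + 1))
      (fun x : (Fin (d + 1) → Fin n) × (Fin (a + 1) → Fin n) => ∑ i, {x.1 i} + ∑ i, {x.2 i}) :=
    (isTup_fn _).prod (isTup_fn _)
  have d₁ := h₁ n (by omega) hST (P := fun _ => True) (by rw [dens_iff]; simp)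
  have d₂ := h₂ n (by omega) (hST.prod hbX) (d₁.prod (c₂ := η / 8)
    (Q := fun x y => (∑ i, ({x.1 i} : Multiset (Fin n)) + (∑ i, {y.1 i} + ∑ i, {y.2 i})).toFinset ∈ E)
    (by positivity) (by
      intro x hx
      refine hE.dens hη hn' (B := ∑ i, {x.1 i})
        (Multiset.nodup_of_le (Multiset.le_add_right _ _) hx.2) ?_ (by omega) hbX
      simp; omega))
  have d₃ := d₂.prod (β := ((Fin M → Fin n) × (Fin M → Fin n)) ×
      (Fin r → (Tri n a d × Fin n) × (Fin n × Fin n)))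
    (c₂ := c₀ * c₀ * (η / 8 * (η / 8)) ^ r)
    (Q := fun x y => (Seg E (a + 1) (d + 1) (List.ofFn x.1.1) (List.ofFn (f y.1.1))
        (List.ofFn x.1.2) ∧ Seg E (a + 1) (d + 1) (List.ofFn x.2.2) (List.ofFn (f y.1.2))
        (List.ofFn x.1.2)) ∧ ∀ j, ({u j} + {(y.2 j).1.2} + (y.2 j).1.1.verts).toFinset ∈ E ∧
        ({(y.2 j).2.2} + {(y.2 j).2.1} + (y.2 j).1.1.verts).toFinset ∈ E)
    (by positivity) (by
      intro x hx
      have hx' := hx.2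
      have hc₁ : (List.ofFn x.1.1 ++ List.ofFn x.1.2).Nodup := by
        rw [← Multiset.coe_nodup, ← Multiset.coe_add, coe_ofFn, coe_ofFn]
        exact Multiset.nodup_of_le (Multiset.le_add_right _ _) hx'
      have hc₂ : (List.ofFn x.2.2 ++ List.ofFn x.1.2).Nodup := by
        rw [← Multiset.coe_nodup, ← Multiset.coe_add, coe_ofFn, coe_ofFn, add_comm]
        exact Multiset.nodup_of_le
          (add_le_add (Multiset.le_add_left _ _) (Multiset.le_add_left _ _)) hx'
      have e₁ := hf _ _ (by simp) (by simp) hc₁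
      have e₂ := hf _ _ (by simp) (by simp) hc₂
      have e₃ := Dens.pi (by positivity) fun j : Fin r => gadget_dens hη hE hn' (u j)
      rw [Fintype.card_fin] at e₃
      have e₄ := (e₁.prod hc₀.le fun _ _ => e₂).prod (by positivity) fun _ _ => e₃
      exact e₄.mono le_rfl fun _ h => h)
  let e : (Core n a d r × Loose n r M) × Detour n a d M ≃
      (((Fin (a + 1) → Fin n) × (Fin (a + 1) → Fin n)) ×
        ((Fin (d + 1) → Fin n) × (Fin (a + 1) → Fin n))) ×
      (((Fin M → Fin n) × (Fin M → Fin n)) ×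
        (Fin r → (Tri n a d × Fin n) × (Fin n × Fin n))) :=
    { toFun := fun ω => ((ω.1.1.1, ω.2.1), ((ω.1.2.2, ω.2.2),
        fun j => ((ω.1.1.2 j).1, ((ω.1.1.2 j).2, ω.1.2.1 j))))
      invFun := fun x => (((x.1.1, fun j => ((x.2.2 j).1, (x.2.2 j).2.1)),
        (fun j => (x.2.2 j).2.2, x.2.1.1)), (x.1.2, x.2.1.2))
      left_inv := fun _ => rfl
      right_inv := fun _ => rfl }
  refine (h₃ n (by omega) ((isTup_core.prod isTup_loose).prod isTup_detour)
    (d₃.equiv e)).mono le_rfl fun ω hω => ⟨?_, hω.2⟩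
  obtain ⟨⟨⟨⟨-, g₁⟩, -⟩, ⟨g₂, g₃⟩, g₄⟩, -⟩ := hω
  refine ⟨g₂, (Seg.edge (by simp) (by simp) (by simp) ?_).trans g₃, fun j => (g₄ j).1,
    fun j => (g₄ j).2⟩
  rw [coe_ofFn, coe_ofFn, coe_ofFn, add_assoc]
  exact g₁

theorem doubled_dens {n a d q : ℕ} (had : 1 ≤ a + d) {η : ℝ} (hη : 0 < η)
    {E : Finset (Finset (Fin n))} (hE : DegCond η (2 * a + 3 + d) E)
    (hn : 2 + 2 * (2 * a + 3 + d) * (2 * a + 3 + d) ≤ n) {α β γ : Type} [Fintype α] [Fintype β]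
    [Fintype γ] {P : α → β → γ → Prop} {c : ℝ} (hc : 0 < c)
    (h : Dens c (fun ω : (α × β) × γ => P ω.1.1 ω.1.2 ω.2)) (x : β → Fin q → Fin n)
    (y : γ → Fin q → Fin n) (hne : ∀ o b b', P o b b' → ∀ i, x b i ≠ y b' i) :
    Dens (((c * (η / 8) ^ q) ^ 2) ^ 2)
      (fun ω : ((α × (Fin q → Tri n a d)) × (Fin 2 → β)) × (Fin 2 → γ) => ∀ s s',
        P ω.1.1.1 (ω.1.2 s) (ω.2 s') ∧
          ∀ i, ({x (ω.1.2 s) i} + {y (ω.2 s') i} + (ω.1.1.2 i).verts).toFinset ∈ E) := by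
  have h₁ := h.prod (β := Fin q → Tri n a d) (c₂ := (η / 8) ^ q)
    (Q := fun ω L => ∀ i, ({x ω.1.2 i} + {y ω.2 i} + (L i).verts).toFinset ∈ E)
    (by positivity) (by
      intro ω hω
      have := Dens.pi (ι := Fin q) (β := Tri n a d) (c := η / 8)
        (Q := fun i L => ({x ω.1.2 i} + {y ω.2 i} + L.verts).toFinset ∈ E) (by positivity)
        fun i => hE.dens hη hn (by
          have := hne _ _ _ hω i
          rw [Multiset.singleton_add, Multiset.nodup_cons]
          exact ⟨by simpa using this, Multiset.nodup_singleton _⟩)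
          (by rw [Multiset.card_add, Multiset.card_singleton, Multiset.card_singleton]; omega)
          (by omega) isTup_tri
      rwa [Fintype.card_fin] at this)
  let e : ((α × (Fin q → Tri n a d)) × γ) × β ≃ ((α × β) × γ) × (Fin q → Tri n a d) :=
    { toFun := fun ω => (((ω.1.1.1, ω.2), ω.1.2), ω.1.1.2)
      invFun := fun ω => (((ω.1.1.1, ω.2), ω.1.2), ω.1.1.2)
      left_inv := fun _ => rfl
      right_inv := fun _ => rfl }
  have h₂ := (h₁.equiv e).dup (by positivity) 1
  let e' : ((α × (Fin q → Tri n a d)) × (Fin 2 → β)) × γ ≃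
      ((α × (Fin q → Tri n a d)) × γ) × (Fin 2 → β) :=
    { toFun := fun ω => ((ω.1.1, ω.2), ω.1.2)
      invFun := fun ω => ((ω.1.1, ω.2), ω.1.2)
      left_inv := fun _ => rfl
      right_inv := fun _ => rfl }
  exact ((h₂.equiv e').dup (by positivity) 1).mono le_rfl fun ω hω s s' => hω s' s

theorem sum_append {n s t : ℕ} (p : Fin s → Fin n) (q : Fin t → Fin n) :
    ∑ i, ({Fin.append p q i} : Multiset (Fin n)) = ∑ i, {p i} + ∑ i, {q i} := by
  simp [Fin.sum_univ_add]

section tuples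

variable {n a d M N : ℕ}

/-- The vertices exchanged in the loose part. -/
def Loose.fn {r : ℕ} (f : (Fin M → Fin n) → Fin N → Fin n) (x : Loose n r M) :
    Fin (r + N) → Fin n :=
  Fin.append x.1 (f x.2)

/-- The vertices exchanged in the detour. -/
def Detour.fn (f : (Fin M → Fin n) → Fin N → Fin n) (y : Detour n a d M) :
    Fin (d + 1 + (a + 1) + N) → Fin n :=
  Fin.append (Fin.append y.1.1 y.1.2) (f y.2)

variable {f : (Fin M → Fin n) → Fin N → Fin n}
  (hf : ∀ φ, ∑ i, {f φ i} ≤ ∑ i, ({φ i} : Multiset (Fin n)))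

include hf

theorem Loose.fn_le {r : ℕ} (x : Loose n r M) : ∑ i, {x.fn f i} ≤ x.verts := by
  simp only [Loose.fn, sum_append]
  exact add_le_add_right (hf _) _

theorem Detour.fn_le (y : Detour n a d M) : ∑ i, {y.fn f i} ≤ y.verts := by
  simp only [Detour.fn, sum_append]
  exact add_le_add_right (hf _) _

end tuples

/-- The parameters of an absorber, except for those which complete the second edges of the
exchanges. -/
abbrev Frame (n a d M N : ℕ) : Type :=
  ((Core n a d (d + 1 + (a + 1)) × (Fin (d + 1 + (a + 1) + N) → Tri n a d)) ×
    (Fin 2 → Loose n (d + 1 + (a + 1)) M)) × (Fin 2 → Detour n a d M)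

/-- The parameters which complete the second edges of the exchanges of an absorber. -/
abbrev Fill (n a d N : ℕ) : Type :=
  (Fin (d + 1 + (a + 1) + N) → Duo n a d) × (Fin (d + 1 + (a + 1)) → Duo n a d)

/-- The absorber with the given parameters. -/
def absorberOf {n a d M N : ℕ} (f : (Fin M → Fin n) → Fin N → Fin n)
    (ω : Frame n a d M N × Fill n a d N) :
    List (List (Fin n) × List (Fin n) × List (Fin n)) :=
  absorber ω.1.1.1.1.1.1 ω.1.1.1.1.1.2 (f (ω.1.1.2 0).2) ((ω.1.1.2 1).fn f) ((ω.1.2 0).fn f)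
    ((ω.1.2 1).fn f) ω.1.1.1.2 ω.2.1 (ω.1.1.2 0).1 (fun j => (ω.1.1.1.1.2 j).2)
    (fun j => (ω.1.1.1.1.2 j).1.2) (fun j => (ω.1.1.1.1.2 j).1.1) ω.2.2

/-- The vertices of the parameters of an absorber. -/
def paramVerts {n a d M N : ℕ} (ω : Frame n a d M N × Fill n a d N) : Multiset (Fin n) :=
  ω.1.1.1.1.verts + ∑ i, (ω.1.1.1.2 i).verts + ∑ s, (ω.1.1.2 s).verts + ∑ s, (ω.1.2 s).verts +
    (∑ i, (ω.2.1 i).verts + ∑ j, (ω.2.2 j).verts)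

theorem exists_isTup_paramVerts (a d M N : ℕ) :
    ∃ K, ∀ n, IsTup K (paramVerts : Frame n a d M N × Fill n a d N → _) :=
  ⟨_, fun _ => (((isTup_core.prod (isTup_tri.pi _)).prod (isTup_loose.pi 2)).prod
    (isTup_detour.pi 2)).prod ((isTup_duo.pi _).prod (isTup_duo.pi _))⟩

theorem absorberOf_verts_le {n a d M N : ℕ} {f : (Fin M → Fin n) → Fin N → Fin n}
    (hf : ∀ φ, ∑ i, {f φ i} ≤ ∑ i, ({φ i} : Multiset (Fin n)))
    (ω : Frame n a d M N × Fill n a d N) : segVerts (absorberOf f ω) ≤ paramVerts ω := by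
  obtain ⟨⟨⟨⟨o, L⟩, x⟩, y⟩, R, R'⟩ := ω
  rw [absorberOf, absorber_verts]
  calc _ = o.verts + ∑ i, (L i).verts + (∑ i, {(x 0).1 i} + ∑ i, {f (x 0).2 i}
          + ∑ i, {(x 1).fn f i}) + (∑ i, {(y 0).fn f i} + ∑ i, {(y 1).fn f i})
          + (∑ i, (R i).verts + ∑ i, (R' i).verts) := by
        simp only [Core.verts, Finset.sum_add_distrib]
        abel
    _ ≤ o.verts + ∑ i, (L i).verts + ((x 0).verts
          + (x 1).verts) + ((y 0).verts + (y 1).verts)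
          + (∑ i, (R i).verts + ∑ i, (R' i).verts) := by
        gcongr
        · exact add_le_add_right (hf _) _
        · exact Loose.fn_le hf _
        · exact Detour.fn_le hf _
        · exact Detour.fn_le hf _
    _ = _ := by simp only [paramVerts, Fin.sum_univ_two]

theorem duo_dens {n a d : ℕ} (had : 1 ≤ a + d) {η : ℝ} (hη : 0 < η)
    {E : Finset (Finset (Fin n))} (hE : DegCond η (2 * a + 3 + d) E)
    (hn : 2 + 2 * (2 * a + 3 + d) * (2 * a + 3 + d) ≤ n) {D : Tri n a d} {v w : Fin n}
    (h : ({v} + {w} + D.verts).Nodup) :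
    Dens (η / 8) (fun R : Duo n a d =>
      (∑ t, {D.2.2 t} + {v} + {w} + R.verts).toFinset ∈ E) := by
  refine hE.dens hη hn (Multiset.nodup_of_le ?_ h) ?_ (by omega) isTup_duo
  · calc ∑ t, {D.2.2 t} + {v} + {w} = {v} + {w} + ∑ t, ({D.2.2 t} : Multiset (Fin n)) := by abel
      _ ≤ {v} + {w} + D.verts := by
        rw [Tri.verts, ← add_assoc (∑ i, {D.1 i})]
        exact add_le_add_right (Multiset.le_add_left _ _) _
  · simp; omega

set_option synthInstance.maxSize 1000 in
/-- A positive proportion of the tuples of a bounded size are absorbers for a given tuple. -/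
theorem absorber_dens {a d : ℕ} (had : 1 ≤ a + d) {η : ℝ} (hη : 0 < η) :
    ∃ K : ℕ, ∃ c : ℝ, 0 < c ∧ ∃ n₀ : ℕ, ∀ n : ℕ, n₀ ≤ n →
      ∃ g : (Fin K → Fin n) → List (List (Fin n) × List (Fin n) × List (Fin n)),
        (∀ τ, g τ ≠ [] ∧ segVerts (g τ) ≤ ∑ i, {τ i}) ∧
        ∀ E : Finset (Finset (Fin n)), DegCond η (2 * a + 3 + d) E →
          ∀ u : Fin (d + 1 + (a + 1)) → Fin n, Dens c (fun τ =>
            Replaces E (a + 1) (d + 1) (g τ) (g τ) ∧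
              ∃ L', Replaces E (a + 1) (d + 1) (g τ) L' ∧
                segVerts L' = segVerts (g τ) + ∑ i, {u i}) := by
  obtain ⟨M, N, c₀, hc₀, n₁, h₁⟩ := connect_dens had hη
  obtain ⟨K, hK⟩ := exists_isTup_paramVerts a d M N
  obtain ⟨c₁, hc₁, n₂, h₂⟩ := core_dens (a := a) (d := d) (d + 1 + (a + 1)) M N hη hc₀
  refine ⟨K, ((c₁ * (η / 8) ^ (d + 1 + (a + 1) + N)) ^ 2) ^ 2 *
    ((η / 8) ^ (d + 1 + (a + 1) + N) * (η / 8) ^ (d + 1 + (a + 1))), by positivity,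
    n₁ + n₂ + (2 + 2 * (2 * a + 3 + d) * (2 * a + 3 + d)), fun n hn => ?_⟩
  obtain ⟨f, hf, hf'⟩ := h₁ n (by omega)
  obtain ⟨e, he⟩ := hK n
  have hn' : 2 + 2 * (2 * a + 3 + d) * (2 * a + 3 + d) ≤ n := by omega
  refine ⟨fun τ => absorberOf f (e.symm τ), fun τ => ⟨by simp [absorberOf, absorber], ?_⟩,
    fun E hE u => ?_⟩
  · have h3 := he (e.symm τ)
    rw [e.apply_symm_apply] at h3
    rw [← h3]
    exact absorberOf_verts_le hf _
  have d₁ := doubled_dens had hη hE hn' (P := fun o x y => CoreGood E f u o x y ∧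
    (o.verts + x.verts + y.verts).Nodup) hc₁ (h₂ n (by omega) f E hE (hf' E hE) u)
    (fun x => x.fn f) (fun y => y.fn f) (by
      intro o x y h i hi
      have h1 : (∑ i, {x.fn f i} + ∑ i, {y.fn f i} : Multiset (Fin n)).Nodup :=
        Multiset.nodup_of_le (add_le_add ((Loose.fn_le hf x).trans (Multiset.le_add_left _ _))
          (Detour.fn_le hf y)) h.2
      rw [Multiset.nodup_add, Multiset.disjoint_left] at h1
      refine h1.2.2 (?_ : x.fn f i ∈ _) ?_
      · exact Multiset.mem_sum.2 ⟨i, mem_univ _, by simp⟩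
      · exact Multiset.mem_sum.2 ⟨i, mem_univ _, by simp [hi]⟩)
  have d₂ := d₁.prod (β := Fill n a d N)
    (c₂ := (η / 8) ^ (d + 1 + (a + 1) + N) * (η / 8) ^ (d + 1 + (a + 1)))
    (Q := fun ω R => (∀ i, (∑ t, {(ω.1.1.2 i).2.2 t} + {(ω.1.2 1).fn f i} + {(ω.2 1).fn f i} +
        (R.1 i).verts).toFinset ∈ E) ∧ ∀ j, (∑ t, {(ω.1.1.1.2 j).1.1.2.2 t} +
          {(ω.1.1.1.2 j).2} + {(ω.1.1.1.2 j).1.2} + (R.2 j).verts).toFinset ∈ E)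
    (by positivity) (by
      intro ω hω
      have e₁ := Dens.pi (by positivity) fun i : Fin (d + 1 + (a + 1) + N) =>
        duo_dens had hη hE hn' (D := ω.1.1.2 i) (v := (ω.1.2 1).fn f i) (w := (ω.2 1).fn f i)
          (hE.nodup (by simp [isTup_tri.card_vs]; omega) ((hω 1 1).2 i))
      have e₂ := Dens.pi (by positivity) fun j : Fin (d + 1 + (a + 1)) =>
        duo_dens had hη hE hn' (D := (ω.1.1.1.2 j).1.1) (v := (ω.1.1.1.2 j).2)
          (w := (ω.1.1.1.2 j).1.2) (by
            refine Multiset.nodup_of_le ?_ (hω 0 0).1.2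
            rw [add_assoc (Core.verts _)]
            refine le_trans (le_trans ?_ (Multiset.le_add_left _ _)) (Multiset.le_add_right _ _)
            refine le_trans (le_of_eq ?_) (Finset.single_le_sum (fun _ _ => Multiset.zero_le _)
              (mem_univ j))
            abel)
      rw [Fintype.card_fin] at e₁ e₂
      have e₃ := e₁.prod (by positivity) fun _ _ => e₂
      exact e₃.mono le_rfl fun _ h => h)
  refine (d₂.equiv e.symm).mono le_rfl fun τ hτ => ?_
  obtain ⟨g₁, g₂, g₃⟩ := hτ
  refine absorber_absorbs (g₁ 0 0).1.1.seg ?_ (fun i => ?_) (fun i => (g₁ 0 1).2 i) g₂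
    (g₁ 0 0).1.1.edge' (g₁ 0 0).1.1.edge g₃
  · rw [Detour.fn, List.ofFn_fin_append, List.ofFn_fin_append]
    exact (g₁ 0 0).1.1.seg'
  · rw [add_comm ({_} : Multiset (Fin n)) {_}]
    exact (g₁ 1 0).2 i

section selection

variable {n K : ℕ} {ι : Type} [Fintype ι] {c : ℝ} {G : ι → (Fin K → Fin n) → Prop}

open Classical in
theorem exists_halving [Nonempty ι] (hn : 0 < n) (hc : 0 < c) (hG : ∀ ρ, Dens c (G ρ))
    (w : ι → ℝ) (hw : ∀ ρ, 0 ≤ w ρ) (F : Finset (Fin n))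
    (hF : ((K * K + K * F.card : ℕ) : ℝ) ≤ c / 2 * n) :
    ∃ τ : Fin K → Fin n, (∃ ρ, G ρ τ) ∧ (∑ i, {τ i} : Multiset (Fin n)).Nodup ∧
      (∀ x ∈ F, x ∉ (∑ i, {τ i} : Multiset (Fin n))) ∧
      ∑ ρ, (if G ρ τ then 1 / 2 else 1) * w ρ ≤ (1 - c / 4) * ∑ ρ, w ρ := by
  let A : Finset (Fin K → Fin n) := univ.filter fun τ => (∃ ρ, G ρ τ) ∧
    (∑ i, {τ i} : Multiset (Fin n)).Nodup ∧ ∀ x ∈ F, x ∉ (∑ i, {τ i} : Multiset (Fin n))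
  have h1 : ∀ ρ, c / 2 * (A.card : ℝ) ≤ ((A.filter (G ρ)).card : ℝ) := by
    intro ρ
    have h := (hG ρ).nodup hn (isTup_fn K) F hF
    rw [dens_iff] at h
    calc c / 2 * (A.card : ℝ) ≤ c / 2 * Fintype.card (Fin K → Fin n) := by
          gcongr; exact card_le_univ A
      _ ≤ _ := h
      _ ≤ _ := by
        norm_cast
        refine card_le_card fun τ hτ => ?_
        simp only [A, mem_filter, mem_univ, true_and] at hτ ⊢
        exact ⟨⟨⟨ρ, hτ.1⟩, hτ.2⟩, hτ.1⟩
  have hA : A.Nonempty := by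
    obtain ⟨ρ⟩ := (inferInstance : Nonempty ι)
    have : Nonempty (Fin n) := ⟨⟨0, hn⟩⟩
    obtain ⟨τ, hτ⟩ := ((hG ρ).nodup hn (isTup_fn K) F hF).exists (by positivity)
    exact ⟨τ, mem_filter.2 ⟨mem_univ _, ⟨ρ, hτ.1⟩, hτ.2⟩⟩
  have h2 : ∑ τ ∈ A, ∑ ρ, (if G ρ τ then 1 / 2 else 1) * w ρ
      ≤ ∑ τ ∈ A, (1 - c / 4) * ∑ ρ, w ρ := by
    rw [sum_comm, sum_const, nsmul_eq_mul, mul_sum, mul_sum]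
    refine sum_le_sum fun ρ _ => ?_
    rw [← sum_mul, ← mul_assoc]
    refine mul_le_mul_of_nonneg_right ?_ (hw ρ)
    have h3 : ∀ τ, (if G ρ τ then (1 / 2 : ℝ) else 1) = 1 - 1 / 2 * (if G ρ τ then 1 else 0) := by
      intro τ; split_ifs <;> norm_num
    simp only [h3, sum_sub_distrib, ← mul_sum, sum_boole]
    have := h1 ρ
    simp only [sum_const, nsmul_eq_mul, mul_one]
    linarith
  obtain ⟨τ, hτ, h⟩ := exists_le_of_sum_le hA h2
  simp only [A, mem_filter, mem_univ, true_and] at hτ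
  exact ⟨τ, hτ.1, hτ.2.1, hτ.2.2, h⟩

open Classical in
theorem exists_family [Nonempty ι] (hn : 0 < n) (hc : 0 < c) (hc' : c ≤ 1)
    (hG : ∀ ρ, Dens c (G ρ)) (t : ℕ) (ht : ((K * K + K * (t * K) : ℕ) : ℝ) ≤ c / 2 * n) :
    ∃ τ : Fin t → Fin K → Fin n, (∑ i, ∑ j, {τ i j} : Multiset (Fin n)).Nodup ∧
      (∀ i, ∃ ρ, G ρ (τ i)) ∧
      ∑ ρ, ∏ i, (if G ρ (τ i) then (1 / 2 : ℝ) else 1) ≤ (1 - c / 4) ^ t * Fintype.card ι := by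
  induction t with
  | zero => exact ⟨Fin.elim0, by simp, fun i => i.elim0, by simp⟩
  | succ t ih =>
    obtain ⟨τ, h₁, h₂, h₃⟩ := ih (le_trans (by gcongr; omega) ht)
    obtain ⟨σ, g₁, g₂, g₃, g₄⟩ := exists_halving hn hc hG
      (fun ρ => ∏ i, (if G ρ (τ i) then (1 / 2 : ℝ) else 1))
      (fun ρ => prod_nonneg fun i _ => by split_ifs <;> norm_num)
      (∑ i, ∑ j, {τ i j} : Multiset (Fin n)).toFinset (by
        refine le_trans ?_ ht
        norm_cast
        rw [Multiset.toFinset_card_of_nodup h₁]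
        simp only [Multiset.card_sum, Multiset.card_singleton, sum_const, card_univ,
          Fintype.card_fin, smul_eq_mul, mul_one]
        gcongr
        omega)
    refine ⟨Fin.cons σ τ, ?_, ?_, ?_⟩
    · rw [Fin.sum_univ_succ]
      simp only [Fin.cons_zero, Fin.cons_succ]
      rw [Multiset.nodup_add]
      refine ⟨g₂, h₁, ?_⟩
      rw [Multiset.disjoint_right]
      exact fun {x} hx => g₃ x (Multiset.mem_toFinset.2 hx)
    · intro i
      refine Fin.cases ?_ (fun i => ?_) i
      · simpa using g₁
      · simpa using h₂ i
    · simp only [Fin.prod_univ_succ, Fin.cons_zero, Fin.cons_succ]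
      refine g₄.trans ?_
      rw [pow_succ', mul_assoc]
      exact mul_le_mul_of_nonneg_left h₃ (by linarith)

/-- There is a bounded-rate family of disjoint tuples which contains many good tuples for every
index. -/
theorem exists_selection [Nonempty ι] (hn : 0 < n) (hc : 0 < c) (hc' : c ≤ 1)
    (hG : ∀ ρ, Dens c (G ρ)) (g s : ℕ) (hg : 2 * (1 - c / 4) ^ g ≤ 1 / 2)
    (hs : Fintype.card ι < 2 ^ s)
    (ht : ((K * K + K * (g * s * K) : ℕ) : ℝ) ≤ c / 2 * n) :
    ∃ τ : Fin (g * s) → Fin K → Fin n, (∑ i, ∑ j, {τ i j} : Multiset (Fin n)).Nodup ∧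
      (∀ i, ∃ ρ, G ρ (τ i)) ∧ ∀ ρ, s ≤ {i | G ρ (τ i)}.ncard := by
  classical
  obtain ⟨τ, h₁, h₂, h₃⟩ := exists_family hn hc hc' hG (g * s) ht
  refine ⟨τ, h₁, h₂, fun ρ => ?_⟩
  have h4 : ∏ i, (if G ρ (τ i) then (1 / 2 : ℝ) else 1) ≤ (1 - c / 4) ^ (g * s) * 2 ^ s := by
    refine (single_le_sum (f := fun ρ => ∏ i, (if G ρ (τ i) then (1 / 2 : ℝ) else 1))
      (fun ρ _ => prod_nonneg fun i _ => by split_ifs <;> norm_num) (mem_univ ρ)).trans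
      (h₃.trans ?_)
    have : (Fintype.card ι : ℝ) ≤ 2 ^ s := by exact_mod_cast hs.le
    exact mul_le_mul_of_nonneg_left this (pow_nonneg (by linarith) _)
  rw [prod_ite, prod_const, prod_const_one, mul_one, pow_mul, ← mul_pow] at h4
  have h5 : ((1 / 2 : ℝ)) ^ (univ.filter fun i => G ρ (τ i)).card ≤ (1 / 2) ^ s := by
    refine h4.trans (pow_le_pow_left₀ ?_ (by linarith) _)
    exact mul_nonneg (pow_nonneg (by linarith) _) zero_le_two
  rw [Set.ncard_eq_toFinset_card', Set.toFinset_ofPred]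
  exact (pow_le_pow_iff_right_of_lt_one₀ (by norm_num) (by norm_num)).1 h5

end selection

/-- Disjoint segments can be connected in such a way that every family of segments with the same
ends gives a segment which uses the same connecting vertices. -/
theorem exists_chain {n l m N : ℕ} {E : Finset (Finset (Fin n))} {B : ℝ}
    (H : ∀ S T : List (Fin n), S.length = l → T.length = l → (S ++ T).Nodup →
      ∀ F : Finset (Fin n), (F.card : ℝ) ≤ B → ∃ I : List (Fin n), I.length = N ∧ I.Nodup ∧
        (∀ x ∈ F, x ∉ I) ∧ Seg E l m S I T)
    (L : List (List (Fin n) × List (Fin n) × List (Fin n)))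
    (q : List (Fin n) × List (Fin n) × List (Fin n)) (F : Finset (Fin n))
    (hL : Replaces E l m (q :: L) (q :: L)) (hn : (segVerts (q :: L)).Nodup)
    (hF : ((F.card + (segVerts (q :: L)).card + N * L.length : ℕ) : ℝ) ≤ B) :
    ∃ (C : Multiset (Fin n)) (T : List (Fin n)), C.card ≤ N * L.length ∧
      (segVerts (q :: L) + C).Nodup ∧ (∀ x ∈ F, x ∉ C) ∧
      ∀ L', Replaces E l m (q :: L) L' → ∃ I : List (Fin n), Seg E l m q.1 I T ∧
        ((q.1 : Multiset (Fin n)) + I + T) = segVerts L' + C := by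
  classical
  induction L generalizing q F with
  | nil =>
    refine ⟨0, q.2.2, by simp, by simpa using hn, by simp, fun L' hL' => ?_⟩
    obtain ⟨q', L'', ⟨h₁, h₂, h₃⟩, h₄, rfl⟩ := List.forall₂_cons_left_iff.1 hL'
    obtain rfl := List.forall₂_nil_left_iff.1 h₄
    rw [h₁, h₂] at h₃
    exact ⟨q'.2.1, h₃, by simp [segVerts, h₁, h₂]⟩
  | cons p L ih =>
    obtain ⟨⟨-, -, hq⟩, hL₁⟩ := List.forall₂_cons.1 hL
    obtain ⟨⟨-, -, hp⟩, -⟩ := List.forall₂_cons.1 hL₁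
    have hn' := hn
    rw [segVerts_cons] at hn'
    obtain ⟨hn₁, hn₂, hn₃⟩ := Multiset.nodup_add.1 hn'
    have hST : (q.2.2 ++ p.1).Nodup := by
      rw [← Multiset.coe_nodup, ← Multiset.coe_add]
      refine Multiset.nodup_of_le ?_ hn'
      rw [segVerts_cons]
      exact add_le_add (Multiset.le_add_left _ _)
        ((Multiset.le_add_right _ _).trans
          ((Multiset.le_add_right _ _).trans (Multiset.le_add_right _ _)))
    obtain ⟨J, hJ, hJ', hJF, hJs⟩ := H q.2.2 p.1 hq.length_right hp.length_left hST
      (F ∪ (segVerts (q :: p :: L)).toFinset) (le_trans (by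
        norm_cast
        have h₁ := card_union_le F (segVerts (q :: p :: L)).toFinset
        have h₂ := Multiset.toFinset_card_le (segVerts (q :: p :: L))
        omega) hF)
    let V : Multiset (Fin n) := (q.1 : Multiset (Fin n)) + q.2.1 + q.2.2 + J
    have hV : (segVerts (q :: p :: L)).card + N = V.card + (segVerts (p :: L)).card := by
      simp only [V, segVerts_cons q, Multiset.card_add, Multiset.coe_card, hJ]
      omega
    obtain ⟨C, T, hC, hC', hCF, hCI⟩ := ih p (F ∪ V.toFinset) hL₁ hn₂ (le_trans (by
      norm_cast
      have h₁ := card_union_le F V.toFinset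
      have h₂ := Multiset.toFinset_card_le V
      simp only [List.length_cons, Nat.mul_add] at *
      omega) hF)
    refine ⟨J + C, T, ?_, ?_, ?_, fun L' hL' => ?_⟩
    · simp only [Multiset.card_add, Multiset.coe_card, List.length_cons, Nat.mul_add, hJ]
      omega
    · have h : segVerts (q :: p :: L) + (J + C) = V + (segVerts (p :: L) + C) := by
        simp only [V, segVerts_cons q]
        abel
      rw [h, Multiset.nodup_add]
      refine ⟨?_, hC', ?_⟩
      · refine Multiset.nodup_add.2 ⟨hn₁, Multiset.coe_nodup.2 hJ', ?_⟩
        rw [Multiset.disjoint_left]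
        intro x hx hxJ
        refine hJF x (mem_union_right _ (Multiset.mem_toFinset.2 ?_)) hxJ
        rw [segVerts_cons]
        exact Multiset.mem_add.2 (Or.inl hx)
      · rw [Multiset.disjoint_left]
        intro x hx hx'
        rcases Multiset.mem_add.1 hx' with hx' | hx'
        · rcases Multiset.mem_add.1 hx with hx | hx
          · exact Multiset.disjoint_left.1 hn₃ hx hx'
          · refine hJF x (mem_union_right _ (Multiset.mem_toFinset.2 ?_)) hx
            rw [segVerts_cons]
            exact Multiset.mem_add.2 (Or.inr hx')
        · exact hCF x (mem_union_right _ (Multiset.mem_toFinset.2 hx)) hx'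
    · intro x hx hx'
      rcases Multiset.mem_add.1 hx' with hx' | hx'
      · exact hJF x (mem_union_left _ hx) hx'
      · exact hCF x (mem_union_left _ hx) hx'
    · obtain ⟨q', L'', ⟨h₁, h₂, h₃⟩, h₄, rfl⟩ := List.forall₂_cons_left_iff.1 hL'
      obtain ⟨I, hI, hI'⟩ := hCI L'' h₄
      rw [h₁, h₂] at h₃
      refine ⟨q'.2.1 ++ q.2.2 ++ (J ++ p.1 ++ I), h₃.trans (hJs.trans hI), ?_⟩
      rw [segVerts_cons, h₁, h₂]
      simp only [← Multiset.coe_add]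
      calc _ = (q.1 : Multiset (Fin n)) + q'.2.1 + q.2.2 + J + (p.1 + I + T) := by abel
        _ = _ := by rw [hI']; abel

/-- If every index is good for many families, then the vertices of a short list of indices can be
absorbed. -/
theorem exists_alternatives {n l m t s : ℕ} {E : Finset (Finset (Fin n))} {ι : Type}
    {f : Fin t → List (List (Fin n) × List (Fin n) × List (Fin n))}
    (hf : ∀ i, Replaces E l m (f i) (f i)) {v : ι → Multiset (Fin n)} {G : ι → Fin t → Prop}
    (hs : ∀ ρ, s ≤ {i | G ρ i}.ncard)
    (hG : ∀ ρ i, G ρ i → ∃ L', Replaces E l m (f i) L' ∧ segVerts L' = segVerts (f i) + v ρ)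
    (R : List ι) (hR : R.length ≤ s) :
    ∃ f' : Fin t → List (List (Fin n) × List (Fin n) × List (Fin n)),
      (∀ i, Replaces E l m (f i) (f' i)) ∧
      ∑ i, segVerts (f' i) = ∑ i, segVerts (f i) + (R.map v).sum := by
  classical
  suffices ∃ f' : Fin t → List (List (Fin n) × List (Fin n) × List (Fin n)),
      (∃ B : Finset (Fin t), B.card ≤ R.length ∧ ∀ i ∉ B, f' i = f i) ∧
      (∀ i, Replaces E l m (f i) (f' i)) ∧
      ∑ i, segVerts (f' i) = ∑ i, segVerts (f i) + (R.map v).sum by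
    obtain ⟨f', -, h⟩ := this
    exact ⟨f', h⟩
  induction R with
  | nil => exact ⟨f, ⟨∅, by simp, fun _ _ => rfl⟩, hf, by simp⟩
  | cons ρ R ih =>
    rw [List.length_cons] at hR
    obtain ⟨f', ⟨B, hB, hB'⟩, h₁, h₂⟩ := ih (by omega)
    obtain ⟨i, hi, hiB⟩ : ∃ i, G ρ i ∧ i ∉ B := by
      by_contra! h
      have h₃ : {i | G ρ i}.ncard ≤ (B : Set (Fin t)).ncard :=
        Set.ncard_le_ncard (fun i hi => h i hi) (Set.toFinite _)
      rw [Set.ncard_coe_finset] at h₃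
      have := hs ρ
      omega
    obtain ⟨L', hL', hv⟩ := hG ρ i hi
    refine ⟨Function.update f' i L', ⟨insert i B, ?_, ?_⟩, ?_, ?_⟩
    · exact (card_insert_le _ _).trans (by simpa using hB)
    · intro j hj
      rw [mem_insert, not_or] at hj
      rw [Function.update_of_ne hj.1, hB' j hj.2]
    · intro j
      rcases eq_or_ne j i with rfl | hj
      · simpa using hL'
      · rw [Function.update_of_ne hj]; exact h₁ j
    · rw [← add_sum_erase _ _ (mem_univ i), Function.update_self, hv, ← hB' i hiB,
        sum_congr rfl (fun j hj => by rw [Function.update_of_ne (ne_of_mem_erase hj)]),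
        add_right_comm, add_sum_erase _ (fun i => segVerts (f' i)) (mem_univ i), h₂,
        List.map_cons, List.sum_cons]
      abel

/-- A set whose size is divisible by `r` is a union of `r`-tuples. -/
theorem exists_groups {n q r : ℕ} {U : Finset (Fin n)} (hU : U.card = q * r) :
    ∃ R : List (Fin r → Fin n), R.length = q ∧
      (R.map fun ρ => (∑ i, {ρ i} : Multiset (Fin n))).sum = U.val := by
  let e : Fin q × Fin r ≃ U := finProdFinEquiv.trans (U.equivFinOfCardEq hU).symm
  refine ⟨List.ofFn fun j i => (e (j, i) : Fin n), by simp, ?_⟩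
  rw [List.map_ofFn, List.sum_ofFn]
  simp only [Function.comp_apply]
  rw [← Fintype.sum_prod_type' (f := fun j i => ({(e (j, i) : Fin n)} : Multiset (Fin n))),
    Equiv.sum_comp e (fun u => ({(u : Fin n)} : Multiset (Fin n))),
    sum_coe_sort U (fun u => ({u} : Multiset (Fin n))), Finset.sum_multiset_singleton]

theorem exists_pow_lt_two_pow_floor (r : ℕ) {σ : ℝ} (hσ : 0 < σ) :
    ∃ n₀ : ℕ, ∀ n : ℕ, n₀ ≤ n → n ^ r < 2 ^ ⌊σ * n⌋₊ := by
  have hb : (1 : ℝ) < 2 ^ σ := Real.one_lt_rpow (by norm_num) hσ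
  obtain ⟨n₀, h⟩ := Filter.eventually_atTop.1
    ((tendsto_pow_const_div_const_pow_of_one_lt r hb).eventually (gt_mem_nhds one_half_pos))
  refine ⟨n₀, fun n hn => ?_⟩
  have h₁ := h n hn
  rw [div_lt_iff₀ (by positivity), ← Real.rpow_natCast (2 ^ σ), ← Real.rpow_mul zero_le_two] at h₁
  have h₂ : (2 : ℝ) ^ (σ * n) ≤ 2 ^ ((⌊σ * n⌋₊ + 1 : ℕ) : ℝ) :=
    Real.rpow_le_rpow_of_exponent_le one_le_two (by push_cast; exact (Nat.lt_floor_add_one _).le)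
  rw [Real.rpow_natCast, pow_succ] at h₂
  have h₃ : (n : ℝ) ^ r < 2 ^ ⌊σ * n⌋₊ := by linarith
  exact_mod_cast h₃

theorem Replaces.length_le {n l m : ℕ} {E : Finset (Finset (Fin n))}
    {L L' : List (List (Fin n) × List (Fin n) × List (Fin n))} (h : Replaces E l m L L')
    (hl : 1 ≤ l) : L'.length ≤ (segVerts L').card := by
  induction h with
  | nil => simp
  | cons h _ ih =>
    have := h.2.2.length_left
    rw [segVerts_cons]
    simp only [List.length_cons, Multiset.card_add, Multiset.coe_card]
    omega

theorem exists_absorbing_path {a d : ℕ} (had : 1 ≤ a + d) {η ζ : ℝ} (hη : 0 < η) (hζ : 0 < ζ) :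
    ∃ ε : ℝ, 0 < ε ∧ ∃ n₀ : ℕ, ∀ n : ℕ, n₀ ≤ n →
      ∀ E : Finset (Finset (Fin n)), DegCond η (2 * a + 3 + d) E →
        ∃ A : List (Fin n), IsPath (2 * a + 3 + d) (a + 1) E A ∧ (A.toFinset.card : ℝ) ≤ ζ * n ∧
          ∀ U : Finset (Fin n), Disjoint U A.toFinset →
            (U.card : ℝ) ≤ ε * n → (d + 1 + (a + 1)) ∣ U.card →
            ∃ Q : List (Fin n), IsPath (2 * a + 3 + d) (a + 1) E Q ∧
              Q.toFinset = A.toFinset ∪ U ∧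
              firstEnd (a + 1) Q = firstEnd (a + 1) A ∧ lastEnd (a + 1) Q = lastEnd (a + 1) A := by
  obtain ⟨N, κ, hκ, n₁, Hc⟩ := exists_connect had hη
  obtain ⟨K, c₀, hc₀, n₂, Ha⟩ := absorber_dens had hη
  obtain ⟨c, hc, hcc₀, hc1⟩ : ∃ c : ℝ, 0 < c ∧ c ≤ c₀ ∧ c ≤ 1 :=
    ⟨min c₀ 1, lt_min hc₀ one_pos, min_le_left _ _, min_le_right _ _⟩
  obtain ⟨g, hg⟩ := exists_pow_lt_of_lt_one (show (0 : ℝ) < 1 / 4 by norm_num)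
    (show 1 - c / 4 < 1 by linarith)
  have hg0 : 1 ≤ g := by
    by_contra! h
    obtain rfl : g = 0 := by omega
    norm_num at hg
  obtain ⟨σ, hσ, hσc, hσζ, hσκ⟩ : ∃ σ : ℝ, 0 < σ ∧ K * g * K * σ ≤ c / 4 ∧
      (g * K * (1 + N)) * σ ≤ ζ ∧ (g * K * (1 + N)) * σ ≤ κ := by
    have h : ∀ (D b : ℝ), 0 ≤ D → 0 < b → ∃ σ₀ : ℝ, 0 < σ₀ ∧ ∀ σ ≤ σ₀, D * σ ≤ b := by
      intro D b hD hb
      refine ⟨b / (D + 1), by positivity, fun σ hσ => ?_⟩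
      rw [le_div_iff₀ (by positivity)] at hσ
      rcases le_or_gt σ 0 with h | h
      · exact (mul_nonpos_of_nonneg_of_nonpos hD h).trans hb.le
      · nlinarith
    obtain ⟨σ₁, h₁, h₁'⟩ := h (K * g * K) (c / 4) (by positivity) (by positivity)
    obtain ⟨σ₂, h₂, h₂'⟩ := h (g * K * (1 + N)) ζ (by positivity) hζ
    obtain ⟨σ₃, h₃, h₃'⟩ := h (g * K * (1 + N)) κ (by positivity) hκ
    refine ⟨min σ₁ (min σ₂ σ₃), by positivity, h₁' _ (min_le_left _ _), h₂' _ ?_, h₃' _ ?_⟩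
    · exact (min_le_right _ _).trans (min_le_left _ _)
    · exact (min_le_right _ _).trans (min_le_right _ _)
  obtain ⟨n₃, hn₃⟩ := exists_pow_lt_two_pow_floor (d + 1 + (a + 1)) hσ
  obtain ⟨n₄, hn₄⟩ := exists_nat_ge (K * K / (c / 4))
  obtain ⟨n₅, hn₅⟩ := exists_nat_ge (1 / (σ / 2))
  refine ⟨σ / 2, by positivity, n₁ + n₂ + n₃ + n₄ + n₅ + 1, fun n hn E hE => ?_⟩
  have hn0 : 0 < n := by omega
  have : Nonempty (Fin n) := ⟨⟨0, hn0⟩⟩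
  obtain ⟨G, hG, HG⟩ := Ha n (by omega)
  replace Hc := Hc n (by omega) E hE
  replace hn₃ := hn₃ n (by omega)
  have hn₄' : (K * K : ℝ) ≤ c / 4 * n := by
    rw [div_le_iff₀ (by positivity)] at hn₄
    have : (n₄ : ℝ) ≤ n := by exact_mod_cast (by omega : n₄ ≤ n)
    nlinarith
  have hn₅' : 1 ≤ σ / 2 * n := by
    rw [div_le_iff₀ (by positivity)] at hn₅
    have : (n₅ : ℝ) ≤ n := by exact_mod_cast (by omega : n₅ ≤ n)
    nlinarith
  generalize hs : ⌊σ * n⌋₊ = s at hn₃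
  have hs₁ : (s : ℝ) ≤ σ * n := hs ▸ Nat.floor_le (by positivity)
  have hs₂ : σ / 2 * n ≤ s := by
    have := Nat.lt_floor_add_one (σ * n)
    rw [hs] at this
    linarith
  have hs0 : 1 ≤ s := by exact_mod_cast hn₅'.trans hs₂
  obtain ⟨τ, hτ, hτG, hτs⟩ := exists_selection (K := K) hn0 hc hc1
    (fun u => (HG E hE u).mono hcc₀ fun _ h => h) g s (by linarith) (by simpa using hn₃) (by
      push_cast
      have : (K : ℝ) * (g * s * K) ≤ c / 4 * n := by
        calc (K : ℝ) * (g * s * K) = K * g * K * s := by ring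
          _ ≤ K * g * K * (σ * n) := by gcongr
          _ = K * g * K * σ * n := by ring
          _ ≤ _ := by gcongr
      linarith)
  have hf : ∀ i, Replaces E (a + 1) (d + 1) (G (τ i)) (G (τ i)) := fun i => (hτG i).choose_spec.1
  have hV : segVerts (List.ofFn fun i => G (τ i)).flatten ≤ ∑ i, ∑ j, {τ i j} := by
    rw [segVerts_flatten]
    exact sum_le_sum fun i _ => (hG (τ i)).2
  have hVc : (segVerts (List.ofFn fun i => G (τ i)).flatten).card ≤ g * s * K := by
    simpa using Multiset.card_le_card hV
  have hLL := Replaces.flatten hf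
  have hLl := hLL.length_le (by omega)
  obtain ⟨q, L, hL⟩ : ∃ q L, (List.ofFn fun i => G (τ i)).flatten = q :: L := by
    refine List.exists_cons_of_ne_nil fun h => ?_
    rw [List.flatten_eq_nil_iff] at h
    exact (hG (τ ⟨0, Nat.mul_pos hg0 hs0⟩)).1 (h _ (List.mem_ofFn.2 ⟨_, rfl⟩))
  have hsum := segVerts_flatten fun i => G (τ i)
  have hLU : ∀ f' : Fin (g * s) → List (List (Fin n) × List (Fin n) × List (Fin n)),
      (∀ i, Replaces E (a + 1) (d + 1) (G (τ i)) (f' i)) →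
      Replaces E (a + 1) (d + 1) (q :: L) (List.ofFn f').flatten :=
    fun f' h => hL ▸ Replaces.flatten h
  rw [hL] at hV hVc hLL hLl hsum
  have hsize : (((segVerts (q :: L)).card + N * L.length : ℕ) : ℝ) ≤ g * K * (1 + N) * σ * n := by
    have h₁ : (segVerts (q :: L)).card + N * L.length ≤ g * s * K + N * (g * s * K) := by
      rw [List.length_cons] at hLl
      gcongr
      omega
    calc (((segVerts (q :: L)).card + N * L.length : ℕ) : ℝ)
        ≤ ((g * s * K + N * (g * s * K) : ℕ) : ℝ) := by exact_mod_cast h₁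
      _ = g * K * (1 + N) * s := by push_cast; ring
      _ ≤ g * K * (1 + N) * (σ * n) := by gcongr
      _ = _ := by ring
  obtain ⟨C, T, hC, hnd, -, hCI⟩ := exists_chain Hc L q ∅ hLL (Multiset.nodup_of_le hV hτ) (by
    rw [card_empty, zero_add]
    exact hsize.trans (by gcongr))
  obtain ⟨I, hI, hI'⟩ := hCI _ hLL
  have hkl : 2 * a + 3 + d = 2 * (a + 1) + (d + 1) := by ring
  have hA : ((q.1 ++ I ++ T : List (Fin n)) : Multiset (Fin n)) = segVerts (q :: L) + C := by
    rw [← hI', Multiset.coe_add, Multiset.coe_add]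
  have hAn : (q.1 ++ I ++ T).Nodup := by rw [← Multiset.coe_nodup, hA]; exact hnd
  refine ⟨q.1 ++ I ++ T, hI.isPath hkl (by omega) hAn, ?_, fun U hUA hU hdvd => ?_⟩
  · refine le_trans ?_ (hsize.trans (by gcongr))
    norm_cast
    rw [List.toFinset_card_of_nodup hAn, ← Multiset.coe_card, hA, Multiset.card_add]
    gcongr
  · obtain ⟨p, hp⟩ := hdvd
    obtain ⟨R, hR, hR'⟩ := exists_groups (q := p) (r := d + 1 + (a + 1)) (hp.trans (mul_comm _ _))
    have hps : p ≤ s := by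
      have h₁ : p ≤ U.card := by rw [hp]; exact Nat.le_mul_of_pos_left _ (by omega)
      have h₂ : (U.card : ℝ) ≤ s := hU.trans hs₂
      exact h₁.trans (by exact_mod_cast h₂)
    obtain ⟨f', hf', hf''⟩ := exists_alternatives hf hτs (fun u i h => h.2) R (hR.le.trans hps)
    obtain ⟨J, hJ, hJ'⟩ := hCI _ (hLU f' hf')
    have hQ : ((q.1 ++ J ++ T : List (Fin n)) : Multiset (Fin n))
        = ((q.1 ++ I ++ T : List (Fin n)) : Multiset (Fin n)) + U.val := by
      rw [← Multiset.coe_add, ← Multiset.coe_add, hJ', hA, segVerts_flatten, hf'', hR', hsum]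
      abel
    have hQn : (q.1 ++ J ++ T).Nodup := by
      rw [← Multiset.coe_nodup, hQ, Multiset.nodup_add]
      refine ⟨Multiset.coe_nodup.2 hAn, U.nodup, ?_⟩
      rw [Multiset.disjoint_left]
      exact fun {x} hx hxU => disjoint_left.1 hUA hxU (List.mem_toFinset.2 hx)
    refine ⟨q.1 ++ J ++ T, hJ.isPath hkl (by omega) hQn, ?_, ?_, ?_⟩
    · ext x
      have h : x ∈ ((q.1 ++ J ++ T : List (Fin n)) : Multiset (Fin n)) ↔
          x ∈ ((q.1 ++ I ++ T : List (Fin n)) : Multiset (Fin n)) ∨ x ∈ U.val := by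
        rw [hQ, Multiset.mem_add]
      simpa only [mem_union, List.mem_toFinset, Multiset.mem_coe, mem_val] using h
    · rw [hI.firstEnd_eq, hJ.firstEnd_eq]
    · rw [hI.lastEnd_eq, hJ.lastEnd_eq]

theorem stmt4 (η ζ : ℝ) (hη : 0 < η) (hζ : 0 < ζ)
    (k l : ℕ) (hk : 4 ≤ k) (hl1 : 1 ≤ l) (hl2 : 2 * l < k) :
    ∃ ε : ℝ, 0 < ε ∧ ∃ n₀ : ℕ, ∀ n : ℕ, n₀ ≤ n →
      ∀ E : Finset (Finset (Fin n)), (∀ e ∈ E, e.card = k) →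
        (∀ S : Finset (Fin n), S.card = k - 2 →
          η * (Nat.choose n 2) ≤ (degH E S : ℝ)) →
        ∃ A : List (Fin n), IsPath k l E A ∧ (A.toFinset.card : ℝ) ≤ ζ * n ∧
          ∀ U : Finset (Fin n), Disjoint U A.toFinset →
            (U.card : ℝ) ≤ ε * n → (k - l) ∣ U.card →
            ∃ Q : List (Fin n), IsPath k l E Q ∧
              Q.toFinset = A.toFinset ∪ U ∧
              firstEnd l Q = firstEnd l A ∧ lastEnd l Q = lastEnd l A := by
  obtain ⟨a, rfl⟩ : ∃ a, l = a + 1 := ⟨l - 1, by omega⟩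
  obtain ⟨d, rfl⟩ : ∃ d, k = 2 * a + 3 + d := ⟨k - (2 * a + 3), by omega⟩
  obtain ⟨ε, hε, n₀, H⟩ := exists_absorbing_path (a := a) (d := d) (by omega) hη hζ
  refine ⟨ε, hε, n₀, fun n hn E hE hE' => ?_⟩
  rw [show 2 * a + 3 + d - (a + 1) = d + 1 + (a + 1) by omega]
  exact H n hn E ⟨hE, hE'⟩
end

section
/- Let η > 0, let k ≥ 4 and 1 ≤ ℓ < k/2 be integers, set η̃ = η/(4·k!) and q = 3k − 2ℓ. For all sufficiently large n the following holds: if H = (V,E) is a k-uniform hypergraph on n vertices with δ_{k−2}(H) ≥ η·C(n,2), then for every (k−ℓ)-element set S ⊆ V there exist at least η̃⁵·n^q ordered q-tuples of vertices of V that span an ℓ-path with exactly three edges which absorbs S. -/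
open Finset

/-- The ℓ-path `vs` absorbs the vertex set `S` (disjoint from it): there is an ℓ-path `Q`
on the vertex set `V(vs) ∪ S` with the same ends as `vs`. -/
def PathAbsorbs {n : ℕ} (k l : ℕ) (E : Finset (Finset (Fin n))) (vs : List (Fin n))
    (S : Finset (Fin n)) : Prop :=
  ∃ Q : List (Fin n), IsPath k l E Q ∧ Q.toFinset = vs.toFinset ∪ S ∧
    firstEnd l Q = firstEnd l vs ∧ lastEnd l Q = lastEnd l vs


/-- If every `f ∈ A` can be sent into `B` by at least `c` reassignments of its values at `a` and
`b`, then `B` has density at least `c / |α|²` relative to `A`. -/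
lemma mul_card_le_of_update {ι α : Type*} [Fintype ι] [DecidableEq ι] [Fintype α] [DecidableEq α]
    (A B : Finset (ι → α)) {a b : ι} (hab : a ≠ b) (c : ℝ)
    (h : ∀ f ∈ A, c ≤
      ((univ.filter fun p : α × α =>
        Function.update (Function.update f a p.1) b p.2 ∈ B).card : ℝ)) :
    c * (A.card : ℝ) ≤ (B.card : ℝ) * (Fintype.card α : ℝ) ^ 2 := by
  classical
  set Z := A.sigma fun f => univ.filter fun p : α × α =>
    Function.update (Function.update f a p.1) b p.2 ∈ B with hZ
  have hlow : c * (A.card : ℝ) ≤ (Z.card : ℝ) := by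
    rw [hZ, Finset.card_sigma]
    push_cast
    calc c * (A.card : ℝ) = ∑ _f ∈ A, c := by simp [mul_comm]
      _ ≤ _ := Finset.sum_le_sum h
  have hup : Z.card ≤ (B ×ˢ (univ : Finset (α × α))).card := by
    refine Finset.card_le_card_of_injOn
      (fun z => (Function.update (Function.update z.1 a z.2.1) b z.2.2, (z.1 a, z.1 b))) ?_ ?_
    · intro z hz
      simp only [hZ, Finset.coe_sigma, Set.mem_sigma_iff, Finset.mem_coe, Finset.mem_filter] at hz
      simpa using hz.2
    · rintro ⟨f, u, v⟩ _ ⟨g, u', v'⟩ _ heq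
      simp only [Prod.mk.injEq] at heq
      obtain ⟨h1, h2, h3⟩ := heq
      have hu : u = u' := by simpa [hab] using congrFun h1 a
      have hv : v = v' := by simpa using congrFun h1 b
      have hfg : f = g := by
        funext i
        by_cases hia : i = a
        · rw [hia, h2]
        by_cases hib : i = b
        · rw [hib, h3]
        simpa [hia, hib] using congrFun h1 i
      subst hfg hu hv
      rfl
  have hup' : (Z.card : ℝ) ≤ (B.card : ℝ) * (Fintype.card α : ℝ) ^ 2 := by
    calc (Z.card : ℝ) ≤ ((B ×ˢ (univ : Finset (α × α))).card : ℝ) := by exact_mod_cast hup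
      _ = _ := by
        rw [Finset.card_product, Finset.card_univ, Fintype.card_prod]
        push_cast
        ring
  exact hlow.trans hup'

/-- The number of ordered pairs which complete `W` to an edge while avoiding `X`. -/
lemma degH_sub_le_card_pairs {n k : ℕ} (hk : 2 ≤ k) {E : Finset (Finset (Fin n))}
    (hE : ∀ e ∈ E, e.card = k) {W X : Finset (Fin n)} (hW : W.card = k - 2) :
    (degH E W : ℝ) - 2 * (X.card : ℝ) * n ≤
      ((univ.filter fun p : Fin n × Fin n =>
        p.1 ≠ p.2 ∧ p.1 ∉ X ∧ p.2 ∉ X ∧ insert p.1 (insert p.2 W) ∈ E).card : ℝ) := by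
  classical
  set P := univ.filter fun p : Fin n × Fin n => p.1 ≠ p.2 ∧ insert p.1 (insert p.2 W) ∈ E with hP
  set P' := univ.filter fun p : Fin n × Fin n =>
        p.1 ≠ p.2 ∧ p.1 ∉ X ∧ p.2 ∉ X ∧ insert p.1 (insert p.2 W) ∈ E with hP'
  have h1 : degH E W ≤ P.card := by
    refine Finset.card_le_card_of_surjOn (fun p => insert p.1 (insert p.2 W)) ?_
    intro e he
    simp only [Finset.coe_filter, Set.mem_ofPred_eq] at he
    have hc : (e \ W).card = 2 := by
      rw [Finset.card_sdiff_of_subset he.2, hE e he.1, hW]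
      omega
    obtain ⟨u, v, huv, h⟩ := Finset.card_eq_two.1 hc
    have hins : insert u (insert v W) = e := by
      rw [← Finset.sdiff_union_of_subset he.2, h]
      ext
      simp
    refine ⟨(u, v), ?_, hins⟩
    simp only [hP, Finset.coe_filter, Set.mem_ofPred_eq, Finset.mem_univ, true_and]
    exact ⟨huv, by rw [hins]; exact he.1⟩
  have h2 : P ⊆ P' ∪ (X ×ˢ univ ∪ univ ×ˢ X) := by
    intro p hp
    simp only [hP, hP', Finset.mem_filter, Finset.mem_union, Finset.mem_product, Finset.mem_univ,
      true_and, and_true] at hp ⊢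
    tauto
  have h3 : P.card ≤ P'.card + (X.card * n + n * X.card) := by
    refine (Finset.card_le_card h2).trans ((Finset.card_union_le _ _).trans ?_)
    gcongr
    refine (Finset.card_union_le _ _).trans ?_
    simp [Finset.card_product]
  have h4 : (degH E W : ℝ) ≤ (P'.card : ℝ) + ((X.card : ℝ) * n + n * X.card) := by
    exact_mod_cast h1.trans h3
  linarith

open Classical in
/-- Assignments that are injective on `T` with values outside `S` there, and for which every
constraint `(J, S')` yields an edge `f(J) ∪ S'`. -/
noncomputable def admissible {ι : Type*} [Fintype ι] {n : ℕ}
    (E : Finset (Finset (Fin n))) (S : Finset (Fin n)) (T : Finset ι)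
    (C : List (Finset ι × Finset (Fin n))) : Finset (ι → Fin n) :=
  univ.filter fun f => Set.InjOn f T ∧ (∀ i ∈ T, f i ∉ S) ∧ ∀ c ∈ C, c.1.image f ∪ c.2 ∈ E

lemma mul_card_admissible_le {ι : Type*} [Fintype ι] [DecidableEq ι] {n k : ℕ} (hk : 2 ≤ k)
    {E : Finset (Finset (Fin n))} (hE : ∀ e ∈ E, e.card = k) {D : ℝ}
    (hD : ∀ W : Finset (Fin n), W.card = k - 2 → D ≤ (degH E W : ℝ))
    {S S' : Finset (Fin n)} (hS : S' ⊆ S) {T T' J J' : Finset ι} {a b : ι}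
    (C : List (Finset ι × Finset (Fin n))) (hC : ∀ c ∈ C, c.1 ⊆ T)
    (hab : a ≠ b) (ha : a ∉ T) (hb : b ∉ T) (hT' : T' = insert a (insert b T))
    (hJT : J ⊆ T) (hJ' : J' = insert a (insert b J)) (hcard : J.card + S'.card = k - 2)
    {c : ℝ} (hc : c * (n : ℝ) ^ 2 ≤ D - 2 * ((Fintype.card ι + S.card : ℕ) : ℝ) * n)
    (hn : 0 < n) :
    c * ((admissible E S T C).card : ℝ) ≤ ((admissible E S T' ((J', S') :: C)).card : ℝ) := by
  classical
  have key := mul_card_le_of_update (admissible E S T C) (admissible E S T' ((J', S') :: C)) hab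
    (c * (n : ℝ) ^ 2) ?_
  · rw [Fintype.card_fin] at key
    have hn' : (0 : ℝ) < (n : ℝ) ^ 2 := by positivity
    refine le_of_mul_le_mul_right ?_ hn'
    linarith
  intro f hf
  simp only [admissible, Finset.mem_filter, Finset.mem_univ, true_and] at hf
  obtain ⟨hinj, hoff, hcon⟩ := hf
  set W := J.image f ∪ S' with hWdef
  set X := T.image f ∪ S with hXdef
  have hW : W.card = k - 2 := by
    rw [hWdef, Finset.card_union_of_disjoint, Finset.card_image_of_injOn, hcard]
    · exact hinj.mono (by exact_mod_cast hJT)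
    · rw [Finset.disjoint_left]
      intro x hx hxS
      obtain ⟨i, hi, rfl⟩ := Finset.mem_image.1 hx
      exact hoff i (hJT hi) (hS hxS)
  have hX : X.card ≤ Fintype.card ι + S.card :=
    (Finset.card_union_le _ _).trans
      (Nat.add_le_add_right (Finset.card_image_le.trans (Finset.card_le_univ T)) _)
  have h1 := degH_sub_le_card_pairs hk hE (X := X) hW
  have h2 : D ≤ (degH E W : ℝ) := hD W hW
  have h3 : (X.card : ℝ) * n ≤ ((Fintype.card ι + S.card : ℕ) : ℝ) * n := by gcongr
  refine le_trans (by linarith) (h1.trans ?_)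
  norm_cast
  refine Finset.card_le_card ?_
  intro p hp
  obtain ⟨u, v⟩ := p
  simp only [Finset.mem_filter, Finset.mem_univ, true_and] at hp ⊢
  obtain ⟨huv, hu, hv, hedge⟩ := hp
  set g := Function.update (Function.update f a u) b v with hg
  have ga : g a = u := by simp [hg, hab]
  have gb : g b = v := by simp [hg]
  have gT : ∀ i ∈ T, g i = f i := by
    intro i hi
    have hia : i ≠ a := fun h => ha (h ▸ hi)
    have hib : i ≠ b := fun h => hb (h ▸ hi)
    simp [hg, hia, hib]
  have gimg : ∀ K : Finset ι, K ⊆ T → K.image g = K.image f := fun K hK =>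
    Finset.image_congr fun i hi => gT i (hK hi)
  simp only [hXdef, Finset.mem_union, Finset.mem_image, not_or, not_exists, not_and] at hu hv
  simp only [admissible, Finset.mem_filter, Finset.mem_univ, true_and]
  subst hT' hJ'
  refine ⟨?_, ?_, ?_⟩
  · intro i hi j hj hij
    simp only [Finset.coe_insert, Set.mem_insert_iff, Finset.mem_coe] at hi hj
    rcases hi with rfl | rfl | hi <;> rcases hj with rfl | rfl | hj
    · rfl
    · exact absurd (ga.symm.trans (hij.trans gb)) huv
    · exact absurd ((gT j hj).symm.trans (hij.symm.trans ga)) (hu.1 j hj)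
    · exact absurd (ga.symm.trans (hij.symm.trans gb)) huv
    · rfl
    · exact absurd ((gT j hj).symm.trans (hij.symm.trans gb)) (hv.1 j hj)
    · exact absurd ((gT i hi).symm.trans (hij.trans ga)) (hu.1 i hi)
    · exact absurd ((gT i hi).symm.trans (hij.trans gb)) (hv.1 i hi)
    · exact hinj hi hj ((gT i hi).symm.trans (hij.trans (gT j hj)))
  · intro i hi
    simp only [Finset.mem_insert] at hi
    rcases hi with rfl | rfl | hi
    · rw [ga]; exact hu.2
    · rw [gb]; exact hv.2
    · rw [gT i hi]; exact hoff i hi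
  · intro c' hc'
    rcases List.mem_cons.1 hc' with rfl | hc'
    · simp only [Finset.image_insert, ga, gb, gimg J hJT, Finset.insert_union]
      exact hedge
    · rw [gimg _ (hC c' hc')]
      exact hcon c' hc'

/-- Most assignments are admissible when there are no edge constraints. -/
lemma half_pow_le_card_admissible {q n : ℕ} (E : Finset (Finset (Fin n))) (S : Finset (Fin n))
    (T : Finset (Fin q)) (hn0 : 0 < n) (hn : 2 * (q * (q + S.card)) ≤ n) :
    (n : ℝ) ^ q / 2 ≤ ((admissible E S T []).card : ℝ) := by
  classical
  have h1 : (n - S.card).descFactorial q ≤ (admissible E S T []).card := by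
    have hcard : Fintype.card (Fin q ↪ {x : Fin n // x ∉ S}) = (n - S.card).descFactorial q := by
      rw [Fintype.card_embedding_eq, Fintype.card_fin]
      congr 1
      rw [Fintype.card_subtype_compl]
      simp
    rw [← hcard, ← Finset.card_univ]
    refine Finset.card_le_card_of_injOn (fun e i => (e i : Fin n)) ?_ ?_
    · intro e _
      simp only [admissible, Finset.coe_filter, Set.mem_ofPred_eq, Finset.mem_univ, true_and]
      refine ⟨?_, fun i _ => (e i).2, by simp⟩
      exact (Subtype.val_injective.comp e.injective).injOn
    · intro e _ e' _ h
      ext i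
      exact congrArg Fin.val (congrFun h i)
  rcases Nat.eq_zero_or_pos q with rfl | hq
  · have : (1 : ℝ) ≤ ((admissible E S T []).card : ℝ) := by exact_mod_cast h1
    norm_num
    linarith
  have hle : q + S.card ≤ n := by nlinarith
  have h2 : (n - (q + S.card)) ^ q ≤ (admissible E S T []).card :=
    le_trans (Nat.pow_le_pow_left (by omega) q)
      ((Nat.pow_sub_le_descFactorial (n - S.card) q).trans h1)
  have h3 : ((n : ℝ) - ((q + S.card : ℕ) : ℝ)) ^ q ≤ ((admissible E S T []).card : ℝ) := by
    rw [← Nat.cast_sub hle]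
    exact_mod_cast h2
  refine le_trans ?_ h3
  have hnR : (0 : ℝ) < n := by exact_mod_cast hn0
  set M : ℝ := ((q + S.card : ℕ) : ℝ) with hM
  have hM0 : 0 ≤ M := Nat.cast_nonneg _
  have hMn : M / n ≤ 1 := by
    rw [div_le_one hnR]
    rw [hM]; exact_mod_cast hle
  have hqM : (q : ℝ) * (M / n) ≤ 1 / 2 := by
    rw [← mul_div_assoc, div_le_iff₀ hnR]
    have : 2 * ((q : ℝ) * M) ≤ n := by rw [hM]; exact_mod_cast hn
    linarith
  have hb := one_add_mul_le_pow (a := -(M / n)) (by linarith) q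
  calc (n : ℝ) ^ q / 2 = (n : ℝ) ^ q * (1 / 2) := by ring
    _ ≤ (n : ℝ) ^ q * (1 + -(M / n)) ^ q := by gcongr; linarith
    _ = (n - M) ^ q := by
      rw [← mul_pow]
      congr 1
      field_simp
      ring

lemma toFinset_take_drop_map_range {α : Type*} [DecidableEq α] (G : ℕ → α) {N a k : ℕ}
    (h : a + k ≤ N) :
    ((((List.range N).map G).drop a).take k).toFinset = (Finset.Ico a (a + k)).image G := by
  have h1 : (List.range N).drop a = List.range' a (N - a) := by
    rw [List.range_eq_range', List.drop_range']
    simp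
  rw [← List.map_drop, ← List.map_take, h1, List.take_range'_of_length_ge (by omega)]
  ext x
  simp [List.mem_range'_1, and_assoc]

/-- Position `j` of the absorbing path, as a position of the original path (if `< 3 * d + l`)
or of the absorbed set (shifted by `3 * d + l`): the absorbed vertices are inserted after position
`d + l`, and two pairs of neighbouring vertices are swapped. -/
def absorbPos (d l j : ℕ) : ℕ :=
  if j + 1 = d then d
  else if j = d then d - 1
  else if j ≤ d + l then j
  else if j ≤ 2 * d + l then 3 * d + l + (j - (d + l + 1))
  else if j + 1 = 3 * d + l then 2 * d + l
  else if j = 3 * d + l then 2 * d + l - 1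
  else j - d

/-- The inverse of `absorbPos` on `[0, 4 * d + l)`. -/
def absorbPosInv (d l i : ℕ) : ℕ :=
  if i + 1 = d then d
  else if i = d then d - 1
  else if i ≤ d + l then i
  else if i + 1 = 2 * d + l then 3 * d + l
  else if i = 2 * d + l then 3 * d + l - 1
  else if i < 3 * d + l then i + d
  else i - (3 * d + l) + (d + l + 1)

lemma image_absorbPos_Ico {d l a b : ℕ} (hl : 1 ≤ l) (hld : l < d) (hd : 3 ≤ d)
    (hb : b ≤ 4 * d + l) :
    (Finset.Ico a b).image (absorbPos d l) =
      (Finset.range (4 * d + l)).filter fun i => a ≤ absorbPosInv d l i ∧ absorbPosInv d l i < b := by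
  have hinv : ∀ j < 4 * d + l, absorbPosInv d l (absorbPos d l j) = j ∧
      absorbPos d l j < 4 * d + l := by
    intro j hj
    obtain ⟨i, hi⟩ : ∃ i, absorbPos d l j = i := ⟨_, rfl⟩
    rw [hi]
    unfold absorbPos at hi
    unfold absorbPosInv
    split_ifs at hi <;> split_ifs <;> omega
  have hinv' : ∀ i < 4 * d + l, absorbPos d l (absorbPosInv d l i) = i := by
    intro i hi
    obtain ⟨j, hj⟩ : ∃ j, absorbPosInv d l i = j := ⟨_, rfl⟩
    rw [hj]
    unfold absorbPosInv at hj
    unfold absorbPos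
    split_ifs at hj <;> split_ifs <;> omega
  ext i
  simp only [Finset.mem_image, Finset.mem_Ico, Finset.mem_filter, Finset.mem_range]
  constructor
  · rintro ⟨j, hj, rfl⟩
    obtain ⟨h1, h2⟩ := hinv j (by omega)
    rw [h1]
    exact ⟨h2, hj⟩
  · rintro ⟨hi, h⟩
    exact ⟨_, h, hinv' i hi⟩

/-- If `F` lists the vertices of a three-edge path followed by those of a set `S`, and two
suitable further sets are edges, then the path absorbs `S`. -/
lemma isPath_and_pathAbsorbs {n d l : ℕ} (hl : 1 ≤ l) (hld : l < d) (hd : 3 ≤ d)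
    {E : Finset (Finset (Fin n))} {F : ℕ → Fin n}
    (hF : Set.InjOn F (Finset.range (4 * d + l)))
    (h₁ : (Finset.Ico 0 (d + l)).image F ∈ E)
    (h₂ : (Finset.Ico d (d + (d + l))).image F ∈ E)
    (h₃ : (Finset.Ico (2 * d) (2 * d + (d + l))).image F ∈ E)
    (h₄ : ((Finset.range (4 * d + l)).filter fun i =>
      i + 1 = d ∨ (d < i ∧ i ≤ d + l) ∨ (3 * d + l ≤ i ∧ i + 1 < 4 * d + l)).image F ∈ E)
    (h₅ : ((Finset.range (4 * d + l)).filter fun i =>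
      (d + l < i ∧ i + 1 < 2 * d + l) ∨ i = 2 * d + l ∨ 4 * d ≤ i + 1).image F ∈ E) :
    IsPath (d + l) l E ((List.range (3 * d + l)).map F) ∧
      PathAbsorbs (d + l) l E ((List.range (3 * d + l)).map F)
        ((Finset.Ico (3 * d + l) (4 * d + l)).image F) := by
  have hG : ∀ a b, b ≤ 4 * d + l → (Finset.Ico a b).image (F ∘ absorbPos d l) =
      ((Finset.range (4 * d + l)).filter fun i =>
        a ≤ absorbPosInv d l i ∧ absorbPosInv d l i < b).image F := by
    intro a b hb
    rw [← Finset.image_image, image_absorbPos_Ico hl hld hd hb]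
  have hfull : ((List.range (4 * d + l)).map (F ∘ absorbPos d l)).toFinset =
      (Finset.range (4 * d + l)).image F := by
    have := toFinset_take_drop_map_range (F ∘ absorbPos d l) (N := 4 * d + l) (a := 0)
      (k := 4 * d + l) (by omega)
    rw [zero_add, hG _ _ le_rfl] at this
    rw [List.drop_zero, List.take_of_length_le (by simp)] at this
    rw [this]
    congr 1
    ext i
    simp only [Finset.mem_filter, Finset.mem_range]
    unfold absorbPosInv
    grind
  have hA : ((List.range (3 * d + l)).map F).toFinset = (Finset.range (3 * d + l)).image F := by
    ext x
    simp
  refine ⟨⟨?_, ⟨3, by norm_num, by simp⟩, ?_⟩,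
    (List.range (4 * d + l)).map (F ∘ absorbPos d l), ⟨?_, ⟨4, by norm_num, by simp⟩, ?_⟩, ?_, ?_, ?_⟩
  · refine List.Nodup.map_on ?_ List.nodup_range
    intro x hx y hy hxy
    rw [List.mem_range] at hx hy
    exact hF (by simp; omega) (by simp; omega) hxy
  · intro i hi
    simp only [Nat.add_sub_cancel, List.length_map, List.length_range] at hi ⊢
    rw [toFinset_take_drop_map_range F hi]
    have hi3 : i < 3 := by
      by_contra hcon
      have : 3 * d ≤ i * d := Nat.mul_le_mul_right d (by omega)
      omega
    interval_cases i
    · simpa using h₁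
    · simpa using h₂
    · exact h₃
  · rw [← Multiset.coe_nodup, ← Multiset.toFinset_card_eq_card_iff_nodup]
    change ((List.range (4 * d + l)).map (F ∘ absorbPos d l)).toFinset.card = _
    rw [hfull, Finset.card_image_of_injOn hF]
    simp
  · intro i hi
    simp only [Nat.add_sub_cancel, List.length_map, List.length_range] at hi ⊢
    rw [toFinset_take_drop_map_range _ hi, hG _ _ hi]
    have hi3 : i < 4 := by
      by_contra hcon
      have : 4 * d ≤ i * d := Nat.mul_le_mul_right d (by omega)
      omega
    interval_cases i
    · convert h₁ using 2
      ext i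
      simp only [Finset.mem_filter, Finset.mem_range, Finset.mem_Ico]
      unfold absorbPosInv
      grind
    · convert h₄ using 2
      ext i
      simp only [Finset.mem_filter, Finset.mem_range]
      unfold absorbPosInv
      grind
    · convert h₅ using 2
      ext i
      simp only [Finset.mem_filter, Finset.mem_range]
      unfold absorbPosInv
      grind
    · convert h₃ using 2
      ext i
      simp only [Finset.mem_filter, Finset.mem_range, Finset.mem_Ico]
      unfold absorbPosInv
      grind
  · rw [hfull, hA, ← Finset.image_union]
    congr 1
    ext i
    simp only [Finset.mem_union, Finset.mem_range, Finset.mem_Ico]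
    omega
  · have e1 := toFinset_take_drop_map_range F (N := 3 * d + l) (a := 0) (k := l) (by omega)
    have e2 := toFinset_take_drop_map_range (F ∘ absorbPos d l) (N := 4 * d + l) (a := 0) (k := l)
      (by omega)
    rw [List.drop_zero] at e1 e2
    rw [firstEnd, firstEnd, e1, e2, hG _ _ (by omega)]
    congr 1
    ext i
    simp only [Finset.mem_filter, Finset.mem_range, Finset.mem_Ico]
    unfold absorbPosInv
    grind
  · have e1 := toFinset_take_drop_map_range F (N := 3 * d + l) (a := 3 * d) (k := l) (by omega)
    have e2 := toFinset_take_drop_map_range (F ∘ absorbPos d l) (N := 4 * d + l) (a := 4 * d)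
      (k := l) (by omega)
    rw [List.take_of_length_le (by simp)] at e1 e2
    rw [lastEnd, lastEnd, List.length_map, List.length_map, List.length_range, List.length_range,
      Nat.add_sub_cancel, Nat.add_sub_cancel, e1, e2, hG _ _ (by omega)]
    congr 1
    ext i
    simp only [Finset.mem_filter, Finset.mem_range, Finset.mem_Ico]
    unfold absorbPosInv
    grind

lemma isPath_and_absorbs_of_mem {n d l : ℕ} (hl : 1 ≤ l) (hld : l < d) (hd : 3 ≤ d)
    {E : Finset (Finset (Fin n))} {S : Finset (Fin n)} {s : ℕ → Fin n}
    (hs : Set.InjOn s (Finset.range d)) (hsS : (Finset.range d).image s = S)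
    {f : Fin (3 * d + l) → Fin n} (hf : Function.Injective f) (hoff : ∀ i, f i ∉ S)
    (h₁ : (univ.filter fun i : Fin (3 * d + l) => (i : ℕ) < d + l).image f ∈ E)
    (h₂ : (univ.filter fun i : Fin (3 * d + l) => d ≤ (i : ℕ) ∧ (i : ℕ) < 2 * d + l).image f ∈ E)
    (h₃ : (univ.filter fun i : Fin (3 * d + l) => 2 * d ≤ (i : ℕ)).image f ∈ E)
    (h₄ : (univ.filter fun i : Fin (3 * d + l) =>
      (i : ℕ) + 1 = d ∨ (d < (i : ℕ) ∧ (i : ℕ) ≤ d + l)).image f ∪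
        (Finset.range (d - 1)).image s ∈ E)
    (h₅ : (univ.filter fun i : Fin (3 * d + l) =>
      (d + l < (i : ℕ) ∧ (i : ℕ) + 1 < 2 * d + l) ∨ (i : ℕ) = 2 * d + l).image f ∪
        (Finset.Ico (d - l - 1) d).image s ∈ E) :
    IsPath (d + l) l E (List.ofFn f) ∧ Disjoint S (List.ofFn f).toFinset ∧
      PathAbsorbs (d + l) l E (List.ofFn f) S := by
  classical
  set F : ℕ → Fin n := fun i => if h : i < 3 * d + l then f ⟨i, h⟩ else s (i - (3 * d + l)) with hF
  have hFf : ∀ i : Fin (3 * d + l), F i = f i := fun i => by simp [hF]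
  have hFs : ∀ i, F (3 * d + l + i) = s i := fun i => by simp [hF]
  have hsmem : ∀ i < d, s i ∈ S := fun i hi => by
    rw [← hsS]
    exact Finset.mem_image_of_mem s (Finset.mem_range.2 hi)
  have himg : ∀ (p : ℕ → Prop) [DecidablePred p], (univ.filter fun i : Fin (3 * d + l) => p i).image f =
      ((Finset.range (3 * d + l)).filter p).image F := by
    intro p _
    ext x
    simp only [Finset.mem_image, Finset.mem_filter, Finset.mem_univ, true_and, Finset.mem_range]
    constructor
    · rintro ⟨i, hi, rfl⟩
      exact ⟨i, ⟨i.2, hi⟩, hFf i⟩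
    · rintro ⟨i, ⟨hi, hp⟩, rfl⟩
      exact ⟨⟨i, hi⟩, hp, (hFf ⟨i, hi⟩).symm⟩
  have hsimg : ∀ a b, (Finset.Ico a b).image s =
      (Finset.Ico (3 * d + l + a) (3 * d + l + b)).image F := by
    intro a b
    ext x
    simp only [Finset.mem_image, Finset.mem_Ico]
    constructor
    · rintro ⟨i, hi, rfl⟩
      exact ⟨3 * d + l + i, by omega, hFs i⟩
    · rintro ⟨i, hi, rfl⟩
      refine ⟨i - (3 * d + l), by omega, ?_⟩
      rw [← hFs]
      congr 1
      omega
  have hlist : List.ofFn f = (List.range (3 * d + l)).map F := by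
    refine List.ext_getElem (by simp) fun i h1 h2 => ?_
    have hi : i < 3 * d + l := by simpa using h1
    simp [hF, hi]
  have hS : S = (Finset.Ico (3 * d + l) (4 * d + l)).image F := by
    have := hsimg 0 d
    rw [Nat.Ico_zero_eq_range, hsS] at this
    rw [this]
    congr 2
    omega
  have hinj : Set.InjOn F (Finset.range (4 * d + l)) := by
    intro i hi j hj hij
    simp only [Finset.coe_range, Set.mem_Iio] at hi hj
    by_cases hi' : i < 3 * d + l <;> by_cases hj' : j < 3 * d + l
    · simp only [hF, hi', hj', dif_pos] at hij
      exact congrArg Fin.val (hf hij)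
    · simp only [hF, hi', hj', dif_pos, dif_neg, not_false_eq_true] at hij
      exact absurd (hij ▸ hsmem _ (by omega)) (hoff ⟨i, hi'⟩)
    · simp only [hF, hi', hj', dif_pos, dif_neg, not_false_eq_true] at hij
      exact absurd (hij ▸ hsmem _ (by omega)) (hoff ⟨j, hj'⟩)
    · simp only [hF, hi', hj', dif_neg, not_false_eq_true] at hij
      have := hs (by simp; omega) (by simp; omega) hij
      omega
  rw [himg (fun i => i < d + l)] at h₁
  rw [himg (fun i => d ≤ i ∧ i < 2 * d + l)] at h₂
  rw [himg (fun i => 2 * d ≤ i)] at h₃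
  rw [himg (fun i => i + 1 = d ∨ (d < i ∧ i ≤ d + l)), Finset.range_eq_Ico (a := d - 1), hsimg,
    ← Finset.image_union] at h₄
  rw [himg (fun i => (d + l < i ∧ i + 1 < 2 * d + l) ∨ i = 2 * d + l), hsimg,
    ← Finset.image_union] at h₅
  have key := isPath_and_pathAbsorbs hl hld hd hinj (E := E) ?_ ?_ ?_ ?_ ?_
  · rw [← hlist, ← hS] at key
    refine ⟨key.1, ?_, key.2⟩
    rw [Finset.disjoint_right]
    intro x hx
    simp only [List.mem_toFinset, List.mem_ofFn] at hx
    obtain ⟨i, rfl⟩ := hx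
    exact hoff i
  · convert h₁ using 2
    ext i
    simp only [Finset.mem_filter, Finset.mem_range, Finset.mem_Ico]
    omega
  · convert h₂ using 2
    ext i
    simp only [Finset.mem_filter, Finset.mem_range, Finset.mem_Ico]
    omega
  · convert h₃ using 2
    ext i
    simp only [Finset.mem_filter, Finset.mem_range, Finset.mem_Ico]
    omega
  · convert h₄ using 2
    ext i
    simp only [Finset.mem_filter, Finset.mem_range, Finset.mem_Ico, Finset.mem_union]
    omega
  · convert h₅ using 2
    ext i
    simp only [Finset.mem_filter, Finset.mem_range, Finset.mem_Ico, Finset.mem_union]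
    omega

lemma card_filter_fin_Ico {q a b : ℕ} (hb : b ≤ q) :
    (univ.filter fun i : Fin q => a ≤ (i : ℕ) ∧ (i : ℕ) < b).card = b - a := by
  rw [← Nat.card_Ico, ← Finset.card_image_of_injective _ Fin.val_injective]
  congr 1
  ext i
  simp only [Finset.mem_image, Finset.mem_filter, Finset.mem_univ, true_and, Finset.mem_Ico]
  constructor
  · rintro ⟨j, hj, rfl⟩
    exact hj
  · intro hi
    exact ⟨⟨i, by omega⟩, hi, rfl⟩

/-- The counting bound behind the absorbing lemma, for the relative pair density `c`. -/
lemma pow_mul_le_ncard_absorbing {n d l : ℕ} (hl : 1 ≤ l) (hld : l < d) (hd : 3 ≤ d)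
    {E : Finset (Finset (Fin n))} (hE : ∀ e ∈ E, e.card = d + l) {c D : ℝ} (hc0 : 0 ≤ c)
    (hD : ∀ W : Finset (Fin n), W.card = d + l - 2 → D ≤ (degH E W : ℝ))
    {S : Finset (Fin n)} (hS : S.card = d)
    (hc : c * (n : ℝ) ^ 2 ≤ D - 2 * ((3 * d + l + d : ℕ) : ℝ) * n) (hn0 : 0 < n)
    (hn : 2 * ((3 * d + l) * (3 * d + l + d)) ≤ n) :
    c ^ 5 * ((n : ℝ) ^ (3 * d + l) / 2) ≤
      (Set.ncard {f : Fin (3 * d + l) → Fin n |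
        IsPath (d + l) l E (List.ofFn f) ∧ Disjoint S (List.ofFn f).toFinset ∧
          PathAbsorbs (d + l) l E (List.ofFn f) S} : ℝ) := by
  classical
  have : Nonempty (Fin n) := ⟨⟨0, hn0⟩⟩
  obtain ⟨s, hs⟩ := (Finset.finite_toSet (Finset.range d)).exists_bijOn_of_encard_eq
    (t := (S : Set (Fin n))) (by
      rw [Set.encard_coe_eq_coe_finsetCard, Set.encard_coe_eq_coe_finsetCard, hS,
        Finset.card_range])
  have hsS : (Finset.range d).image s = S := by
    rw [← Finset.coe_inj, Finset.coe_image, hs.image_eq]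
  have hsi := hs.injOn
  have hk : 2 ≤ d + l := by omega
  have hc' : c * (n : ℝ) ^ 2 ≤
      D - 2 * ((Fintype.card (Fin (3 * d + l)) + S.card : ℕ) : ℝ) * n := by
    rwa [Fintype.card_fin, hS]
  set S₁ := (Finset.range (d - 1)).image s with hS₁
  set S₂ := (Finset.Ico (d - l - 1) d).image s with hS₂
  have hS₁S : S₁ ⊆ S := by
    rw [← hsS]
    exact Finset.image_subset_image (Finset.range_subset_range.2 (by omega))
  have hS₂S : S₂ ⊆ S := by
    rw [← hsS]
    refine Finset.image_subset_image fun i hi => ?_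
    simp only [Finset.mem_Ico, Finset.mem_range] at hi ⊢
    omega
  have hS₁c : S₁.card = d - 1 := by
    rw [hS₁, Finset.card_image_of_injOn, Finset.card_range]
    exact hsi.mono (by simp)
  have hS₂c : S₂.card = l + 1 := by
    rw [hS₂, Finset.card_image_of_injOn, Nat.card_Ico]
    · omega
    · refine hsi.mono fun i hi => ?_
      simp only [Finset.coe_Ico, Finset.coe_range, Set.mem_Ico, Set.mem_Iio] at hi ⊢
      omega
  set J₁ := univ.filter fun i : Fin (3 * d + l) => (i : ℕ) < d + l with hJ₁
  set J₂ := univ.filter fun i : Fin (3 * d + l) => d ≤ (i : ℕ) ∧ (i : ℕ) < 2 * d + l with hJ₂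
  set J₃ := univ.filter fun i : Fin (3 * d + l) => 2 * d ≤ (i : ℕ) with hJ₃
  set J₄ := univ.filter fun i : Fin (3 * d + l) =>
    (i : ℕ) + 1 = d ∨ (d < (i : ℕ) ∧ (i : ℕ) ≤ d + l) with hJ₄
  set J₅ := univ.filter fun i : Fin (3 * d + l) =>
    (d + l < (i : ℕ) ∧ (i : ℕ) + 1 < 2 * d + l) ∨ (i : ℕ) = 2 * d + l with hJ₅
  set T₄ := univ.filter fun i : Fin (3 * d + l) => (i : ℕ) + 2 < 3 * d + l with hT₄
  set T₃ := T₄.filter fun i : Fin (3 * d + l) => 2 ≤ (i : ℕ) with hT₃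
  set T₂ := T₃.filter fun i : Fin (3 * d + l) => (i : ℕ) ≠ d ∧ (i : ℕ) + 1 ≠ 2 * d + l with hT₂
  set T₁ := T₂.filter fun i : Fin (3 * d + l) => (i : ℕ) ≠ d + l + 1 ∧ (i : ℕ) ≠ 2 * d + l with hT₁
  set T₀ := T₁.filter fun i : Fin (3 * d + l) => (i : ℕ) + 1 ≠ d ∧ (i : ℕ) ≠ d + l with hT₀
  have b₀ := half_pow_le_card_admissible E S T₀ hn0 (by rwa [hS])
  have b₁ : c * ((admissible E S T₀ []).card : ℝ) ≤
      ((admissible E S T₁ [(J₄, S₁)]).card : ℝ) := by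
    refine mul_card_admissible_le hk hE hD hS₁S (J := univ.filter fun i : Fin (3 * d + l) =>
      d + 1 ≤ (i : ℕ) ∧ (i : ℕ) < d + l) (a := ⟨d - 1, by omega⟩) (b := ⟨d + l, by omega⟩) []
      ?_ ?_ ?_ ?_ ?_ ?_ ?_ ?_ hc' hn0
    · simp
    · simp only [ne_eq, Fin.mk.injEq]; omega
    · simp [T₀]; omega
    · simp [T₀]
    · ext i; simp [T₀, T₁, T₂, T₃, T₄, Fin.ext_iff]; omega
    · intro i; simp [T₀, T₁, T₂, T₃, T₄]; omega
    · ext i; simp [J₄, Fin.ext_iff]; omega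
    · rw [card_filter_fin_Ico (by omega), hS₁c]; omega
  have b₂ : c * ((admissible E S T₁ [(J₄, S₁)]).card : ℝ) ≤
      ((admissible E S T₂ [(J₅, S₂), (J₄, S₁)]).card : ℝ) := by
    refine mul_card_admissible_le hk hE hD hS₂S (J := univ.filter fun i : Fin (3 * d + l) =>
      d + l + 2 ≤ (i : ℕ) ∧ (i : ℕ) < 2 * d + l - 1) (a := ⟨d + l + 1, by omega⟩)
      (b := ⟨2 * d + l, by omega⟩) _ ?_ ?_ ?_ ?_ ?_ ?_ ?_ ?_ hc' hn0
    · simp only [List.forall_mem_cons, List.not_mem_nil, false_imp_iff, implies_true, and_true]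
      intro i; simp [J₄, T₁, T₂, T₃, T₄]; omega
    · simp only [ne_eq, Fin.mk.injEq]; omega
    · simp [T₁]
    · simp [T₁]
    · ext i; simp [T₁, T₂, T₃, T₄, Fin.ext_iff]; omega
    · intro i; simp [T₁, T₂, T₃, T₄]; omega
    · ext i; simp [J₅, Fin.ext_iff]; omega
    · rw [card_filter_fin_Ico (by omega), hS₂c]; omega
  have b₃ : c * ((admissible E S T₂ [(J₅, S₂), (J₄, S₁)]).card : ℝ) ≤
      ((admissible E S T₃ [(J₂, ∅), (J₅, S₂), (J₄, S₁)]).card : ℝ) := by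
    refine mul_card_admissible_le hk hE hD (Finset.empty_subset S)
      (J := univ.filter fun i : Fin (3 * d + l) =>
      d + 1 ≤ (i : ℕ) ∧ (i : ℕ) < 2 * d + l - 1) (a := ⟨d, by omega⟩)
      (b := ⟨2 * d + l - 1, by omega⟩) _ ?_ ?_ ?_ ?_ ?_ ?_ ?_ ?_ hc' hn0
    · simp only [List.forall_mem_cons, List.not_mem_nil, false_imp_iff, implies_true, and_true]
      refine ⟨fun i => ?_, fun i => ?_⟩
      · simp [J₅, T₂, T₃, T₄]; omega
      · simp [J₄, T₂, T₃, T₄]; omega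
    · simp only [ne_eq, Fin.mk.injEq]; omega
    · simp [T₂]
    · simp [T₂]; omega
    · ext i; simp [T₂, T₃, T₄, Fin.ext_iff]; omega
    · intro i; simp [T₂, T₃, T₄]; omega
    · ext i; simp [J₂, Fin.ext_iff]; omega
    · rw [card_filter_fin_Ico (by omega), Finset.card_empty]; omega
  have b₄ : c * ((admissible E S T₃ [(J₂, ∅), (J₅, S₂), (J₄, S₁)]).card : ℝ) ≤
      ((admissible E S T₄ [(J₁, ∅), (J₂, ∅), (J₅, S₂), (J₄, S₁)]).card : ℝ) := by
    refine mul_card_admissible_le hk hE hD (Finset.empty_subset S)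
      (J := univ.filter fun i : Fin (3 * d + l) =>
      2 ≤ (i : ℕ) ∧ (i : ℕ) < d + l) (a := ⟨0, by omega⟩)
      (b := ⟨1, by omega⟩) _ ?_ ?_ ?_ ?_ ?_ ?_ ?_ ?_ hc' hn0
    · simp only [List.forall_mem_cons, List.not_mem_nil, false_imp_iff, implies_true, and_true]
      refine ⟨fun i => ?_, fun i => ?_, fun i => ?_⟩
      · simp [J₂, T₃, T₄]; omega
      · simp [J₅, T₃, T₄]; omega
      · simp [J₄, T₃, T₄]; omega
    · simp only [ne_eq, Fin.mk.injEq]; omega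
    · simp [T₃]
    · simp [T₃]
    · ext i; simp [T₃, T₄, Fin.ext_iff]; omega
    · intro i; simp [T₃, T₄]; omega
    · ext i; simp [J₁, Fin.ext_iff]; omega
    · rw [card_filter_fin_Ico (by omega), Finset.card_empty]; omega
  have b₅ : c * ((admissible E S T₄ [(J₁, ∅), (J₂, ∅), (J₅, S₂), (J₄, S₁)]).card : ℝ) ≤
      ((admissible E S univ [(J₃, ∅), (J₁, ∅), (J₂, ∅), (J₅, S₂), (J₄, S₁)]).card : ℝ) := by
    refine mul_card_admissible_le hk hE hD (Finset.empty_subset S)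
      (J := univ.filter fun i : Fin (3 * d + l) =>
      2 * d ≤ (i : ℕ) ∧ (i : ℕ) < 3 * d + l - 2) (a := ⟨3 * d + l - 2, by omega⟩)
      (b := ⟨3 * d + l - 1, by omega⟩) _ ?_ ?_ ?_ ?_ ?_ ?_ ?_ ?_ hc' hn0
    · simp only [List.forall_mem_cons, List.not_mem_nil, false_imp_iff, implies_true, and_true]
      refine ⟨fun i => ?_, fun i => ?_, fun i => ?_, fun i => ?_⟩
      · simp [J₁, T₄]; omega
      · simp [J₂, T₄]; omega
      · simp [J₅, T₄]; omega
      · simp [J₄, T₄]; omega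
    · simp only [ne_eq, Fin.mk.injEq]; omega
    · simp [T₄]; omega
    · simp [T₄]; omega
    · ext i; simp [T₄, Fin.ext_iff]; omega
    · intro i; simp [T₄]; omega
    · ext i; simp [J₃, Fin.ext_iff]; omega
    · rw [card_filter_fin_Ico (by omega), Finset.card_empty]; omega
  have hsub : ((admissible E S univ
      [(J₃, ∅), (J₁, ∅), (J₂, ∅), (J₅, S₂), (J₄, S₁)] : Finset _) : Set _) ⊆
      {f : Fin (3 * d + l) → Fin n |
        IsPath (d + l) l E (List.ofFn f) ∧ Disjoint S (List.ofFn f).toFinset ∧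
          PathAbsorbs (d + l) l E (List.ofFn f) S} := by
    intro f hf
    simp only [admissible, Finset.coe_filter, Set.mem_ofPred_eq, Finset.mem_univ, true_and,
      List.forall_mem_cons, Finset.union_empty, Finset.coe_univ, Set.injOn_univ,
      forall_const] at hf
    obtain ⟨hinj, hoff, h3, h1, h2, h5, h4, -⟩ := hf
    exact isPath_and_absorbs_of_mem hl hld hd hsi hsS hinj hoff h1 h2 h3 h4 h5
  have hfin := Set.ncard_le_ncard hsub (Set.toFinite _)
  rw [Set.ncard_coe_finset] at hfin
  refine le_trans ?_ (Nat.cast_le.2 hfin)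
  calc c ^ 5 * ((n : ℝ) ^ (3 * d + l) / 2)
      = c * (c * (c * (c * (c * ((n : ℝ) ^ (3 * d + l) / 2))))) := by ring
    _ ≤ c * (c * (c * (c * (c * ((admissible E S T₀ []).card : ℝ))))) := by gcongr
    _ ≤ c * (c * (c * (c * ((admissible E S T₁ [(J₄, S₁)]).card : ℝ)))) := by gcongr
    _ ≤ c * (c * (c * ((admissible E S T₂ [(J₅, S₂), (J₄, S₁)]).card : ℝ))) := by gcongr
    _ ≤ c * (c * ((admissible E S T₃ [(J₂, ∅), (J₅, S₂), (J₄, S₁)]).card : ℝ)) := by gcongr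
    _ ≤ c * ((admissible E S T₄ [(J₁, ∅), (J₂, ∅), (J₅, S₂), (J₄, S₁)]).card : ℝ) := by gcongr
    _ ≤ _ := b₅

theorem stmt5 (η : ℝ) (hη : 0 < η) (k l : ℕ) (hk : 4 ≤ k) (hl1 : 1 ≤ l)
    (hl2 : 2 * l < k) :
    ∃ n₀ : ℕ, ∀ n : ℕ, n₀ ≤ n →
      ∀ E : Finset (Finset (Fin n)), (∀ e ∈ E, e.card = k) →
        (∀ S : Finset (Fin n), S.card = k - 2 →
          η * (Nat.choose n 2) ≤ (degH E S : ℝ)) →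
        ∀ S : Finset (Fin n), S.card = k - l →
          (η / (4 * (Nat.factorial k : ℝ))) ^ 5 * (n : ℝ) ^ (3 * k - 2 * l) ≤
            (Set.ncard {f : Fin (3 * k - 2 * l) → Fin n |
              IsPath k l E (List.ofFn f) ∧ Disjoint S (List.ofFn f).toFinset ∧
                PathAbsorbs k l E (List.ofFn f) S} : ℝ) := by
  obtain ⟨d, rfl⟩ : ∃ d, k = d + l := ⟨k - l, by omega⟩
  generalize hq : 3 * (d + l) - 2 * l = q
  obtain rfl : q = 3 * d + l := by omega
  set M : ℕ := 3 * d + l + d with hM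
  obtain ⟨m, hm⟩ := exists_nat_ge (16 * (M : ℝ) / η)
  refine ⟨2 * ((3 * d + l) * M) + m + 2, fun n hn E hE hdeg S hS => ?_⟩
  set t : ℝ := η / (4 * (Nat.factorial (d + l) : ℝ)) with ht
  have hfact : (24 : ℝ) ≤ (Nat.factorial (d + l) : ℝ) := by
    have : Nat.factorial 4 ≤ Nat.factorial (d + l) := Nat.factorial_le hk
    exact_mod_cast this
  have ht0 : 0 ≤ t := by positivity
  have htη : t ≤ η / 96 := by
    rw [ht]
    gcongr
    linarith
  have hn2 : (2 : ℝ) ≤ n := by exact_mod_cast (by omega : 2 ≤ n)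
  have hMn : 16 * (M : ℝ) ≤ η * n := by
    have h1 : (m : ℝ) ≤ n := by exact_mod_cast (by omega : m ≤ n)
    rw [div_le_iff₀ hη] at hm
    nlinarith
  have hc : 2 * t * (n : ℝ) ^ 2 ≤ η * (Nat.choose n 2) - 2 * (M : ℝ) * n := by
    rw [Nat.cast_choose_two]
    have h1 : 2 * t * (n : ℝ) ^ 2 ≤ η / 48 * (n : ℝ) ^ 2 := by
      gcongr
      linarith
    have h2 : 16 * (M : ℝ) * n ≤ η * n * n := by gcongr
    have h3 : 0 ≤ η * (n * (n - 2)) := by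
      have : (0 : ℝ) ≤ n - 2 := by linarith
      positivity
    nlinarith
  have key := pow_mul_le_ncard_absorbing hl1 (by omega) (by omega) hE (c := 2 * t) (by positivity)
    hdeg (S := S) (by omega) hc (by omega)
    (by rw [← hM]; omega)
  refine le_trans ?_ key
  have hpos : 0 ≤ t ^ 5 * (n : ℝ) ^ (3 * d + l) := by positivity
  calc t ^ 5 * (n : ℝ) ^ (3 * d + l) ≤ 16 * (t ^ 5 * (n : ℝ) ^ (3 * d + l)) := by linarith
    _ = _ := by ring
end
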